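/- Let K : (0,∞)⁴ → [0,∞) be a continuous coagulation kernel that is symmetric and satisfies the power-law bounds with exponents α, β, and let r be an admissible fusion kernel with exponents μ > 0 and σ. Let f_in be a nonnegative Radon measure on (0,∞)² supported in {a ≥ c₀ v^{2/3}} with ∫ (v^{−μ−3} + v^{μ+3} + v^{σ(μ+3)} + a^{μ+3}) df_in(a,v) < ∞, and let T > 0. Then for every ε ∈ (0,1) there exists a weak solution f_ε of the ε-fusion coagulation problem with initial datum f_in, and there is a constant C(T) > 0 independent of ε ∈ (0,1) such that sup_{t∈[0,T]} ∫ (v^{−μ−3} + v^{μ+3} + v^{σ(μ+3)} + a^{μ+3}) df_ε(t)(a,v) ≤ C(T). Moreover, there exist a sequence ε_n → 0 and a map f̄ ∈ C((0,T]; 𝓜^I₊) such that f_{ε_n}(t) → f̄(t) in the weak-* topology of measures for every t ∈ [σ̄, T] and every σ̄ > 0. -/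

import Mathlib

open MeasureTheory Real Set Filter Topology
open scoped ENNReal

noncomputable section

/-- `c₀ = (36π)^(1/3)`, the isoperimetric constant relating area and volume of a ball. -/
def c0 : ℝ := (36 * Real.pi) ^ ((1 : ℝ) / 3)

/-- The open quadrant `(0,∞)²` of pairs `(a,v)` (surface area, volume). -/
def Quad : Set (ℝ × ℝ) := {p | 0 < p.1 ∧ 0 < p.2}

/-- The isoperimetric region `{(a,v) : v > 0, a ≥ c₀ v^(2/3)}`. -/
def IsoRegion : Set (ℝ × ℝ) := {p | 0 < p.2 ∧ c0 * p.2 ^ ((2 : ℝ) / 3) ≤ p.1}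

/-- A nonnegative (Radon) measure on `(0,∞)²` supported in `{a ≥ c₀ v^(2/3)}`:
it gives zero mass to the complement of the isoperimetric region. -/
def IsIsoMeasure (m : Measure (ℝ × ℝ)) : Prop := m IsoRegionᶜ = 0

/-- `C₀((0,∞)²)`: continuous functions vanishing at infinity of the open quadrant
(extended by zero outside the quadrant). -/
def IsC0Quad (φ : ℝ × ℝ → ℝ) : Prop :=
  Continuous φ ∧ (∀ p, p ∉ Quad → φ p = 0) ∧
    ∀ δ > 0, ∃ Kc : Set (ℝ × ℝ), IsCompact Kc ∧ Kc ⊆ Quad ∧ ∀ p ∉ Kc, |φ p| ≤ δ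

/-- `C_c((0,∞)²)`: continuous functions with compact support contained in the quadrant. -/
def IsCcQuad (φ : ℝ × ℝ → ℝ) : Prop :=
  Continuous φ ∧ HasCompactSupport φ ∧ tsupport φ ⊆ Quad

/-- `C₀((0,∞))`: continuous functions on `(0,∞)` vanishing at infinity (extended by zero). -/
def IsC0Pos (φ : ℝ → ℝ) : Prop :=
  Continuous φ ∧ (∀ v, v ∉ Ioi (0 : ℝ) → φ v = 0) ∧
    ∀ δ > 0, ∃ Kc : Set ℝ, IsCompact Kc ∧ Kc ⊆ Ioi (0 : ℝ) ∧ ∀ v ∉ Kc, |φ v| ≤ δ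

/-- `C_c((0,∞))`: continuous functions with compact support contained in `(0,∞)`. -/
def IsCcPos (φ : ℝ → ℝ) : Prop :=
  Continuous φ ∧ HasCompactSupport φ ∧ tsupport φ ⊆ Ioi (0 : ℝ)

/-- Partial derivative in the area variable `a`. -/
def da (φ : ℝ × ℝ → ℝ) (p : ℝ × ℝ) : ℝ := deriv (fun a => φ (a, p.2)) p.1

/-- Time-dependent test functions `φ ∈ C¹_c([0,∞); C¹_c((0,∞)²))`. -/
def IsTestFun (ψ : ℝ × (ℝ × ℝ) → ℝ) : Prop :=
  ContDiff ℝ 1 ψ ∧ HasCompactSupport ψ ∧ ∀ q : ℝ × (ℝ × ℝ), q.2 ∉ Quad → ψ q = 0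

/-- The assumptions on the coagulation kernel `K`: continuity, symmetry, and the
two-sided power law bounds with constants `K₀ ≥ K₁ > 0` and exponents
`al > 0`, `be ∈ (0,1)`, `be - al ∈ (0,1)`. -/
structure IsCoagKernel (K : ℝ × ℝ → ℝ × ℝ → ℝ) (K₀ K₁ al be : ℝ) : Prop where
  cont : ContinuousOn (fun q : (ℝ × ℝ) × (ℝ × ℝ) => K q.1 q.2) (Quad ×ˢ Quad)
  symm : ∀ η η', K η η' = K η' η
  K1_pos : 0 < K₁
  K1_le_K0 : K₁ ≤ K₀
  al_pos : 0 < al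
  be_mem : be ∈ Ioo (0 : ℝ) 1
  be_sub_al_mem : be - al ∈ Ioo (0 : ℝ) 1
  lower : ∀ η ∈ Quad, ∀ η' ∈ Quad,
    K₁ * (η.2 ^ (-al) * η'.2 ^ be + η'.2 ^ (-al) * η.2 ^ be) ≤ K η η'
  upper : ∀ η ∈ Quad, ∀ η' ∈ Quad,
    K η η' ≤ K₀ * (η.2 ^ (-al) * η'.2 ^ be + η'.2 ^ (-al) * η.2 ^ be)

/-- The assumptions on an admissible fusion kernel `r`: positivity, `C¹` regularity,
two-sided power law bounds `R₀ a^mu v^sg ≤ r ≤ R₁ a^mu v^sg`, and the structural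
differential inequalities on the isoperimetric region. -/
structure IsFusionKernel (r : ℝ × ℝ → ℝ) (R₀ R₁ mu sg B : ℝ) : Prop where
  smooth : ContDiffOn ℝ 1 r Quad
  pos : ∀ η ∈ Quad, 0 < r η
  R0_pos : 0 < R₀
  R1_pos : 0 < R₁
  B_pos : 0 < B
  lower : ∀ η ∈ Quad, R₀ * η.1 ^ mu * η.2 ^ sg ≤ r η
  upper : ∀ η ∈ Quad, r η ≤ R₁ * η.1 ^ mu * η.2 ^ sg
  cond_pos : 0 < mu → ∀ η ∈ IsoRegion, 0 ≤ da r η - mu * η.1⁻¹ * r η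
  cond_nonpos : mu ≤ 0 → ∀ η ∈ IsoRegion,
    0 ≤ da r η * (η.1 - c0 * η.2 ^ ((2 : ℝ) / 3)) + r η
  cond_upper : ∀ η ∈ IsoRegion, da r η ≤ B * η.1⁻¹ * r η

/-- The weak identity at time `t` against the test function `ψ`, for the
fusion–coagulation equation with fusion coefficient `c` (the `Λ`-fusion problem
corresponds to `c = Λ⁻¹`). -/
def WeakIdentity (K : ℝ × ℝ → ℝ × ℝ → ℝ) (r : ℝ × ℝ → ℝ) (c : ℝ)
    (fin : Measure (ℝ × ℝ)) (f : ℝ → Measure (ℝ × ℝ))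
    (ψ : ℝ × (ℝ × ℝ) → ℝ) (t : ℝ) : Prop :=
  (∫ η, ψ (t, η) ∂(f t)) - (∫ η, ψ (0, η) ∂fin)
      - ∫ s in (0 : ℝ)..t, ∫ η, deriv (fun u => ψ (u, η)) s ∂(f s)
    = (∫ s in (0 : ℝ)..t, (1 / 2) *
        ∫ η, ∫ η', K η η' * (ψ (s, η + η') - ψ (s, η) - ψ (s, η')) ∂(f s) ∂(f s))
      + c * ∫ s in (0 : ℝ)..t,
          ∫ η, r η * (c0 * η.2 ^ ((2 : ℝ) / 3) - η.1) * da (fun p => ψ (s, p)) η ∂(f s)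

/-- A weak solution of the fusion–coagulation problem with fusion coefficient `c`
(power-law exponents `al`, `be` of the coagulation kernel enter the a priori moment
bound), initial datum `fin`: a weak-* continuous family of measures supported in the
isoperimetric region, with locally uniformly bounded `(v^(-al) + v^be)`-moments,
satisfying the weak identity for all test functions and times. -/
def IsWeakSolution (K : ℝ × ℝ → ℝ × ℝ → ℝ) (r : ℝ × ℝ → ℝ) (c al be : ℝ)
    (fin : Measure (ℝ × ℝ)) (f : ℝ → Measure (ℝ × ℝ)) : Prop :=
  (∀ t, 0 ≤ t → IsIsoMeasure (f t)) ∧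
  (∀ φ, IsC0Quad φ → ContinuousOn (fun t => ∫ η, φ η ∂(f t)) (Ici (0 : ℝ))) ∧
  (∀ T > (0 : ℝ), ∃ C : ℝ≥0∞, C ≠ ⊤ ∧ ∀ t ∈ Icc (0 : ℝ) T,
      (∫⁻ η, ENNReal.ofReal (η.2 ^ (-al) + η.2 ^ be) ∂(f t)) ≤ C) ∧
  (∀ ψ, IsTestFun ψ → ∀ t, 0 ≤ t → WeakIdentity K r c fin f ψ t)

/-- The regularized fusion kernel `r̄_ε(a,v) = r(a,v)/(1 + ε^(2μ+2) a^μ)`. -/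
def rbarFn (r : ℝ × ℝ → ℝ) (mu ε : ℝ) (η : ℝ × ℝ) : ℝ :=
  r η / (1 + ε ^ (2 * mu + 2) * η.1 ^ mu)

end

section WeakConvergence

open scoped NNReal BoundedContinuousFunction

variable {X : Type*} [MeasurableSpace X]

/-- On a separable metrizable space the weak topology on finite measures is pseudometrizable. -/
theorem FiniteMeasure.pseudoMetrizableSpace_of_separable [Nonempty X] [TopologicalSpace X]
    [TopologicalSpace.PseudoMetrizableSpace X] [TopologicalSpace.SeparableSpace X] [BorelSpace X] :
    TopologicalSpace.PseudoMetrizableSpace (FiniteMeasure X) := by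
  obtain ⟨x₀⟩ := ‹Nonempty X›
  let d : FiniteMeasure X := ⟨Measure.dirac x₀, inferInstance⟩
  have hd : ∀ f : FiniteMeasure X, f + d ≠ 0 := by
    intro f h
    have h1 : ((f + d : FiniteMeasure X) : Measure X) univ = 0 := by rw [h]; simp
    rw [FiniteMeasure.toMeasure_add] at h1
    simp [d] at h1
  let J : FiniteMeasure X → ProbabilityMeasure X × ℝ≥0 := fun f => ((f + d).normalize, f.mass)
  have hm : ∀ f : FiniteMeasure X, (f + d).mass = f.mass + d.mass := fun f => by
    rw [FiniteMeasure.mass, FiniteMeasure.coeFn_add]; rfl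
  have hJ : IsInducing J := by
    rw [isInducing_iff_nhds]
    intro f
    apply le_antisymm
    · rw [← tendsto_iff_comap]
      refine Tendsto.prodMk_nhds ?_ (FiniteMeasure.continuous_mass.tendsto f)
      exact FiniteMeasure.tendsto_normalize_of_tendsto
        ((continuous_id.add continuous_const).tendsto f) (hd f)
    · have hT : Tendsto J (comap J (𝓝 (J f))) (𝓝 (J f)) := tendsto_comap
      have h1 := (continuous_fst.tendsto _).comp hT
      have h2 := (continuous_snd.tendsto _).comp hT
      have h3 : Tendsto (fun g => g + d) (comap J (𝓝 (J f))) (𝓝 (f + d)) := by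
        rw [← FiniteMeasure.tendsto_normalize_iff_tendsto (hd f)]
        refine ⟨h1, ?_⟩
        simp only [hm]
        exact h2.add tendsto_const_nhds
      have h4 : Tendsto (fun g => g) (comap J (𝓝 (J f))) (𝓝 f) := by
        rw [FiniteMeasure.tendsto_iff_forall_integral_tendsto] at h3 ⊢
        intro φ
        have h5 := h3 φ
        have h6 : ∀ g : FiniteMeasure X, ∫ x, φ x ∂((g + d : FiniteMeasure X) : Measure X)
            = ∫ x, φ x ∂(g : Measure X) + ∫ x, φ x ∂(d : Measure X) := fun g => by
          rw [FiniteMeasure.toMeasure_add]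
          exact integral_add_measure (φ.integrable _) (φ.integrable _)
        simp only [h6] at h5
        simpa using h5.sub_const (∫ x, φ x ∂(d : Measure X))
      exact h4
  exact hJ.pseudoMetrizableSpace

/-- Weak convergence of finite measures can be tested on bounded Lipschitz functions. -/
theorem FiniteMeasure.tendsto_of_forall_lipschitz [PseudoMetricSpace X] [BorelSpace X]
    {ι : Type*} {l : Filter ι} [l.IsCountablyGenerated]
    {μs : ι → FiniteMeasure X} {μ : FiniteMeasure X}
    (h : ∀ (φ : X →ᵇ ℝ) (L : ℝ≥0), LipschitzWith L φ →
      Tendsto (fun i => ∫ x, φ x ∂(μs i : Measure X)) l (𝓝 (∫ x, φ x ∂(μ : Measure X)))) :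
    Tendsto μs l (𝓝 μ) := by
  have hm : Tendsto (fun i => (μs i).mass) l (𝓝 μ.mass) := by
    have := h (BoundedContinuousFunction.const X 1) 0 (LipschitzWith.const 1)
    simpa [FiniteMeasure.mass] using this
  by_cases h0 : μ = 0
  · subst h0
    exact FiniteMeasure.tendsto_zero_of_tendsto_zero_mass (by simpa using hm)
  · have : Nonempty X := by
      by_contra hne
      rw [not_nonempty_iff] at hne
      apply h0
      apply FiniteMeasure.toMeasure_injective
      simp [Measure.eq_zero_of_isEmpty]
    have hmne : μ.mass ≠ 0 := (FiniteMeasure.mass_nonzero_iff μ).2 h0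
    rw [← FiniteMeasure.tendsto_normalize_iff_tendsto h0]
    refine ⟨?_, hm⟩
    rw [tendsto_iff_forall_lipschitz_integral_tendsto]
    rintro φ ⟨C, hC⟩ ⟨L, hL⟩
    let φb : X →ᵇ ℝ := ⟨⟨φ, hL.continuous⟩, C, hC⟩
    have h1 := h φb L hL
    have h2 : Tendsto (fun i => ((μs i).mass : ℝ)⁻¹ * ∫ x, φ x ∂(μs i : Measure X)) l
        (𝓝 ((μ.mass : ℝ)⁻¹ * ∫ x, φ x ∂(μ : Measure X))) := by
      refine Tendsto.mul (Tendsto.inv₀ ?_ ?_) h1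
      · exact (NNReal.continuous_coe.tendsto _).comp hm
      · exact_mod_cast hmne
    have key : ∀ ν : FiniteMeasure X, ν ≠ 0 →
        ∫ x, φ x ∂(ν.normalize : Measure X) = (ν.mass : ℝ)⁻¹ * ∫ x, φ x ∂(ν : Measure X) := by
      intro ν hν
      rw [← FiniteMeasure.average_eq_integral_normalize _ hν, average_eq]
      rfl
    rw [key μ h0]
    refine h2.congr' ?_
    have : ∀ᶠ i in l, (μs i).mass ≠ 0 := hm.eventually_ne hmne
    filter_upwards [this] with i hi
    rw [key _ ((FiniteMeasure.mass_nonzero_iff _).1 hi)]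

theorem FiniteMeasure.tendsto_prod_self [Nonempty X] [TopologicalSpace X]
    [TopologicalSpace.PseudoMetrizableSpace X] [SecondCountableTopology X] [BorelSpace X]
    {ι : Type*} {l : Filter ι} {μs : ι → FiniteMeasure X} {μ : FiniteMeasure X}
    (h : Tendsto μs l (𝓝 μ)) :
    Tendsto (fun i => (μs i).prod (μs i)) l (𝓝 (μ.prod μ)) := by
  have hm : Tendsto (fun i => (μs i).mass) l (𝓝 μ.mass) := h.mass
  by_cases h0 : μ = 0
  · subst h0
    simp only [FiniteMeasure.zero_prod]
    refine FiniteMeasure.tendsto_zero_of_tendsto_zero_mass ?_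
    simp only [FiniteMeasure.mass_prod]
    simpa using hm.mul hm
  · have h1 := FiniteMeasure.tendsto_normalize_of_tendsto h h0
    have h2 := (ProbabilityMeasure.continuous_prod.tendsto (μ.normalize, μ.normalize)).comp
      (h1.prodMk_nhds h1)
    have h3 := (ProbabilityMeasure.toFiniteMeasure_continuous.tendsto _).comp h2
    have h4 := (hm.mul hm).smul h3
    have key : ∀ ν : FiniteMeasure X,
        ν.prod ν = (ν.mass * ν.mass) • (ν.normalize.prod ν.normalize).toFiniteMeasure := by
      intro ν
      apply FiniteMeasure.toMeasure_injective
      have h5 : (ν : Measure X) = ν.mass • (ν.normalize : Measure X) := by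
        conv_lhs => rw [ν.self_eq_mass_smul_normalize]
        rfl
      rw [FiniteMeasure.toMeasure_prod, FiniteMeasure.toMeasure_smul]
      conv_lhs => rw [h5]
      rw [Measure.prod_smul_left, Measure.prod_smul_right, smul_smul]
      rfl
    simp only [key]
    exact h4

/-- Arzelà–Ascoli type compactness for families of finite measures: pointwise relative compactness
and asymptotic equicontinuity against bounded Lipschitz functions give a subsequence converging at
every parameter, with continuous limit. -/
theorem FiniteMeasure.exists_subseq_tendsto [Nonempty X] [PseudoMetricSpace X]
    [TopologicalSpace.SeparableSpace X] [BorelSpace X]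
    {T : Type*} [PseudoMetricSpace T] [TopologicalSpace.SeparableSpace T] [Nonempty T]
    (F : ℕ → T → FiniteMeasure X)
    (hcomp : ∀ t, ∃ S : Set (FiniteMeasure X), IsCompact S ∧ ∀ n, F n t ∈ S)
    (heq : ∀ (φ : X →ᵇ ℝ) (L : ℝ≥0), LipschitzWith L φ → ∀ t, ∀ δ > 0, ∃ ρ > 0, ∀ s,
      dist s t < ρ → ∀ᶠ n in atTop,
        |∫ x, φ x ∂(F n s : Measure X) - ∫ x, φ x ∂(F n t : Measure X)| ≤ δ) :
    ∃ θ : ℕ → ℕ, StrictMono θ ∧ ∃ g : T → FiniteMeasure X, Continuous g ∧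
      ∀ t, Tendsto (fun n => F (θ n) t) atTop (𝓝 (g t)) := by
  have : TopologicalSpace.PseudoMetrizableSpace (FiniteMeasure X) :=
    FiniteMeasure.pseudoMetrizableSpace_of_separable
  choose S hS hFS using hcomp
  let q : ℕ → T := TopologicalSpace.denseSeq T
  have hpi : IsCompact (Set.pi univ (fun i => S (q i))) := isCompact_univ_pi fun i => hS (q i)
  obtain ⟨u, -, θ, hθ, hu⟩ := hpi.isSeqCompact (x := fun n i => F n (q i))
    (fun n i _ => hFS (q i) n)
  rw [tendsto_pi_nhds] at hu
  have hconv : ∀ t, ∃ g : FiniteMeasure X, Tendsto (fun n => F (θ n) t) atTop (𝓝 g) := by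
    intro t
    obtain ⟨g, -, κ, hκ, hg⟩ := (hS t).isSeqCompact (x := fun n => F (θ n) t)
      (fun n => hFS t (θ n))
    refine ⟨g, FiniteMeasure.tendsto_of_forall_lipschitz fun φ L hφ => ?_⟩
    have hcau : CauchySeq (fun n => ∫ x, φ x ∂(F (θ n) t : Measure X)) := by
      rw [Metric.cauchySeq_iff']
      intro δ hδ
      obtain ⟨ρ, hρ, hs⟩ := heq φ L hφ t (δ / 5) (by positivity)
      obtain ⟨i, hi⟩ := (TopologicalSpace.denseRange_denseSeq T).exists_mem_open
        (Metric.isOpen_ball (x := t) (ε := ρ)) ⟨t, Metric.mem_ball_self hρ⟩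
      have h1 := hθ.tendsto_atTop.eventually (hs (q i) hi)
      have h2 := (FiniteMeasure.tendsto_iff_forall_integral_tendsto.1 (hu i)) φ
      have h3 := h2.eventually (Metric.ball_mem_nhds _ (show 0 < δ / 5 by positivity))
      obtain ⟨N, hN⟩ := eventually_atTop.1 (h1.and h3)
      refine ⟨N, fun n hn => ?_⟩
      obtain ⟨a1, a2⟩ := hN n hn
      obtain ⟨b1, b2⟩ := hN N le_rfl
      simp only [Function.comp, Real.dist_eq] at a2 b2 ⊢
      rw [abs_le] at a1 b1
      rw [abs_lt] at a2 b2 ⊢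
      constructor <;> linarith [a1.1, a1.2, b1.1, b1.2, a2.1, a2.2, b2.1, b2.2]
    obtain ⟨y, hy⟩ := cauchySeq_tendsto_of_complete hcau
    have h4 := (FiniteMeasure.tendsto_iff_forall_integral_tendsto.1 hg) φ
    have h5 := hy.comp hκ.tendsto_atTop
    rwa [tendsto_nhds_unique h4 h5]
  choose g hg using hconv
  refine ⟨θ, hθ, g, continuous_iff_continuousAt.2 fun t => ?_, hg⟩
  refine FiniteMeasure.tendsto_of_forall_lipschitz fun φ L hφ => ?_
  rw [Metric.tendsto_nhds_nhds]
  intro δ hδ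
  obtain ⟨ρ, hρ, hs⟩ := heq φ L hφ t (δ / 2) (by positivity)
  refine ⟨ρ, hρ, fun {s} hst => ?_⟩
  have h1 := (FiniteMeasure.tendsto_iff_forall_integral_tendsto.1 (hg s)) φ
  have h2 := (FiniteMeasure.tendsto_iff_forall_integral_tendsto.1 (hg t)) φ
  have h3 := le_of_tendsto (h1.sub h2).abs (hθ.tendsto_atTop.eventually (hs s hst))
  rw [Real.dist_eq]
  linarith

end WeakConvergence

section MomentConvergence

open scoped NNReal BoundedContinuousFunction

variable {X : Type*}

/-- `G` is dominated by a constant plus an arbitrarily small multiple of the weight `W`. -/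
def IsSubweight (W G : X → ℝ) : Prop := ∀ δ > 0, ∃ R, ∀ x, |G x| ≤ R + δ * W x

theorem IsSubweight.mono {W G H : X → ℝ} (hH : IsSubweight W H) (h : ∀ x, |G x| ≤ H x) :
    IsSubweight W G := fun δ hδ => by
  obtain ⟨R, hR⟩ := hH δ hδ
  exact ⟨R, fun x => (h x).trans ((le_abs_self _).trans (hR x))⟩

theorem IsSubweight.const_mul {W G : X → ℝ} (hW : ∀ x, 0 ≤ W x) (hG : IsSubweight W G) (c : ℝ) :
    IsSubweight W (fun x => c * G x) := fun δ hδ => by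
  obtain ⟨R, hR⟩ := hG (δ / (|c| + 1)) (by positivity)
  refine ⟨|c| * R, fun x => ?_⟩
  rw [abs_mul]
  have h2 : |c| * (δ / (|c| + 1)) ≤ δ := by
    rw [mul_div_assoc', div_le_iff₀ (by positivity)]
    nlinarith [abs_nonneg c]
  have h1 := mul_le_mul_of_nonneg_left (hR x) (abs_nonneg c)
  nlinarith [mul_le_mul_of_nonneg_right h2 (hW x)]

theorem IsSubweight.rpow {W : X → ℝ} (hW : ∀ x, 1 ≤ W x) {s : ℝ} (hs0 : 0 ≤ s) (hs : s < 1) :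
    IsSubweight W (fun x => W x ^ s) := fun δ hδ => by
  have h1 : Tendsto (fun y : ℝ => y ^ (-(1 - s))) atTop (𝓝 0) :=
    tendsto_rpow_neg_atTop (by linarith)
  obtain ⟨Y, hY⟩ := eventually_atTop.1 (h1.eventually (ge_mem_nhds hδ))
  refine ⟨(max Y 1) ^ s, fun x => ?_⟩
  have hx : 0 < W x := by linarith [hW x]
  rw [abs_of_nonneg (by positivity)]
  rcases le_total (W x) (max Y 1) with h | h
  · have := Real.rpow_le_rpow hx.le h hs0
    have : 0 ≤ δ * W x := by positivity
    linarith
  · have h2 := hY (W x) ((le_max_left _ _).trans h)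
    have h3 : W x ^ s = W x ^ (-(1 - s)) * W x := by
      conv_rhs => rw [← Real.rpow_one (W x), ← Real.rpow_mul hx.le, ← Real.rpow_add hx]
      ring_nf
    have : 0 ≤ (max Y 1 : ℝ) ^ s := by positivity
    simp only [h3]
    nlinarith [mul_le_mul_of_nonneg_right h2 hx.le]

theorem IsSubweight.integrable [MeasurableSpace X] {W G : X → ℝ}
    (hG : IsSubweight W G) (hGm : Measurable G)
    {μ : Measure X} [IsFiniteMeasure μ] (hW : Integrable W μ) : Integrable G μ := by
  obtain ⟨R, hR⟩ := hG 1 one_pos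
  exact Integrable.mono' ((integrable_const R).add (hW.const_mul 1)) hGm.aestronglyMeasurable
    (ae_of_all _ fun x => by simpa using hR x)

/-- Truncation of a continuous function at height `R`. -/
noncomputable def truncBCF [TopologicalSpace X] (G : X → ℝ) (hG : Continuous G) (R : ℝ) : X →ᵇ ℝ :=
  BoundedContinuousFunction.ofNormedAddCommGroup (fun x => max (-|R|) (min |R| (G x)))
    (by fun_prop) |R| (fun x => by
      rw [Real.norm_eq_abs, abs_le]
      exact ⟨le_max_left _ _, max_le (by linarith [abs_nonneg R]) (min_le_left _ _)⟩)

theorem abs_sub_truncBCF_le [TopologicalSpace X] {G : X → ℝ} (hG : Continuous G) {R c : ℝ} {x : X}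
    (hc : 0 ≤ c) (h : |G x| ≤ R + c) :
    |G x - truncBCF G hG R x| ≤ c := by
  change |G x - max (-|R|) (min |R| (G x))| ≤ c
  have h1 := le_abs_self R
  rw [abs_le] at h
  rcases le_total |R| (G x) with h2 | h2
  · rw [min_eq_left h2, max_eq_right (by linarith [abs_nonneg R]), abs_le]
    constructor <;> linarith
  · rw [min_eq_right h2]
    rcases le_total (-|R|) (G x) with h3 | h3
    · rw [max_eq_right h3]; simpa using hc
    · rw [max_eq_left h3, abs_le]
      constructor <;> linarith

variable [MeasurableSpace X] [TopologicalSpace X] [BorelSpace X]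

/-- Fatou-type bound: moments are lower semicontinuous under weak convergence. -/
theorem integral_weight_le_of_tendsto {ι : Type*} {l : Filter ι} [l.NeBot]
    {μs : ι → FiniteMeasure X} {μ : FiniteMeasure X} (h : Tendsto μs l (𝓝 μ))
    {W : X → ℝ} (hWc : Continuous W) (hW : ∀ x, 0 ≤ W x) {C : ℝ}
    (hC : ∀ᶠ i in l, Integrable W (μs i : Measure X) ∧ ∫ x, W x ∂(μs i : Measure X) ≤ C) :
    Integrable W (μ : Measure X) ∧ ∫ x, W x ∂(μ : Measure X) ≤ C := by
  have hC0 : 0 ≤ C := by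
    obtain ⟨i, hi⟩ := hC.exists
    exact (integral_nonneg hW).trans hi.2
  let Wn : ℕ → X →ᵇ ℝ := fun n => truncBCF W hWc n
  have hWn : ∀ n x, Wn n x = min (n : ℝ) (W x) := by
    intro n x
    change max (-|(n : ℝ)|) (min |(n : ℝ)| (W x)) = _
    have hn : (0 : ℝ) ≤ n := Nat.cast_nonneg n
    rw [abs_of_nonneg hn, max_eq_right]
    exact (neg_nonpos.2 hn).trans (le_min hn (hW x))
  have h1 : ∀ n, ∫ x, Wn n x ∂(μ : Measure X) ≤ C := by
    intro n
    refine le_of_tendsto ((FiniteMeasure.tendsto_iff_forall_integral_tendsto.1 h) (Wn n)) ?_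
    filter_upwards [hC] with i hi
    refine (integral_mono ((Wn n).integrable _) hi.1 fun x => ?_).trans hi.2
    rw [hWn]; exact min_le_right _ _
  have h2 : ∫⁻ x, ENNReal.ofReal (W x) ∂(μ : Measure X) ≤ ENNReal.ofReal C := by
    have h3 : Tendsto (fun n : ℕ => ∫⁻ x, ENNReal.ofReal (Wn n x) ∂(μ : Measure X)) atTop
        (𝓝 (∫⁻ x, ENNReal.ofReal (W x) ∂(μ : Measure X))) := by
      refine lintegral_tendsto_of_tendsto_of_monotone
        (fun n => ((Wn n).continuous.measurable.ennreal_ofReal).aemeasurable) ?_ ?_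
      · refine ae_of_all _ fun x n m hnm => ENNReal.ofReal_le_ofReal ?_
        rw [hWn, hWn]
        exact min_le_min_right _ (by exact_mod_cast hnm)
      · refine ae_of_all _ fun x => tendsto_const_nhds.congr' ?_
        obtain ⟨N, hN⟩ := exists_nat_ge (W x)
        filter_upwards [eventually_ge_atTop N] with n hn
        rw [hWn, min_eq_right]
        exact hN.trans (by exact_mod_cast hn)
    refine le_of_tendsto' h3 fun n => ?_
    rw [← ofReal_integral_eq_lintegral_ofReal ((Wn n).integrable _)
      (ae_of_all _ fun x => by rw [hWn]; exact le_min (Nat.cast_nonneg n) (hW x))]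
    exact ENNReal.ofReal_le_ofReal (h1 n)
  have h4 : Integrable W (μ : Measure X) :=
    ⟨hWc.measurable.aestronglyMeasurable, by
      rw [hasFiniteIntegral_iff_ofReal (ae_of_all _ hW)]
      exact h2.trans_lt ENNReal.ofReal_lt_top⟩
  refine ⟨h4, ?_⟩
  rw [← ofReal_integral_eq_lintegral_ofReal h4 (ae_of_all _ hW)] at h2
  exact (ENNReal.ofReal_le_ofReal_iff hC0).1 h2

/-- Weak convergence with a uniform `W`-moment bound implies convergence of the integrals of
continuous functions growing strictly slower than `W`. -/
theorem tendsto_integral_of_isSubweight {ι : Type*} {l : Filter ι}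
    {μs : ι → FiniteMeasure X} {μ : FiniteMeasure X} (h : Tendsto μs l (𝓝 μ))
    {W : X → ℝ} (hWc : Continuous W) (hW : ∀ x, 0 ≤ W x) {C : ℝ}
    (hC : ∀ᶠ i in l, Integrable W (μs i : Measure X) ∧ ∫ x, W x ∂(μs i : Measure X) ≤ C)
    {G : X → ℝ} (hGc : Continuous G) (hG : IsSubweight W G) :
    Tendsto (fun i => ∫ x, G x ∂(μs i : Measure X)) l (𝓝 (∫ x, G x ∂(μ : Measure X))) := by
  rcases l.eq_or_neBot with rfl | hl
  · exact tendsto_bot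
  have hμ := integral_weight_le_of_tendsto h hWc hW hC
  have hC0 : 0 ≤ C := (integral_nonneg hW).trans hμ.2
  rw [Metric.tendsto_nhds]
  intro δ hδ
  obtain ⟨R, hR⟩ := hG (δ / (3 * (C + 1))) (by positivity)
  have hsmall : δ / (3 * (C + 1)) * C < δ / 3 := by
    rw [div_mul_eq_mul_div, div_lt_div_iff₀ (by positivity) (by positivity)]
    nlinarith
  have key : ∀ ν : FiniteMeasure X, Integrable W (ν : Measure X) →
      ∫ x, W x ∂(ν : Measure X) ≤ C →
      |∫ x, G x ∂(ν : Measure X) - ∫ x, truncBCF G hGc R x ∂(ν : Measure X)| < δ / 3 := by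
    intro ν hν hνC
    rw [← integral_sub (hG.integrable hGc.measurable hν) ((truncBCF G hGc R).integrable _)]
    refine lt_of_le_of_lt ?_ hsmall
    refine (abs_integral_le_integral_abs).trans ?_
    calc ∫ x, |G x - truncBCF G hGc R x| ∂(ν : Measure X)
        ≤ ∫ x, δ / (3 * (C + 1)) * W x ∂(ν : Measure X) := by
          refine integral_mono_of_nonneg (ae_of_all _ fun x => abs_nonneg _) (hν.const_mul _)
            (ae_of_all _ fun x => ?_)
          exact abs_sub_truncBCF_le hGc (mul_nonneg (by positivity) (hW x)) (hR x)
      _ ≤ _ := by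
          rw [integral_const_mul]
          exact mul_le_mul_of_nonneg_left hνC (by positivity)
  have h1 := ((FiniteMeasure.tendsto_iff_forall_integral_tendsto.1 h)
    (truncBCF G hGc R)).eventually (Metric.ball_mem_nhds _ (show 0 < δ / 3 by positivity))
  filter_upwards [h1, hC] with i h2 h3
  have h4 := key _ h3.1 h3.2
  have h5 := key _ hμ.1 hμ.2
  rw [Real.dist_eq] at h2
  rw [Real.dist_eq]
  rw [abs_lt] at *
  constructor <;> linarith [h2.1, h2.2, h4.1, h4.2, h5.1, h5.2]

/-- Variant of `tendsto_integral_of_isSubweight` with varying integrands converging uniformly on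
the sublevel sets of the weight. -/
theorem tendsto_integral_of_isSubweight_of_uniform {ι : Type*} {l : Filter ι}
    {μs : ι → FiniteMeasure X} {μ : FiniteMeasure X} (h : Tendsto μs l (𝓝 μ))
    {W : X → ℝ} (hWc : Continuous W) (hW : ∀ x, 1 ≤ W x) {C : ℝ}
    (hC : ∀ᶠ i in l, Integrable W (μs i : Measure X) ∧ ∫ x, W x ∂(μs i : Measure X) ≤ C)
    {Gs : ι → X → ℝ} {G H : X → ℝ} (hGsm : ∀ i, Measurable (Gs i)) (hGc : Continuous G)
    (hH : IsSubweight W H) (hGsH : ∀ᶠ i in l, ∀ x, |Gs i x| ≤ H x) (hGH : ∀ x, |G x| ≤ H x)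
    (hunif : ∀ R, ∀ δ > 0, ∀ᶠ i in l, ∀ x, W x ≤ R → |Gs i x - G x| ≤ δ) :
    Tendsto (fun i => ∫ x, Gs i x ∂(μs i : Measure X)) l (𝓝 (∫ x, G x ∂(μ : Measure X))) := by
  rcases l.eq_or_neBot with rfl | hl
  · exact tendsto_bot
  have hW0 : ∀ x, 0 ≤ W x := fun x => zero_le_one.trans (hW x)
  have hμ := integral_weight_le_of_tendsto h hWc hW0 hC
  have hC0 : 0 ≤ C := (integral_nonneg hW0).trans hμ.2
  have hG : IsSubweight W G := hH.mono hGH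
  have h1 := tendsto_integral_of_isSubweight h hWc hW0 hC hGc hG
  suffices h2 : Tendsto (fun i => ∫ x, Gs i x ∂(μs i : Measure X) - ∫ x, G x ∂(μs i : Measure X))
      l (𝓝 0) by simpa using h2.add h1
  rw [Metric.tendsto_nhds]
  intro δ hδ
  set e := δ / (6 * (C + 1)) with he
  have hepos : 0 < e := by positivity
  obtain ⟨R, hR⟩ := hH e hepos
  filter_upwards [hC, hGsH, hunif (|R| / e) e hepos] with i h3 h4 h5
  have hGi : Integrable (Gs i) (μs i : Measure X) :=
    (hH.mono h4).integrable (hGsm i) h3.1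
  have hGi' : Integrable G (μs i : Measure X) := hG.integrable hGc.measurable h3.1
  rw [Real.dist_eq, sub_zero, ← integral_sub hGi hGi']
  have hpt : ∀ x, |Gs i x - G x| ≤ 5 * e * W x := by
    intro x
    rcases le_or_gt (W x) (|R| / e) with h6 | h6
    · have := h5 x h6
      nlinarith [hW x]
    · rw [div_lt_iff₀ hepos] at h6
      have h7 : H x ≤ 2 * e * W x := by
        have := (le_abs_self _).trans (hR x)
        have := le_abs_self R
        linarith
      have h8 := abs_sub (Gs i x) (G x)
      have := h4 x
      have := hGH x
      have : 0 ≤ e * W x := mul_nonneg hepos.le (hW0 x)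
      linarith
  calc |∫ x, (Gs i x - G x) ∂(μs i : Measure X)|
      ≤ ∫ x, |Gs i x - G x| ∂(μs i : Measure X) := abs_integral_le_integral_abs
    _ ≤ ∫ x, 5 * e * W x ∂(μs i : Measure X) :=
        integral_mono_of_nonneg (ae_of_all _ fun x => abs_nonneg _) (h3.1.const_mul _)
          (ae_of_all _ hpt)
    _ = 5 * e * ∫ x, W x ∂(μs i : Measure X) := integral_const_mul _ _
    _ ≤ 5 * e * C := mul_le_mul_of_nonneg_left h3.2 (by positivity)
    _ < δ := by
        rw [he, show 5 * (δ / (6 * (C + 1))) * C = (5 * δ * C) / (6 * (C + 1)) by ring,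
          div_lt_iff₀ (by positivity)]
        nlinarith

end MomentConvergence

section Step

variable {X : Type*} [MeasurableSpace X]

/-- The total loss rate `x ↦ ∫ k(x,y) df(y)` of a coagulation kernel. -/
noncomputable def lossRate (k : X × X → ℝ) (f : Measure X) (x : X) : ℝ := ∫ y, k (x, y) ∂f

/-- One step, of length `τ`, of the explicit splitting scheme: loss by coagulation, transport of
the surviving mass by `Φ`, and gain by coagulation. -/
noncomputable def splitStep [Add X] (k : X × X → ℝ) (Φ : X → X) (τ : ℝ) (f : Measure X) :
    Measure X :=
  (f.withDensity fun x => ENNReal.ofReal (1 - τ * lossRate k f x)).map Φ +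
    ENNReal.ofReal (τ / 2) •
      ((f.prod f).withDensity fun z => ENNReal.ofReal (k z)).map fun z => z.1 + z.2

theorem integral_withDensity_ofReal {f : Measure X} {ρ : X → ℝ} (hρ : Measurable ρ)
    (hρ0 : ∀ x, 0 ≤ ρ x) (g : X → ℝ) :
    ∫ x, g x ∂(f.withDensity fun x => ENNReal.ofReal (ρ x)) = ∫ x, ρ x * g x ∂f := by
  rw [integral_withDensity_eq_integral_toReal_smul hρ.ennreal_ofReal
    (ae_of_all _ fun x => ENNReal.ofReal_lt_top)]
  simp [ENNReal.toReal_ofReal (hρ0 _)]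

theorem integrable_withDensity_ofReal {f : Measure X} {ρ : X → ℝ} (hρ : Measurable ρ)
    (hρ0 : ∀ x, 0 ≤ ρ x) {g : X → ℝ} (hg : Integrable (fun x => ρ x * g x) f) :
    Integrable g (f.withDensity fun x => ENNReal.ofReal (ρ x)) := by
  rw [integrable_withDensity_iff_integrable_smul' hρ.ennreal_ofReal
    (ae_of_all _ fun x => ENNReal.ofReal_lt_top)]
  simpa [ENNReal.toReal_ofReal (hρ0 _)] using hg

variable {k : X × X → ℝ} {Φ : X → X} {τ b : ℝ} {f : Measure X}

theorem lossRate_nonneg (hk0 : ∀ z, 0 ≤ k z) (x : X) : 0 ≤ lossRate k f x :=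
  integral_nonneg fun _ => hk0 _

variable [IsFiniteMeasure f]

theorem measurable_lossRate (hk : Measurable k) : Measurable (lossRate k f) :=
  (hk.stronglyMeasurable.integral_prod_right' (ν := f)).measurable

theorem lossRate_le (hk : Measurable k) (hk0 : ∀ z, 0 ≤ k z) (hkb : ∀ z, k z ≤ b) (x : X) :
    lossRate k f x ≤ b * f.real univ := by
  have : Integrable (fun y => k (x, y)) f := by
    refine Integrable.of_bound (hk.comp measurable_prodMk_left).aestronglyMeasurable b
      (ae_of_all _ fun y => ?_)
    rw [Real.norm_eq_abs, abs_of_nonneg (hk0 _)]; exact hkb _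
  refine (integral_mono this (integrable_const b) fun y => hkb (x, y)).trans ?_
  simp [mul_comm]

variable [Add X]

theorem isFiniteMeasure_splitStep (hk0 : ∀ z, 0 ≤ k z)
    (hkb : ∀ z, k z ≤ b) (hτ : 0 ≤ τ) : IsFiniteMeasure (splitStep k Φ τ f) := by
  have h1 : IsFiniteMeasure (f.withDensity fun x => ENNReal.ofReal (1 - τ * lossRate k f x)) := by
    refine isFiniteMeasure_withDensity (ne_of_lt ?_)
    calc ∫⁻ x, ENNReal.ofReal (1 - τ * lossRate k f x) ∂f ≤ ∫⁻ x, 1 ∂f := by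
          refine lintegral_mono fun x => ?_
          rw [← ENNReal.ofReal_one]
          exact ENNReal.ofReal_le_ofReal
            (by nlinarith [mul_nonneg hτ (lossRate_nonneg (f := f) hk0 x)])
      _ < ⊤ := by simp
  have h2 : IsFiniteMeasure ((f.prod f).withDensity fun z => ENNReal.ofReal (k z)) := by
    refine isFiniteMeasure_withDensity (ne_of_lt ?_)
    calc ∫⁻ z, ENNReal.ofReal (k z) ∂(f.prod f) ≤ ∫⁻ z, ENNReal.ofReal b ∂(f.prod f) :=
          lintegral_mono fun z => ENNReal.ofReal_le_ofReal (hkb z)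
      _ < ⊤ := by
        rw [lintegral_const]
        exact ENNReal.mul_lt_top ENNReal.ofReal_lt_top (measure_lt_top _ _)
  have h3 : IsFiniteMeasure (ENNReal.ofReal (τ / 2) •
      ((f.prod f).withDensity fun z => ENNReal.ofReal (k z)).map fun z => z.1 + z.2) :=
    Measure.smul_finite _ ENNReal.ofReal_ne_top
  unfold splitStep
  infer_instance

variable [MeasurableAdd₂ X]

/-- The weak form of one step of the splitting scheme. -/
theorem splitStep_integral (hk : Measurable k) (hk0 : ∀ z, 0 ≤ k z) (hkb : ∀ z, k z ≤ b)
    (hks : ∀ x y, k (x, y) = k (y, x)) (hΦ : Measurable Φ) (hτ : 0 ≤ τ)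
    (hτL : ∀ x, τ * lossRate k f x ≤ 1) {V : X → ℝ} (hV : Integrable V f)
    (hVΦ : ∀ x, V (Φ x) ≤ V x) {C : ℝ} (hVadd : ∀ x y, V (x + y) ≤ C * (V x + V y))
    {φ : X → ℝ} (hφ : Measurable φ) (hφV : ∀ x, |φ x| ≤ V x) :
    Integrable φ (splitStep k Φ τ f) ∧
      Integrable (fun z : X × X => k z * (φ (z.1 + z.2) - φ z.1 - φ z.2)) (f.prod f) ∧
      Integrable (fun x => (φ (Φ x) - φ x) * (1 - τ * lossRate k f x)) f ∧
      ∫ x, φ x ∂(splitStep k Φ τ f) = ∫ x, φ x ∂f +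
        τ * ((1 / 2) * ∫ z : X × X, k z * (φ (z.1 + z.2) - φ z.1 - φ z.2) ∂(f.prod f)) +
        ∫ x, (φ (Φ x) - φ x) * (1 - τ * lossRate k f x) ∂f := by
  have hLm : Measurable (lossRate k f) := measurable_lossRate hk
  have hs0 : ∀ x, 0 ≤ 1 - τ * lossRate k f x := fun x => by linarith [hτL x]
  have hs1 : ∀ x, 1 - τ * lossRate k f x ≤ 1 := fun x => by
    linarith [mul_nonneg hτ (lossRate_nonneg (f := f) hk0 x)]
  have hsm : Measurable fun x => 1 - τ * lossRate k f x := by fun_prop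
  have hadd : Measurable fun z : X × X => z.1 + z.2 := measurable_fst.add measurable_snd
  have hφi : Integrable φ f := hV.mono' hφ.aestronglyMeasurable (ae_of_all _ hφV)
  have hφΦ : Integrable (fun x => φ (Φ x)) f :=
    hV.mono' (hφ.comp hΦ).aestronglyMeasurable (ae_of_all _ fun x => (hφV _).trans (hVΦ x))
  have hbs : ∀ {g : X → ℝ}, Integrable g f →
      Integrable (fun x => (1 - τ * lossRate k f x) * g x) f := fun {g} hg =>
    hg.bdd_mul hsm.aestronglyMeasurable (c := 1) (ae_of_all _ fun x => by
      rw [Real.norm_eq_abs, abs_of_nonneg (hs0 x)]; exact hs1 x)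
  have hbk : ∀ {g : X × X → ℝ}, Integrable g (f.prod f) →
      Integrable (fun z => k z * g z) (f.prod f) := fun {g} hg =>
    hg.bdd_mul hk.aestronglyMeasurable (c := b) (ae_of_all _ fun z => by
      rw [Real.norm_eq_abs, abs_of_nonneg (hk0 z)]; exact hkb z)
  have hV1 : Integrable (fun z : X × X => V z.1) (f.prod f) := hV.comp_fst f
  have hV2 : Integrable (fun z : X × X => V z.2) (f.prod f) := hV.comp_snd f
  have hφ1 : Integrable (fun z : X × X => φ z.1) (f.prod f) := hφi.comp_fst f
  have hφ2 : Integrable (fun z : X × X => φ z.2) (f.prod f) := hφi.comp_snd f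
  have hφa : Integrable (fun z : X × X => φ (z.1 + z.2)) (f.prod f) :=
    ((hV1.add hV2).const_mul C).mono' (hφ.comp hadd).aestronglyMeasurable
      (ae_of_all _ fun z => (hφV _).trans (hVadd _ _))
  have e1 : ∫ z : X × X, k z * φ z.1 ∂(f.prod f) = ∫ x, lossRate k f x * φ x ∂f := by
    rw [integral_prod _ (hbk hφ1)]
    refine integral_congr_ae (ae_of_all _ fun x => ?_)
    simp only [lossRate, integral_mul_const]
  have e2 : ∫ z : X × X, k z * φ z.2 ∂(f.prod f) = ∫ x, lossRate k f x * φ x ∂f := by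
    rw [← e1, ← integral_prod_swap]
    refine integral_congr_ae (ae_of_all _ fun z => ?_)
    have : k z.swap = k z := hks z.2 z.1
    simp only [Prod.snd_swap, this]
  have hLφ : Integrable (fun x => lossRate k f x * φ x) f := by
    refine hφi.bdd_mul hLm.aestronglyMeasurable (c := b * f.real univ) (ae_of_all _ fun x => ?_)
    rw [Real.norm_eq_abs, abs_of_nonneg (lossRate_nonneg hk0 x)]
    exact lossRate_le hk hk0 hkb x
  have i1 : Integrable φ
      ((f.withDensity fun x => ENNReal.ofReal (1 - τ * lossRate k f x)).map Φ) := by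
    rw [integrable_map_measure hφ.aestronglyMeasurable hΦ.aemeasurable]
    exact integrable_withDensity_ofReal hsm hs0 (hbs hφΦ)
  have i2 : Integrable φ
      (((f.prod f).withDensity fun z => ENNReal.ofReal (k z)).map fun z => z.1 + z.2) := by
    rw [integrable_map_measure hφ.aestronglyMeasurable hadd.aemeasurable]
    exact integrable_withDensity_ofReal hk hk0 (hbk hφa)
  have i3 := i2.smul_measure (c := ENNReal.ofReal (τ / 2)) ENNReal.ofReal_ne_top
  refine ⟨i1.add_measure i3, ?_, ?_, ?_⟩
  · exact hbk ((hφa.sub hφ1).sub hφ2)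
  · refine (hbs (hφΦ.sub hφi)).congr (ae_of_all _ fun x => ?_)
    simp only [Pi.sub_apply, mul_comm]
  · unfold splitStep
    rw [integral_add_measure i1 i3, integral_smul_measure,
      integral_map hΦ.aemeasurable hφ.aestronglyMeasurable,
      integral_map hadd.aemeasurable hφ.aestronglyMeasurable,
      integral_withDensity_ofReal hsm hs0, integral_withDensity_ofReal hk hk0,
      ENNReal.toReal_ofReal (by positivity)]
    have e3 : ∫ z : X × X, k z * (φ (z.1 + z.2) - φ z.1 - φ z.2) ∂(f.prod f) =
        ∫ z : X × X, k z * φ (z.1 + z.2) ∂(f.prod f) - 2 * ∫ x, lossRate k f x * φ x ∂f := by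
      have h : Integrable (fun z : X × X => k z * φ (z.1 + z.2) - k z * φ z.1) (f.prod f) :=
        (hbk hφa).sub (hbk hφ1)
      rw [two_mul]
      nth_rewrite 1 [← e1]
      rw [← e2, ← sub_sub, ← integral_sub (hbk hφa) (hbk hφ1),
        ← integral_sub h (hbk hφ2)]
      refine integral_congr_ae (ae_of_all _ fun z => ?_)
      simp only []; ring
    have e4 : ∫ x, (φ (Φ x) - φ x) * (1 - τ * lossRate k f x) ∂f =
        ∫ x, (1 - τ * lossRate k f x) * φ (Φ x) ∂f - ∫ x, φ x ∂f +
          τ * ∫ x, lossRate k f x * φ x ∂f := by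
      have h : Integrable (fun x => (1 - τ * lossRate k f x) * φ (Φ x) - φ x) f :=
        (hbs hφΦ).sub hφi
      rw [← integral_sub (hbs hφΦ) hφi, ← integral_const_mul, ← integral_add h (hLφ.const_mul _)]
      refine integral_congr_ae (ae_of_all _ fun z => ?_)
      simp only []; ring
    rw [e3, e4, smul_eq_mul]
    ring

end Step

section Scheme

/-- A coagulation kernel together with a hierarchy of weights `Z₀ ≤ Z₁ ≤ W` whose moments can be
propagated successively, and a slowly growing weight `U` controlling the kernel. -/
structure CoagSystem (X : Type*) [TopologicalSpace X] [Add X] where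
  /-- the coagulation kernel -/
  K : X × X → ℝ
  /-- the weight whose moment does not increase -/
  Z₀ : X → ℝ
  /-- the intermediate weight -/
  Z₁ : X → ℝ
  /-- the strongest weight -/
  W : X → ℝ
  /-- the weight controlling the kernel -/
  U : X → ℝ
  /-- the constant in all bounds -/
  C : ℝ
  continuous_K : Continuous K
  continuous_Z₀ : Continuous Z₀
  continuous_Z₁ : Continuous Z₁
  continuous_W : Continuous W
  continuous_U : Continuous U
  K_nonneg : ∀ z, 0 ≤ K z
  K_symm : ∀ x y, K (x, y) = K (y, x)
  C_nonneg : 0 ≤ C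
  one_le_U : ∀ x, 1 ≤ U x
  U_pow_le : ∀ x, U x ^ 3 ≤ W x
  Z₀_nonneg : ∀ x, 0 ≤ Z₀ x
  Z₀_le : ∀ x, Z₀ x ≤ Z₁ x
  Z₁_le : ∀ x, Z₁ x ≤ W x
  K_le : ∀ x y, K (x, y) ≤ C * (U x * U y)
  U_add : ∀ x y, U (x + y) ≤ C * (U x + U y)
  W_add : ∀ x y, W (x + y) ≤ C * (W x + W y)
  K_Z₀ : ∀ x y, Z₀ (x + y) ≤ Z₀ x + Z₀ y
  K_Z₁ : ∀ x y, K (x, y) * (Z₁ (x + y) - Z₁ x - Z₁ y) ≤ C * (Z₁ x * Z₀ y + Z₀ x * Z₁ y)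
  K_W : ∀ x y, K (x, y) * (W (x + y) - W x - W y) ≤ C * (W x * Z₁ y + Z₁ x * W y)
  isCompact_W_le : ∀ R, IsCompact {x | W x ≤ R}

namespace CoagSystem

variable {X : Type*} [TopologicalSpace X] [Add X] (S : CoagSystem X)

theorem one_le_W (x : X) : 1 ≤ S.W x := (one_le_pow₀ (S.one_le_U x)).trans (S.U_pow_le x)

theorem W_nonneg (x : X) : 0 ≤ S.W x := zero_le_one.trans (S.one_le_W x)

theorem U_nonneg (x : X) : 0 ≤ S.U x := zero_le_one.trans (S.one_le_U x)

theorem Z₁_nonneg (x : X) : 0 ≤ S.Z₁ x := (S.Z₀_nonneg x).trans (S.Z₀_le x)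

theorem U_sq_le_W (x : X) : S.U x ^ 2 ≤ S.W x :=
  (pow_le_pow_right₀ (S.one_le_U x) (by norm_num)).trans (S.U_pow_le x)

theorem U_le_W (x : X) : S.U x ≤ S.W x :=
  (le_self_pow₀ (S.one_le_U x) (by norm_num)).trans (S.U_pow_le x)

theorem U_sq_le_rpow (x : X) : S.U x ^ 2 ≤ S.W x ^ ((2 : ℝ) / 3) := by
  have h := Real.rpow_le_rpow (by have := S.U_nonneg x; positivity) (S.U_pow_le x)
    (show (0 : ℝ) ≤ 2 / 3 by norm_num)
  rwa [← Real.rpow_natCast, ← Real.rpow_mul (S.U_nonneg x),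
    show ((3 : ℕ) : ℝ) * (2 / 3) = (2 : ℕ) by norm_num, Real.rpow_natCast] at h

/-- The kernel truncated at height `b`. -/
def trunc (b : ℝ) (z : X × X) : ℝ := min (S.K z) b

variable {S} {b : ℝ}

theorem trunc_nonneg (hb : 0 ≤ b) (z : X × X) : 0 ≤ S.trunc b z := le_min (S.K_nonneg z) hb

theorem trunc_le (z : X × X) : S.trunc b z ≤ b := min_le_right _ _

theorem trunc_le_K (z : X × X) : S.trunc b z ≤ S.K z := min_le_left _ _

theorem trunc_symm (x y : X) : S.trunc b (x, y) = S.trunc b (y, x) := by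
  simp only [trunc, S.K_symm x y]

theorem continuous_trunc : Continuous (S.trunc b) := S.continuous_K.min continuous_const

theorem trunc_mul_le (hb : 0 ≤ b) {z : X × X} {d e : ℝ} (he : 0 ≤ e) (h : S.K z * d ≤ e) :
    S.trunc b z * d ≤ e := by
  rcases le_total 0 d with hd | hd
  · exact (mul_le_mul_of_nonneg_right (trunc_le_K z) hd).trans h
  · exact (mul_nonpos_of_nonneg_of_nonpos (trunc_nonneg hb z) hd).trans he

variable (S)

/-- Pointwise bound of the weak coagulation operator on functions controlled by `U`. -/
theorem abs_K_mul_le {φ : X → ℝ} {B : ℝ} (hB : 0 ≤ B) (hφ : ∀ x, |φ x| ≤ B * S.U x) (x y : X) :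
    S.K (x, y) * |φ (x + y) - φ x - φ y| ≤
      2 * B * S.C * (S.C + 1) * (S.U x ^ 2 * S.U y ^ 2) := by
  have hx := S.one_le_U x
  have hy := S.one_le_U y
  have hC := S.C_nonneg
  have h1 : |φ (x + y) - φ x - φ y| ≤ B * ((S.C + 1) * (S.U x + S.U y)) := by
    have h2 := abs_sub (φ (x + y) - φ x) (φ y)
    have h3 := abs_sub (φ (x + y)) (φ x)
    have h4 := mul_le_mul_of_nonneg_left (S.U_add x y) hB
    have := hφ (x + y)
    have := hφ x
    have := hφ y
    linarith
  have h2 : S.U x + S.U y ≤ 2 * (S.U x * S.U y) := by nlinarith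
  calc S.K (x, y) * |φ (x + y) - φ x - φ y|
      ≤ (S.C * (S.U x * S.U y)) * (B * ((S.C + 1) * (2 * (S.U x * S.U y)))) := by
        refine mul_le_mul (S.K_le x y) (h1.trans ?_) (abs_nonneg _) (by positivity)
        gcongr
    _ = _ := by ring

end CoagSystem

variable {X : Type*} [PseudoMetricSpace X] [Add X]

/-- A discretised transport (time step `τ ↦ Φ τ`) compatible with the weights of a coagulation
system, with speed bounded by `G`. -/
structure FusionFlow (S : CoagSystem X) where
  /-- the discrete flow -/
  Φ : ℝ → X → X
  /-- the bound for its speed -/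
  G : X → ℝ
  /-- the constant in the bound of `G` -/
  D : ℝ
  continuous_Φ : ∀ τ > 0, Continuous (Φ τ)
  D_nonneg : 0 ≤ D
  G_le : ∀ x, G x ≤ D * S.W x
  isSubweight_G : IsSubweight S.W G
  dist_le : ∀ τ > 0, ∀ x, dist (Φ τ x) x ≤ τ * G x
  Z₀_Φ : ∀ τ > 0, ∀ x, S.Z₀ (Φ τ x) ≤ S.Z₀ x
  Z₁_Φ : ∀ τ > 0, ∀ x, S.Z₁ (Φ τ x) ≤ S.Z₁ x
  W_Φ : ∀ τ > 0, ∀ x, S.W (Φ τ x) ≤ S.W x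

variable {S : CoagSystem X}

theorem FusionFlow.G_nonneg (P : FusionFlow S) (x : X) : 0 ≤ P.G x := by
  simpa using dist_nonneg.trans (P.dist_le 1 one_pos x)

/-- Functions which are admissible in the weak formulation: controlled by `U`, and with
difference quotients along the flow controlled by `G`. -/
structure FusionFlow.IsAdm (P : FusionFlow S) (φ : X → ℝ) (B : ℝ) : Prop where
  nonneg : 0 ≤ B
  continuous : Continuous φ
  abs_le : ∀ x, |φ x| ≤ B * S.U x
  abs_sub_le : ∀ τ > 0, ∀ x, |φ (P.Φ τ x) - φ x| ≤ B * (τ * P.G x)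

variable [MeasurableSpace X]

/-- The iterates of the splitting scheme. -/
noncomputable def FusionFlow.scheme (P : FusionFlow S) (M τ : ℝ) (f₀ : Measure X) : ℕ → Measure X
  | 0 => f₀
  | j + 1 => splitStep (S.trunc (1 / (M * τ))) (P.Φ τ) τ (scheme P M τ f₀ j)

/-- The discrete generator of the splitting scheme, in weak form. -/
noncomputable def FusionFlow.discGen (P : FusionFlow S) (M τ : ℝ) (φ : X → ℝ) (f : Measure X) : ℝ :=
  (1 / 2) * ∫ z : X × X, S.trunc (1 / (M * τ)) z * (φ (z.1 + z.2) - φ z.1 - φ z.2) ∂(f.prod f) +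
    ∫ x, τ⁻¹ * ((φ (P.Φ τ x) - φ x) * (1 - τ * lossRate (S.trunc (1 / (M * τ))) f x)) ∂f

/-- The bound for the moment of order `W` at time `t`. -/
noncomputable def CoagSystem.momentBound {X : Type*} [TopologicalSpace X] [Add X]
    [MeasurableSpace X] (S : CoagSystem X) (f₀ : Measure X) (t : ℝ) : ℝ :=
  (∫ x, S.W x ∂f₀) * exp (S.C * ((∫ x, S.Z₁ x ∂f₀) * exp (S.C * (∫ x, S.Z₀ x ∂f₀) * t)) * t)

theorem CoagSystem.momentBound_mono {X : Type*} [TopologicalSpace X] [Add X]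
    [MeasurableSpace X] (S : CoagSystem X) (f₀ : Measure X) {s t : ℝ} (hs : 0 ≤ s) (hst : s ≤ t) :
    S.momentBound f₀ s ≤ S.momentBound f₀ t := by
  have h0 : 0 ≤ ∫ x, S.W x ∂f₀ := integral_nonneg S.W_nonneg
  have h1 : 0 ≤ ∫ x, S.Z₁ x ∂f₀ := integral_nonneg S.Z₁_nonneg
  have h2 : 0 ≤ ∫ x, S.Z₀ x ∂f₀ := integral_nonneg S.Z₀_nonneg
  have hC := S.C_nonneg
  unfold momentBound
  gcongr

variable [BorelSpace X] [SecondCountableTopology X]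

variable {P : FusionFlow S} {M τ : ℝ} {f f₀ : Measure X}

theorem FusionFlow.tau_mul_lossRate_le [IsFiniteMeasure f] (hτ : 0 < τ) (hM : 0 < M)
    (hmass : f.real univ ≤ M) (x : X) : τ * lossRate (S.trunc (1 / (M * τ))) f x ≤ 1 := by
  have hb : 0 ≤ 1 / (M * τ) := by positivity
  have h := lossRate_le (f := f) (S.continuous_trunc).measurable (S.trunc_nonneg hb)
    (S.trunc_le (b := 1 / (M * τ))) x
  have h2 : lossRate (S.trunc (1 / (M * τ))) f x ≤ 1 / (M * τ) * M :=
    h.trans (mul_le_mul_of_nonneg_left hmass hb)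
  calc _ ≤ τ * (1 / (M * τ) * M) := mul_le_mul_of_nonneg_left h2 hτ.le
    _ = 1 := by field_simp

/-- The discrete generator is bounded on admissible functions. -/
theorem FusionFlow.abs_discGen_le (P : FusionFlow S) [IsFiniteMeasure f] (hτ : 0 < τ) (hM : 0 < M)
    (hmass : f.real univ ≤ M) (hW : Integrable S.W f) {I : ℝ} (hI : ∫ x, S.W x ∂f ≤ I)
    {φ : X → ℝ} {B : ℝ} (hφ : P.IsAdm φ B) :
    |P.discGen M τ φ f| ≤ B * (S.C * (S.C + 1) * I ^ 2 + P.D * I) := by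
  have hb : 0 ≤ 1 / (M * τ) := by positivity
  have hB := hφ.nonneg
  have hC := S.C_nonneg
  have hI0 : 0 ≤ ∫ x, S.W x ∂f := integral_nonneg S.W_nonneg
  have hWW : Integrable (fun z : X × X => S.W z.1 * S.W z.2) (f.prod f) := hW.mul_prod hW
  have h1 : |∫ z : X × X, S.trunc (1 / (M * τ)) z * (φ (z.1 + z.2) - φ z.1 - φ z.2) ∂(f.prod f)| ≤
      2 * (B * (S.C * (S.C + 1) * I ^ 2)) := by
    refine abs_integral_le_integral_abs.trans ?_
    calc _ ≤ ∫ z : X × X, 2 * B * S.C * (S.C + 1) * (S.W z.1 * S.W z.2) ∂(f.prod f) := by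
          refine integral_mono_of_nonneg (ae_of_all _ fun z => abs_nonneg _) (hWW.const_mul _)
            (ae_of_all _ fun z => ?_)
          simp only [abs_mul, abs_of_nonneg (S.trunc_nonneg hb z)]
          refine ((mul_le_mul_of_nonneg_right (S.trunc_le_K z) (abs_nonneg _)).trans
            (S.abs_K_mul_le hB hφ.abs_le z.1 z.2)).trans ?_
          have := S.U_sq_le_W z.1
          have := S.U_sq_le_W z.2
          have := S.W_nonneg z.1
          gcongr
      _ = 2 * (B * (S.C * (S.C + 1) * (∫ x, S.W x ∂f) ^ 2)) := by
          rw [integral_const_mul, integral_prod_mul]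
          ring
      _ ≤ _ := by gcongr
  have h2 : |∫ x, τ⁻¹ * ((φ (P.Φ τ x) - φ x) *
      (1 - τ * lossRate (S.trunc (1 / (M * τ))) f x)) ∂f| ≤ B * (P.D * ∫ x, S.W x ∂f) := by
    refine abs_integral_le_integral_abs.trans ?_
    rw [← integral_const_mul, ← integral_const_mul]
    refine integral_mono_of_nonneg (ae_of_all _ fun z => abs_nonneg _)
      ((hW.const_mul _).const_mul _) (ae_of_all _ fun x => ?_)
    have h3 := tau_mul_lossRate_le (S := S) hτ hM hmass x
    have h4 := mul_nonneg hτ.le (lossRate_nonneg (f := f) (S.trunc_nonneg hb) x)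
    have h5 := hφ.abs_sub_le τ hτ x
    simp only [abs_mul, abs_of_nonneg (inv_nonneg.2 hτ.le), abs_of_nonneg (sub_nonneg.2 h3)]
    calc _ ≤ τ⁻¹ * ((B * (τ * P.G x)) * 1) := by
          have := mul_nonneg hB (mul_nonneg hτ.le (P.G_nonneg x))
          gcongr
          linarith
      _ = B * P.G x := by field_simp
      _ ≤ _ := by gcongr; exact P.G_le x
  have h6 : B * (P.D * ∫ x, S.W x ∂f) ≤ B * (P.D * I) :=
    mul_le_mul_of_nonneg_left (mul_le_mul_of_nonneg_left hI P.D_nonneg) hB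
  rw [discGen]
  refine (abs_add_le _ _).trans ?_
  rw [abs_mul, abs_of_pos (by norm_num : (0 : ℝ) < 1 / 2)]
  linarith

variable [ContinuousAdd X]

/-- Weak form of one step of the scheme for functions controlled by `W`. -/
theorem FusionFlow.step_integral (P : FusionFlow S) [IsFiniteMeasure f] (hτ : 0 < τ) (hM : 0 < M)
    (hmass : f.real univ ≤ M) (hW : Integrable S.W f) {φ : X → ℝ} (hφ : Measurable φ) {B : ℝ}
    (hB : 0 ≤ B) (hφW : ∀ x, |φ x| ≤ B * S.W x) :
    Integrable φ (splitStep (S.trunc (1 / (M * τ))) (P.Φ τ) τ f) ∧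
      Integrable (fun z : X × X => S.trunc (1 / (M * τ)) z * (φ (z.1 + z.2) - φ z.1 - φ z.2))
        (f.prod f) ∧
      Integrable (fun x => (φ (P.Φ τ x) - φ x) *
        (1 - τ * lossRate (S.trunc (1 / (M * τ))) f x)) f ∧
      ∫ x, φ x ∂(splitStep (S.trunc (1 / (M * τ))) (P.Φ τ) τ f) =
        ∫ x, φ x ∂f + τ * P.discGen M τ φ f := by
  have hb : 0 ≤ 1 / (M * τ) := by positivity
  obtain ⟨h1, h2, h3, h4⟩ := splitStep_integral (f := f) (S.continuous_trunc).measurable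
    (S.trunc_nonneg hb) (S.trunc_le (b := 1 / (M * τ))) S.trunc_symm
    (P.continuous_Φ τ hτ).measurable hτ.le (tau_mul_lossRate_le hτ hM hmass) (hW.const_mul B)
    (fun x => mul_le_mul_of_nonneg_left (P.W_Φ τ hτ x) hB) (C := S.C)
    (fun x y => by linarith [mul_le_mul_of_nonneg_left (S.W_add x y) hB]) hφ hφW
  refine ⟨h1, h2, h3, ?_⟩
  rw [h4, discGen, integral_const_mul]
  field_simp
  ring

theorem FusionFlow.step_moment_le (P : FusionFlow S) [IsFiniteMeasure f] (hτ : 0 < τ) (hM : 0 < M)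
    (hmass : f.real univ ≤ M) (hW : Integrable S.W f) {φ Z : X → ℝ} (hφ : Measurable φ)
    (hZ : Measurable Z) (hφ0 : ∀ x, 0 ≤ φ x) (hφW : ∀ x, φ x ≤ S.W x) (hZ0 : ∀ x, 0 ≤ Z x)
    (hZW : ∀ x, Z x ≤ S.W x) (hφΦ : ∀ x, φ (P.Φ τ x) ≤ φ x) {C : ℝ} (hC : 0 ≤ C)
    (hK : ∀ x y, S.K (x, y) * (φ (x + y) - φ x - φ y) ≤ C * (φ x * Z y + Z x * φ y)) :
    ∫ x, φ x ∂(splitStep (S.trunc (1 / (M * τ))) (P.Φ τ) τ f) ≤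
      (∫ x, φ x ∂f) * (1 + τ * (C * ∫ x, Z x ∂f)) := by
  have hb : 0 ≤ 1 / (M * τ) := by positivity
  obtain ⟨-, h2, h3, h4⟩ := P.step_integral hτ hM hmass hW hφ zero_le_one
    (fun x => by rw [abs_of_nonneg (hφ0 x), one_mul]; exact hφW x)
  have hφi : Integrable φ f := hW.mono' hφ.aestronglyMeasurable
    (ae_of_all _ fun x => by rw [Real.norm_eq_abs, abs_of_nonneg (hφ0 x)]; exact hφW x)
  have hZi : Integrable Z f := hW.mono' hZ.aestronglyMeasurable
    (ae_of_all _ fun x => by rw [Real.norm_eq_abs, abs_of_nonneg (hZ0 x)]; exact hZW x)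
  have hm1 : Integrable (fun z : X × X => φ z.1 * Z z.2) (f.prod f) := hφi.mul_prod hZi
  have hm2 : Integrable (fun z : X × X => Z z.1 * φ z.2) (f.prod f) := hZi.mul_prod hφi
  have h5 : ∫ z : X × X, S.trunc (1 / (M * τ)) z * (φ (z.1 + z.2) - φ z.1 - φ z.2) ∂(f.prod f) ≤
      2 * (C * ((∫ x, φ x ∂f) * ∫ x, Z x ∂f)) := by
    refine (integral_mono h2 ((hm1.add hm2).const_mul C) fun z => ?_).trans_eq ?_
    · exact S.trunc_mul_le hb (mul_nonneg hC (add_nonneg (mul_nonneg (hφ0 _) (hZ0 _))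
        (mul_nonneg (hZ0 _) (hφ0 _)))) (hK z.1 z.2)
    · rw [integral_const_mul, integral_add' hm1 hm2, integral_prod_mul, integral_prod_mul]
      ring
  have h6 : ∫ x, τ⁻¹ * ((φ (P.Φ τ x) - φ x) *
      (1 - τ * lossRate (S.trunc (1 / (M * τ))) f x)) ∂f ≤ 0 := by
    refine integral_nonpos fun x => ?_
    refine mul_nonpos_of_nonneg_of_nonpos (by positivity)
      (mul_nonpos_of_nonpos_of_nonneg (by simpa using hφΦ x) ?_)
    simpa using tau_mul_lossRate_le hτ hM hmass x
  rw [h4, discGen]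
  have := mul_le_mul_of_nonneg_left h5 hτ.le
  have := mul_nonpos_of_nonneg_of_nonpos hτ.le h6
  linarith

/-- Propagation of finiteness, mass and moments along the scheme. -/
theorem FusionFlow.scheme_bounds (P : FusionFlow S) [IsFiniteMeasure f₀] (hτ : 0 < τ) (hM : 0 < M)
    (hmass : f₀.real univ ≤ M) (hW : Integrable S.W f₀) (j : ℕ) :
    IsFiniteMeasure (P.scheme M τ f₀ j) ∧ (P.scheme M τ f₀ j).real univ ≤ M ∧
      Integrable S.W (P.scheme M τ f₀ j) ∧
      ∫ x, S.W x ∂(P.scheme M τ f₀ j) ≤ S.momentBound f₀ (j * τ) := by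
  have hm1 : 0 ≤ ∫ x, S.Z₁ x ∂f₀ := integral_nonneg S.Z₁_nonneg
  have hm2 : 0 ≤ ∫ x, S.W x ∂f₀ := integral_nonneg S.W_nonneg
  have hC := S.C_nonneg
  suffices h : IsFiniteMeasure (P.scheme M τ f₀ j) ∧ (P.scheme M τ f₀ j).real univ ≤ M ∧
      Integrable S.W (P.scheme M τ f₀ j) ∧
      ∫ x, S.Z₀ x ∂(P.scheme M τ f₀ j) ≤ ∫ x, S.Z₀ x ∂f₀ ∧
      ∫ x, S.Z₁ x ∂(P.scheme M τ f₀ j) ≤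
        (∫ x, S.Z₁ x ∂f₀) * exp (S.C * (∫ x, S.Z₀ x ∂f₀) * (j * τ)) ∧
      ∫ x, S.W x ∂(P.scheme M τ f₀ j) ≤ S.momentBound f₀ (j * τ) from
    ⟨h.1, h.2.1, h.2.2.1, h.2.2.2.2.2⟩
  induction j with
  | zero =>
    exact ⟨‹_›, hmass, hW, le_rfl, by simp [scheme], by simp [scheme, CoagSystem.momentBound]⟩
  | succ j ih =>
    obtain ⟨i1, i2, i3, i4, i5, i6⟩ := ih
    have hb : 0 ≤ 1 / (M * τ) := by positivity
    have hZ0 : ∀ x, S.Z₀ x ≤ S.W x := fun x => (S.Z₀_le x).trans (S.Z₁_le x)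
    have h1 : IsFiniteMeasure (P.scheme M τ f₀ (j + 1)) :=
      isFiniteMeasure_splitStep (S.trunc_nonneg hb) S.trunc_le hτ.le
    refine ⟨h1, ?_, ?_, ?_, ?_, ?_⟩
    · have := P.step_moment_le hτ hM i2 i3 (φ := fun _ => 1) (Z := fun _ => 0) measurable_const
        measurable_const (fun _ => zero_le_one) S.one_le_W (fun _ => le_rfl) S.W_nonneg
        (fun _ => le_rfl) le_rfl (fun x y => by
          have := S.K_nonneg (x, y)
          linarith)
      simp only [integral_const, smul_eq_mul, mul_one, mul_zero, add_zero] at this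
      exact this.trans i2
    · exact (P.step_integral hτ hM i2 i3 S.continuous_W.measurable zero_le_one
        (fun x => by rw [abs_of_nonneg (S.W_nonneg x), one_mul])).1
    · have := P.step_moment_le hτ hM i2 i3 (φ := S.Z₀) (Z := fun _ => 0)
        S.continuous_Z₀.measurable
        measurable_const S.Z₀_nonneg hZ0 (fun _ => le_rfl) S.W_nonneg
        (P.Z₀_Φ τ hτ) le_rfl (fun x y => by
          have := mul_nonpos_of_nonneg_of_nonpos (S.K_nonneg (x, y))
            (show S.Z₀ (x + y) - S.Z₀ x - S.Z₀ y ≤ 0 by linarith [S.K_Z₀ x y])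
          simpa using this)
      simp only [zero_mul, mul_zero, add_zero, mul_one] at this
      exact this.trans i4
    · have := P.step_moment_le hτ hM i2 i3 (φ := S.Z₁) (Z := S.Z₀)
        S.continuous_Z₁.measurable S.continuous_Z₀.measurable S.Z₁_nonneg S.Z₁_le S.Z₀_nonneg hZ0
        (P.Z₁_Φ τ hτ) hC S.K_Z₁
      refine this.trans ?_
      calc _ ≤ ((∫ x, S.Z₁ x ∂f₀) * exp (S.C * (∫ x, S.Z₀ x ∂f₀) * (j * τ))) *
            exp (S.C * (∫ x, S.Z₀ x ∂f₀) * τ) := by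
            refine mul_le_mul i5 ?_ ?_ (by positivity)
            · refine le_trans ?_ (Real.add_one_le_exp _)
              nlinarith [mul_le_mul_of_nonneg_left i4 (mul_nonneg hτ.le hC)]
            · have : 0 ≤ ∫ x, S.Z₀ x ∂(P.scheme M τ f₀ j) := integral_nonneg S.Z₀_nonneg
              positivity
        _ = _ := by
            rw [mul_assoc, ← Real.exp_add]
            push_cast
            ring_nf
    · have := P.step_moment_le hτ hM i2 i3 (φ := S.W) (Z := S.Z₁)
        S.continuous_W.measurable S.continuous_Z₁.measurable S.W_nonneg (fun _ => le_rfl)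
        S.Z₁_nonneg S.Z₁_le (P.W_Φ τ hτ) hC S.K_W
      refine this.trans ?_
      unfold CoagSystem.momentBound at i6 ⊢
      set A := (∫ x, S.Z₁ x ∂f₀) * exp (S.C * (∫ x, S.Z₀ x ∂f₀) * (j * τ)) with hA
      have hZ : 0 ≤ ∫ x, S.Z₀ x ∂f₀ := integral_nonneg S.Z₀_nonneg
      calc _ ≤ ((∫ x, S.W x ∂f₀) * exp (S.C * A * (j * τ))) * exp (S.C * A * τ) := by
            refine mul_le_mul i6 ?_ ?_ (by positivity)
            · refine le_trans ?_ (Real.add_one_le_exp _)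
              nlinarith [mul_le_mul_of_nonneg_left i5 (mul_nonneg hτ.le hC)]
            · have : 0 ≤ ∫ x, S.Z₁ x ∂(P.scheme M τ f₀ j) := integral_nonneg S.Z₁_nonneg
              positivity
        _ = (∫ x, S.W x ∂f₀) * exp (S.C * A * ((j + 1 : ℕ) * τ)) := by
            rw [mul_assoc, ← Real.exp_add]
            push_cast
            ring_nf
        _ ≤ _ := by
            rw [hA]
            gcongr
            exact j.le_succ

end Scheme

section StepFunctions

open scoped NNReal

theorem intervalIntegrable_comp_floor (a : ℕ → ℝ) {τ : ℝ} (hτ : 0 < τ) (u v : ℝ) :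
    IntervalIntegrable (fun s => a ⌊s / τ⌋₊) volume u v := by
  have hm : Measurable fun s : ℝ => a ⌊s / τ⌋₊ :=
    (measurable_from_nat (f := a)).comp (Nat.measurable_floor.comp (measurable_id.div_const τ))
  rw [intervalIntegrable_iff]
  refine Measure.integrableOn_of_bounded (M := ∑ j ∈ Finset.range (⌊max u v / τ⌋₊ + 1), |a j|)
    (by simp) hm.aestronglyMeasurable ?_
  refine (ae_restrict_iff' measurableSet_uIoc).2 (ae_of_all _ fun s hs => ?_)
  refine Finset.single_le_sum (f := fun j => |a j|) (fun j _ => abs_nonneg _) ?_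
  rw [Finset.mem_range, Nat.lt_succ_iff]
  exact Nat.floor_le_floor (div_le_div_of_nonneg_right hs.2 hτ.le)

theorem integral_comp_floor (a : ℕ → ℝ) {τ : ℝ} (hτ : 0 < τ) (k : ℕ) :
    ∫ s in (0 : ℝ)..(k * τ), a ⌊s / τ⌋₊ = τ * ∑ j ∈ Finset.range k, a j := by
  have h := intervalIntegral.sum_integral_adjacent_intervals (μ := volume)
    (f := fun s : ℝ => a ⌊s / τ⌋₊) (a := fun j : ℕ => (j : ℝ) * τ) (n := k)
    fun j _ => intervalIntegrable_comp_floor a hτ _ _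
  simp only [Nat.cast_zero, zero_mul] at h
  rw [← h, Finset.mul_sum]
  refine Finset.sum_congr rfl fun j _ => ?_
  have hle : (j : ℝ) * τ ≤ (j + 1 : ℕ) * τ := by
    push_cast; nlinarith
  have h1 : ∫ s in ((j : ℝ) * τ)..((j + 1 : ℕ) * τ), a ⌊s / τ⌋₊ =
      ∫ s in ((j : ℝ) * τ)..((j + 1 : ℕ) * τ), a j := by
    refine intervalIntegral.integral_congr_ae ?_
    have hne : ∀ᵐ s : ℝ, s ≠ (j + 1 : ℕ) * τ := by simp [ae_iff]
    filter_upwards [hne] with s hs hmem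
    rw [uIoc_of_le hle] at hmem
    have : ⌊s / τ⌋₊ = j := by
      rw [Nat.floor_eq_iff (div_nonneg ((mul_nonneg j.cast_nonneg hτ.le).trans hmem.1.le) hτ.le),
        le_div_iff₀ hτ, div_lt_iff₀ hτ]
      refine ⟨hmem.1.le, ?_⟩
      have := lt_of_le_of_ne hmem.2 hs
      push_cast at this
      exact this
    rw [this]
  rw [h1]
  simp only [intervalIntegral.integral_const, smul_eq_mul]
  push_cast
  ring

theorem abs_sum_sub_integral_comp_floor_le {a : ℕ → ℝ} {τ t A : ℝ} (hτ : 0 < τ) (ht : 0 ≤ t)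
    (ha : ∀ j : ℕ, j * τ ≤ t → |a j| ≤ A) :
    |τ * ∑ j ∈ Finset.range ⌊t / τ⌋₊, a j - ∫ s in (0 : ℝ)..t, a ⌊s / τ⌋₊| ≤ A * τ := by
  have hA : 0 ≤ A := (abs_nonneg _).trans (ha 0 (by simpa using ht))
  have h1 : (⌊t / τ⌋₊ : ℝ) * τ ≤ t := by
    rw [← le_div_iff₀ hτ]; exact Nat.floor_le (div_nonneg ht hτ.le)
  have h2 : t < (⌊t / τ⌋₊ : ℝ) * τ + τ := by
    have := Nat.lt_floor_add_one (t / τ)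
    rw [div_lt_iff₀ hτ] at this
    linarith
  have h3 : ‖∫ s in (⌊t / τ⌋₊ * τ)..t, a ⌊s / τ⌋₊‖ ≤ A * |t - ⌊t / τ⌋₊ * τ| := by
    refine intervalIntegral.norm_integral_le_of_norm_le_const fun s hs => ?_
    rw [uIoc_of_le h1] at hs
    refine ha _ ?_
    have hs0 : 0 ≤ s := le_trans (by positivity) hs.1.le
    have : (⌊s / τ⌋₊ : ℝ) * τ ≤ s := by
      rw [← le_div_iff₀ hτ]; exact Nat.floor_le (div_nonneg hs0 hτ.le)
    exact this.trans hs.2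
  have h4 : |t - ⌊t / τ⌋₊ * τ| ≤ τ := by
    rw [abs_le]
    constructor <;> linarith
  rw [← integral_comp_floor a hτ, abs_sub_comm, intervalIntegral.integral_interval_sub_left
    (intervalIntegrable_comp_floor a hτ _ _) (intervalIntegrable_comp_floor a hτ _ _)]
  exact h3.trans (mul_le_mul_of_nonneg_left h4 hA)

end StepFunctions

section WeakLimit

open scoped NNReal BoundedContinuousFunction

variable {X : Type*} [PseudoMetricSpace X] [Add X]

theorem CoagSystem.isSubweight_prod (S : CoagSystem X) (c : ℝ) :
    IsSubweight (fun z : X × X => S.W z.1 * S.W z.2)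
      (fun z => c * (S.U z.1 ^ 2 * S.U z.2 ^ 2)) := by
  have h1 : ∀ z : X × X, 1 ≤ S.W z.1 * S.W z.2 := fun z =>
    one_le_mul_of_one_le_of_one_le (S.one_le_W _) (S.one_le_W _)
  refine IsSubweight.const_mul (fun z => zero_le_one.trans (h1 z)) ?_ c
  refine (IsSubweight.rpow h1 (s := 2 / 3) (by norm_num) (by norm_num)).mono fun z => ?_
  rw [abs_of_nonneg (by positivity), Real.mul_rpow (S.W_nonneg _) (S.W_nonneg _)]
  exact mul_le_mul (S.U_sq_le_rpow _) (S.U_sq_le_rpow _) (by positivity)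
    (Real.rpow_nonneg (S.W_nonneg _) _)

/-- `g` is the derivative of `φ` along the discrete flow, locally uniformly. -/
def FusionFlow.IsGen {S : CoagSystem X} (P : FusionFlow S) (φ g : X → ℝ) : Prop :=
  Continuous g ∧ ∀ R, ∀ δ > 0, ∀ᶠ τ in 𝓝[>] (0 : ℝ), ∀ x, S.W x ≤ R →
    |τ⁻¹ * (φ (P.Φ τ x) - φ x) - g x| ≤ δ

theorem FusionFlow.IsGen.abs_le {S : CoagSystem X} {P : FusionFlow S} {φ g : X → ℝ} {B : ℝ}
    (hg : P.IsGen φ g)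
    (hφ : P.IsAdm φ B) (x : X) : |g x| ≤ B * P.G x := by
  refine le_of_forall_pos_le_add fun δ hδ => ?_
  obtain ⟨τ, hτ, h⟩ := ((hg.2 (S.W x) δ hδ).and self_mem_nhdsWithin).exists
  have hτ' : 0 < τ := h
  have h1 := hτ x le_rfl
  have h2 := hφ.abs_sub_le τ hτ' x
  have h3 : |τ⁻¹ * (φ (P.Φ τ x) - φ x)| ≤ B * P.G x := by
    rw [abs_mul, abs_of_nonneg (inv_nonneg.2 hτ'.le)]
    calc _ ≤ τ⁻¹ * (B * (τ * P.G x)) := by gcongr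
      _ = _ := by field_simp
  rw [_root_.abs_le] at *
  constructor <;> linarith

variable [MeasurableSpace X]

/-- The coagulation operator plus a drift term, in weak form. -/
noncomputable def CoagSystem.weakOp (S : CoagSystem X) (φ g : X → ℝ) (f : Measure X) : ℝ :=
  (1 / 2) * ∫ z : X × X, S.K z * (φ (z.1 + z.2) - φ z.1 - φ z.2) ∂(f.prod f) + ∫ x, g x ∂f

variable [BorelSpace X]

/-- Sets of finite measures with bounded `W`-moment are relatively compact. -/
theorem CoagSystem.exists_isCompact_of_moment [T2Space X] (S : CoagSystem X) (I : ℝ) :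
    ∃ A : Set (FiniteMeasure X), IsCompact A ∧ ∀ μ : FiniteMeasure X,
      Integrable S.W (μ : Measure X) → ∫ x, S.W x ∂(μ : Measure X) ≤ I → μ ∈ A := by
  have hu : Tendsto (fun n : ℕ => I.toNNReal / ((n : ℝ≥0) + 1)) atTop (𝓝 0) := by
    rw [← NNReal.tendsto_coe]
    push_cast
    exact tendsto_const_nhds.div_atTop
      (tendsto_atTop_add_const_right _ _ tendsto_natCast_atTop_atTop)
  have hcomp := isCompact_setOfPred_finiteMeasure_mass_le_compl_isCompact_le (E := X)
    (K := fun n : ℕ => {x | S.W x ≤ n + 1}) I.toNNReal hu (fun n => S.isCompact_W_le _) (Or.inr ?_)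
  · refine ⟨_, hcomp, fun μ hW hI => ?_⟩
    have hI0 : 0 ≤ I := (integral_nonneg S.W_nonneg).trans hI
    refine ⟨?_, fun n => ?_⟩
    · rw [← NNReal.coe_le_coe, Real.coe_toNNReal _ hI0]
      refine le_trans ?_ hI
      calc (μ.mass : ℝ) = ∫ x, 1 ∂(μ : Measure X) := by
            rw [integral_const, smul_eq_mul, mul_one]; rfl
        _ ≤ _ := integral_mono (integrable_const _) hW S.one_le_W
    · rw [← NNReal.coe_le_coe, NNReal.coe_div, Real.coe_toNNReal _ hI0, le_div_iff₀ (by positivity)]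
      refine le_trans ?_ hI
      have h := mul_meas_ge_le_integral_of_nonneg (ae_of_all _ S.W_nonneg) hW ((n : ℝ) + 1)
      have h2 : ((μ {x | S.W x ≤ n + 1}ᶜ : ℝ≥0) : ℝ) ≤
          (μ : Measure X).real {x | (n : ℝ) + 1 ≤ S.W x} := by
        refine measureReal_mono (μ := (μ : Measure X)) (fun x hx => ?_)
        simp only [mem_compl_iff, mem_ofPred_eq, not_le] at hx ⊢
        exact hx.le
      push_cast
      have h3 : (0 : ℝ) ≤ n + 1 := by positivity
      calc _ ≤ (μ : Measure X).real {x | (n : ℝ) + 1 ≤ S.W x} * (n + 1) :=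
            mul_le_mul_of_nonneg_right h2 h3
        _ ≤ _ := by rw [mul_comm]; exact h
  · intro n m hnm x hx
    have : (n : ℝ) ≤ m := by exact_mod_cast hnm
    simp only [mem_ofPred_eq] at hx ⊢
    linarith

variable [SecondCountableTopology X] [ContinuousAdd X]

/-- Stability of the weak form of the coagulation operator with drift. -/
theorem CoagSystem.tendsto_weakOp [Nonempty X] (S : CoagSystem X) {ι : Type*} {l : Filter ι}
    {μs : ι → FiniteMeasure X} {μ : FiniteMeasure X} (h : Tendsto μs l (𝓝 μ)) {I : ℝ}
    (hI : ∀ᶠ i in l, Integrable S.W (μs i : Measure X) ∧ ∫ x, S.W x ∂(μs i : Measure X) ≤ I)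
    {ks : ι → X × X → ℝ} (hkm : ∀ i, Measurable (ks i))
    (hk0 : ∀ᶠ i in l, ∀ z, 0 ≤ ks i z) (hkK : ∀ᶠ i in l, ∀ z, ks i z ≤ S.K z)
    (hk : ∀ R, ∀ᶠ i in l, ∀ z : X × X, S.W z.1 * S.W z.2 ≤ R → ks i z = S.K z)
    {φs γs : ι → X → ℝ} {φ γ H : X → ℝ} {B : ℝ} (hB : 0 ≤ B)
    (hφsm : ∀ i, Measurable (φs i)) (hφc : Continuous φ)
    (hφsB : ∀ᶠ i in l, ∀ x, |φs i x| ≤ B * S.U x) (hφB : ∀ x, |φ x| ≤ B * S.U x)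
    (hφ : ∀ R, ∀ δ > 0, ∀ᶠ i in l, ∀ x, S.W x ≤ R → |φs i x - φ x| ≤ δ)
    (hγsm : ∀ i, Measurable (γs i)) (hγc : Continuous γ) (hH : IsSubweight S.W H)
    (hγsH : ∀ᶠ i in l, ∀ x, |γs i x| ≤ H x) (hγH : ∀ x, |γ x| ≤ H x)
    (hγ : ∀ R, ∀ δ > 0, ∀ᶠ i in l, ∀ x, S.W x ≤ R → |γs i x - γ x| ≤ δ) :
    Tendsto (fun i => (1 / 2) * ∫ z : X × X, ks i z * (φs i (z.1 + z.2) - φs i z.1 - φs i z.2)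
        ∂((μs i : Measure X).prod (μs i : Measure X)) + ∫ x, γs i x ∂(μs i : Measure X)) l
      (𝓝 (S.weakOp φ γ μ)) := by
  refine Tendsto.add (Tendsto.const_mul _ ?_) ?_
  · have hprod := FiniteMeasure.tendsto_prod_self h
    have hadd : Measurable fun z : X × X => z.1 + z.2 := measurable_fst.add measurable_snd
    have := tendsto_integral_of_isSubweight_of_uniform (X := X × X) hprod
      (W := fun z => S.W z.1 * S.W z.2)
      ((S.continuous_W.comp continuous_fst).mul (S.continuous_W.comp continuous_snd))
      (fun z => one_le_mul_of_one_le_of_one_le (S.one_le_W _) (S.one_le_W _)) (C := I ^ 2)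
      (Gs := fun i z => ks i z * (φs i (z.1 + z.2) - φs i z.1 - φs i z.2))
      (G := fun z => S.K z * (φ (z.1 + z.2) - φ z.1 - φ z.2)) ?_ ?_ ?_
      (S.isSubweight_prod (2 * B * S.C * (S.C + 1))) ?_ ?_ ?_
    · simpa only [FiniteMeasure.toMeasure_prod] using this
    · filter_upwards [hI] with i hi
      rw [FiniteMeasure.toMeasure_prod]
      refine ⟨hi.1.mul_prod hi.1, ?_⟩
      rw [integral_prod_mul, ← sq]
      exact pow_le_pow_left₀ (integral_nonneg S.W_nonneg) hi.2 2
    · exact fun i => (hkm i).mul ((((hφsm i).comp hadd).sub ((hφsm i).comp measurable_fst)).sub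
        ((hφsm i).comp measurable_snd))
    · have := S.continuous_K
      fun_prop
    · filter_upwards [hk0, hkK, hφsB] with i h0 h1 h2 z
      rw [abs_mul, abs_of_nonneg (h0 z)]
      exact (mul_le_mul_of_nonneg_right (h1 z) (abs_nonneg _)).trans
        (S.abs_K_mul_le hB h2 z.1 z.2)
    · intro z
      rw [abs_mul, abs_of_nonneg (S.K_nonneg z)]
      exact S.abs_K_mul_le hB hφB z.1 z.2
    · intro R δ hδ
      have hC := S.C_nonneg
      have hRC : 0 ≤ S.C * |R| := by positivity
      filter_upwards [hk R, hφ (S.C * (2 * |R|)) (δ / (3 * (S.C * |R| + 1))) (by positivity),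
        hφ |R| (δ / (3 * (S.C * |R| + 1))) (by positivity)] with i h1 h2 h3 z hz
      have hx := S.one_le_W z.1
      have hy := S.one_le_W z.2
      have hxR : S.W z.1 ≤ |R| := by nlinarith [le_abs_self R]
      have hyR : S.W z.2 ≤ |R| := by nlinarith [le_abs_self R]
      have hadd : S.W (z.1 + z.2) ≤ S.C * (2 * |R|) :=
        (S.W_add _ _).trans (mul_le_mul_of_nonneg_left (by linarith) hC)
      rw [h1 z hz, ← mul_sub, abs_mul, abs_of_nonneg (S.K_nonneg z)]
      have hK : S.K z ≤ S.C * |R| := by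
        refine (S.K_le z.1 z.2).trans (mul_le_mul_of_nonneg_left ?_ hC)
        refine le_trans ?_ (hz.trans (le_abs_self R))
        exact mul_le_mul (S.U_le_W _) (S.U_le_W _) (S.U_nonneg _) (S.W_nonneg _)
      have e1 := h2 _ hadd
      have e2 := h3 _ hxR
      have e3 := h3 _ hyR
      have e4 : |φs i (z.1 + z.2) - φs i z.1 - φs i z.2 - (φ (z.1 + z.2) - φ z.1 - φ z.2)| ≤
          3 * (δ / (3 * (S.C * |R| + 1))) := by
        rw [abs_le] at *
        constructor <;> linarith
      calc _ ≤ (S.C * |R|) * (3 * (δ / (3 * (S.C * |R| + 1)))) :=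
            mul_le_mul hK e4 (abs_nonneg _) hRC
        _ = (S.C * |R|) / (S.C * |R| + 1) * δ := by field_simp
        _ ≤ 1 * δ := by
            refine mul_le_mul_of_nonneg_right ?_ hδ.le
            rw [div_le_one (by positivity)]; linarith
        _ = δ := one_mul _
  · exact tendsto_integral_of_isSubweight_of_uniform h S.continuous_W S.one_le_W hI hγsm hγc hH
      hγsH hγH hγ

variable {S : CoagSystem X}

/-- Convergence of the discrete generator. -/
theorem FusionFlow.tendsto_discGen [Nonempty X] (P : FusionFlow S) {M : ℝ} (hM : 0 < M)
    {τs : ℕ → ℝ} (hτ0 : ∀ n, 0 < τs n) (hτ : Tendsto τs atTop (𝓝 0))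
    {μs : ℕ → FiniteMeasure X} {μ : FiniteMeasure X} (h : Tendsto μs atTop (𝓝 μ)) {I : ℝ}
    (hmass : ∀ n, (μs n : Measure X).real univ ≤ M)
    (hI : ∀ n, Integrable S.W (μs n : Measure X) ∧ ∫ x, S.W x ∂(μs n : Measure X) ≤ I)
    {φ g : X → ℝ} {B : ℝ} (hφ : P.IsAdm φ B) (hg : P.IsGen φ g) :
    Tendsto (fun n => P.discGen M (τs n) φ (μs n)) atTop (𝓝 (S.weakOp φ g μ)) := by
  have hB := hφ.nonneg
  have hC := S.C_nonneg
  have hb : ∀ n, 0 ≤ 1 / (M * τs n) := fun n => by have := hτ0 n; positivity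
  have hI0 : 0 ≤ I := (integral_nonneg S.W_nonneg).trans (hI 0).2
  have hτ' : Tendsto τs atTop (𝓝[>] 0) :=
    tendsto_nhdsWithin_iff.2 ⟨hτ, Eventually.of_forall hτ0⟩
  have hL1 : ∀ n x, τs n * lossRate (S.trunc (1 / (M * τs n))) (μs n : Measure X) x ≤ 1 :=
    fun n x => tau_mul_lossRate_le (hτ0 n) hM (hmass n) x
  have hL0 : ∀ n x, 0 ≤ lossRate (S.trunc (1 / (M * τs n))) (μs n : Measure X) x :=
    fun n x => lossRate_nonneg (S.trunc_nonneg (hb n)) x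
  have hdq : ∀ n x, |(τs n)⁻¹ * (φ (P.Φ (τs n) x) - φ x)| ≤ B * P.G x := by
    intro n x
    have := hτ0 n
    rw [abs_mul, abs_of_nonneg (inv_nonneg.2 this.le)]
    calc _ ≤ (τs n)⁻¹ * (B * (τs n * P.G x)) := by
          gcongr
          exact hφ.abs_sub_le _ this x
      _ = _ := by field_simp
  have hUint : ∀ n, ∫ x, S.U x ∂(μs n : Measure X) ≤ I := fun n =>
    (integral_mono ((hI n).1.mono' S.continuous_U.measurable.aestronglyMeasurable
      (ae_of_all _ fun x => by
        rw [Real.norm_eq_abs, abs_of_nonneg (S.U_nonneg x)]; exact S.U_le_W x)) (hI n).1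
      S.U_le_W).trans (hI n).2
  have hLU : ∀ n x, lossRate (S.trunc (1 / (M * τs n))) (μs n : Measure X) x ≤
      S.C * S.U x * I := by
    intro n x
    have hUi : Integrable S.U (μs n : Measure X) :=
      (hI n).1.mono' S.continuous_U.measurable.aestronglyMeasurable
      (ae_of_all _ fun x => by
        rw [Real.norm_eq_abs, abs_of_nonneg (S.U_nonneg x)]; exact S.U_le_W x)
    calc lossRate (S.trunc (1 / (M * τs n))) (μs n : Measure X) x
        ≤ ∫ y, S.C * S.U x * S.U y ∂(μs n : Measure X) := by
          refine integral_mono_of_nonneg (ae_of_all _ fun y => S.trunc_nonneg (hb n) _)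
            (hUi.const_mul _) (ae_of_all _ fun y => ?_)
          exact (S.trunc_le_K _).trans ((S.K_le x y).trans_eq (by ring))
      _ = S.C * S.U x * ∫ y, S.U y ∂(μs n : Measure X) := integral_const_mul _ _
      _ ≤ _ := mul_le_mul_of_nonneg_left (hUint n) (mul_nonneg hC (S.U_nonneg x))
  refine S.tendsto_weakOp h (Eventually.of_forall hI)
    (ks := fun n => S.trunc (1 / (M * τs n))) (fun n => (S.continuous_trunc).measurable)
    (Eventually.of_forall fun n => S.trunc_nonneg (hb n))
    (Eventually.of_forall fun n => S.trunc_le_K)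
    ?_ (φs := fun _ => φ) (γs := fun n x => (τs n)⁻¹ * ((φ (P.Φ (τs n) x) - φ x) *
      (1 - τs n * lossRate (S.trunc (1 / (M * τs n))) (μs n : Measure X) x)))
    (H := fun x => B * P.G x) hB (fun _ => hφ.continuous.measurable) hφ.continuous
    (Eventually.of_forall fun _ => hφ.abs_le) hφ.abs_le ?_ ?_ hg.1
    (P.isSubweight_G.const_mul S.W_nonneg B) ?_ (hg.abs_le hφ) ?_
  · intro R
    have h1 : Tendsto (fun n => 1 / (M * τs n)) atTop atTop := by
      simp only [one_div, mul_inv]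
      exact (tendsto_inv_nhdsGT_zero.comp hτ').const_mul_atTop (inv_pos.2 hM)
    filter_upwards [h1.eventually_ge_atTop (S.C * R)] with n hn z hz
    refine min_eq_left (((S.K_le z.1 z.2).trans (mul_le_mul_of_nonneg_left ?_ hC)).trans hn)
    exact le_trans (mul_le_mul (S.U_le_W _) (S.U_le_W _) (S.U_nonneg _) (S.W_nonneg _)) hz
  · exact fun R δ hδ => Eventually.of_forall fun n x _ => by simpa using hδ.le
  · intro n
    have h1 := hφ.continuous.measurable
    have h2 := (P.continuous_Φ (τs n) (hτ0 n)).measurable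
    have h3 : Measurable (lossRate (S.trunc (1 / (M * τs n))) (μs n : Measure X)) :=
      measurable_lossRate S.continuous_trunc.measurable
    exact measurable_const.mul (((h1.comp h2).sub h1).mul
      (measurable_const.sub (measurable_const.mul h3)))
  · refine Eventually.of_forall fun n x => ?_
    have h1 := hL1 n x
    have h2 := mul_nonneg (hτ0 n).le (hL0 n x)
    rw [← mul_assoc, abs_mul, abs_of_nonneg (sub_nonneg.2 h1)]
    have := hdq n x
    nlinarith [abs_nonneg ((τs n)⁻¹ * (φ (P.Φ (τs n) x) - φ x))]
  · intro R δ hδ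
    have hE : Tendsto (fun n => B * (P.D * |R|) * (τs n * (S.C * |R| * I))) atTop (𝓝 0) := by
      simpa using (hτ.mul_const (S.C * |R| * I)).const_mul (B * (P.D * |R|))
    filter_upwards [hτ'.eventually (hg.2 R (δ / 2) (by positivity)),
      hE.eventually (ge_mem_nhds (show 0 < δ / 2 by positivity))] with n h1 h2 x hx
    have h3 := h1 x hx
    have hxR : S.W x ≤ |R| := hx.trans (le_abs_self R)
    have h4 : |(τs n)⁻¹ * (φ (P.Φ (τs n) x) - φ x) *
        (τs n * lossRate (S.trunc (1 / (M * τs n))) (μs n : Measure X) x)| ≤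
        B * (P.D * |R|) * (τs n * (S.C * |R| * I)) := by
      have := hτ0 n
      have hD := P.D_nonneg
      rw [abs_mul, abs_of_nonneg (mul_nonneg this.le (hL0 n x))]
      refine mul_le_mul ((hdq n x).trans ?_) ?_ (mul_nonneg this.le (hL0 n x)) (by positivity)
      · have := P.G_le x
        gcongr
        exact this.trans (by gcongr)
      · gcongr
        refine (hLU n x).trans ?_
        have := (S.U_le_W x).trans hxR
        gcongr
    have h5 : (τs n)⁻¹ * ((φ (P.Φ (τs n) x) - φ x) *
        (1 - τs n * lossRate (S.trunc (1 / (M * τs n))) (μs n : Measure X) x)) - g x =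
        ((τs n)⁻¹ * (φ (P.Φ (τs n) x) - φ x) - g x) - (τs n)⁻¹ * (φ (P.Φ (τs n) x) - φ x) *
        (τs n * lossRate (S.trunc (1 / (M * τs n))) (μs n : Measure X) x) := by ring
    rw [h5]
    refine (abs_sub _ _).trans ?_
    linarith

end WeakLimit

section Existence

open scoped NNReal BoundedContinuousFunction

variable {X : Type*} [PseudoMetricSpace X] [Add X] {S : CoagSystem X}

theorem CoagSystem.isSubweight_of_le_U {φ : X → ℝ} {B : ℝ} (hφ : ∀ x, |φ x| ≤ B * S.U x) :
    IsSubweight S.W φ := by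
  have h : IsSubweight S.W S.U :=
    (IsSubweight.rpow S.one_le_W (s := 2 / 3) (by norm_num) (by norm_num)).mono fun x => by
      rw [abs_of_nonneg (S.U_nonneg x)]
      exact (le_self_pow₀ (S.one_le_U x) (by norm_num)).trans (S.U_sq_le_rpow x)
  exact (h.const_mul S.W_nonneg B).mono hφ

theorem FusionFlow.isAdm_of_lipschitz (P : FusionFlow S) {φ : X → ℝ} {L : ℝ≥0} {b : ℝ}
    (hφ : LipschitzWith L φ) (hb : ∀ x, |φ x| ≤ b) (hb0 : 0 ≤ b) : P.IsAdm φ (b + L) where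
  nonneg := by positivity
  continuous := hφ.continuous
  abs_le x := (hb x).trans (by nlinarith [S.one_le_U x, L.coe_nonneg])
  abs_sub_le τ hτ x := by
    have h1 := hφ.dist_le_mul (P.Φ τ x) x
    rw [Real.dist_eq] at h1
    have h2 := mul_le_mul_of_nonneg_left (P.dist_le τ hτ x) L.coe_nonneg
    have h3 := mul_nonneg hb0 (mul_nonneg hτ.le (P.G_nonneg x))
    linarith

variable [MeasurableSpace X] [BorelSpace X] [SecondCountableTopology X] [ContinuousAdd X]

variable {P : FusionFlow S} {M τ : ℝ} {f₀ : Measure X}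

theorem FusionFlow.scheme_integral (P : FusionFlow S) [IsFiniteMeasure f₀] (hτ : 0 < τ)
    (hM : 0 < M) (hmass : f₀.real univ ≤ M) (hW : Integrable S.W f₀) {φ : X → ℝ} {B : ℝ}
    (hφ : P.IsAdm φ B) (k : ℕ) :
    ∫ x, φ x ∂(P.scheme M τ f₀ k) = ∫ x, φ x ∂f₀ +
      τ * ∑ j ∈ Finset.range k, P.discGen M τ φ (P.scheme M τ f₀ j) := by
  induction k with
  | zero => simp [scheme]
  | succ k ih =>
    obtain ⟨h1, h2, h3, -⟩ := P.scheme_bounds hτ hM hmass hW k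
    have := (P.step_integral hτ hM h2 h3 hφ.continuous.measurable hφ.nonneg
      (fun x => (hφ.abs_le x).trans (mul_le_mul_of_nonneg_left (S.U_le_W x) hφ.nonneg))).2.2.2
    rw [Finset.sum_range_succ, mul_add, ← add_assoc, ← ih]
    exact this

theorem FusionFlow.abs_discGen_scheme_le (P : FusionFlow S) [IsFiniteMeasure f₀] (hτ : 0 < τ)
    (hM : 0 < M) (hmass : f₀.real univ ≤ M) (hW : Integrable S.W f₀) {φ : X → ℝ} {B : ℝ}
    (hφ : P.IsAdm φ B) {t : ℝ} {j : ℕ} (hj : j * τ ≤ t) :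
    |P.discGen M τ φ (P.scheme M τ f₀ j)| ≤
      B * (S.C * (S.C + 1) * S.momentBound f₀ t ^ 2 + P.D * S.momentBound f₀ t) := by
  obtain ⟨h1, h2, h3, h4⟩ := P.scheme_bounds hτ hM hmass hW j
  exact P.abs_discGen_le hτ hM h2 h3 (h4.trans (S.momentBound_mono f₀ (by positivity) hj)) hφ

/-- Existence of solutions to the coagulation equation with transport, in integrated weak form. -/
theorem FusionFlow.exists_solution [T2Space X] [Nonempty X] (P : FusionFlow S) (f₀ : Measure X)
    [IsFiniteMeasure f₀] (hW : Integrable S.W f₀) :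
    ∃ f : ℝ≥0 → FiniteMeasure X, Continuous f ∧
      (∀ t, Integrable S.W (f t : Measure X) ∧
        ∫ x, S.W x ∂(f t : Measure X) ≤ S.momentBound f₀ t) ∧
      ∀ φ g B, P.IsAdm φ B → P.IsGen φ g → ∀ t : ℝ≥0,
        ∫ x, φ x ∂(f t : Measure X) = ∫ x, φ x ∂f₀ +
          ∫ s in (0 : ℝ)..t, S.weakOp φ g (f s.toNNReal : Measure X) := by
  set M : ℝ := f₀.real univ + 1 with hMdef
  have hM : 0 < M := by positivity
  have hmass : f₀.real univ ≤ M := by linarith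
  set τ : ℕ → ℝ := fun n => 1 / ((n : ℝ) + 1) with hτdef
  have hτ : ∀ n, 0 < τ n := fun n => by positivity
  have hτ0 : Tendsto τ atTop (𝓝 0) := tendsto_one_div_add_atTop_nhds_zero_nat
  have hfl : ∀ n (t : ℝ≥0), (⌊(t : ℝ) / τ n⌋₊ : ℝ) * τ n ≤ t := fun n t => by
    rw [← le_div_iff₀ (hτ n)]; exact Nat.floor_le (div_nonneg t.coe_nonneg (hτ n).le)
  let F : ℕ → ℝ≥0 → FiniteMeasure X := fun n t =>
    ⟨P.scheme M (τ n) f₀ ⌊(t : ℝ) / τ n⌋₊, (P.scheme_bounds (hτ n) hM hmass hW _).1⟩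
  have hFW : ∀ n t, Integrable S.W (F n t : Measure X) ∧
      ∫ x, S.W x ∂(F n t : Measure X) ≤ S.momentBound f₀ t := by
    intro n t
    obtain ⟨-, -, h3, h4⟩ := P.scheme_bounds (hτ n) hM hmass hW ⌊(t : ℝ) / τ n⌋₊
    exact ⟨h3, h4.trans (S.momentBound_mono f₀ (mul_nonneg (Nat.cast_nonneg _) (hτ n).le)
      (hfl n t))⟩
  have hFm : ∀ n t, (F n t : Measure X).real univ ≤ M := fun n t =>
    (P.scheme_bounds (hτ n) hM hmass hW ⌊(t : ℝ) / τ n⌋₊).2.1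
  let A : ℝ → ℝ → ℝ := fun B t =>
    B * (S.C * (S.C + 1) * S.momentBound f₀ t ^ 2 + P.D * S.momentBound f₀ t)
  let a : (X → ℝ) → ℕ → ℕ → ℝ := fun φ n j => P.discGen M (τ n) φ (P.scheme M (τ n) f₀ j)
  have ha : ∀ {φ : X → ℝ} {B : ℝ}, P.IsAdm φ B → ∀ n (t : ℝ) (j : ℕ), j * τ n ≤ t →
      |a φ n j| ≤ A B t := fun hφ n t j hj =>
    P.abs_discGen_scheme_le (hτ n) hM hmass hW hφ hj
  have hsum : ∀ {φ : X → ℝ} {B : ℝ}, P.IsAdm φ B → ∀ n (t : ℝ≥0) (T : ℝ), (t : ℝ) ≤ T →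
      |∫ x, φ x ∂(F n t : Measure X) - ∫ x, φ x ∂f₀ - ∫ s in (0 : ℝ)..t, a φ n ⌊s / τ n⌋₊| ≤
        A B T * τ n := by
    intro φ B hφ n t T htT
    have h1 := P.scheme_integral (hτ n) hM hmass hW hφ ⌊(t : ℝ) / τ n⌋₊
    have h2 : ∫ x, φ x ∂(F n t : Measure X) - ∫ x, φ x ∂f₀ =
        τ n * ∑ j ∈ Finset.range ⌊(t : ℝ) / τ n⌋₊, a φ n j := by
      rw [sub_eq_iff_eq_add']; exact h1
    rw [h2]
    exact abs_sum_sub_integral_comp_floor_le (hτ n) t.coe_nonneg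
      fun j hj => ha hφ n T j (hj.trans htT)
  have hafl : ∀ {φ : X → ℝ} {B : ℝ}, P.IsAdm φ B → ∀ n (s T : ℝ), 0 ≤ s → s ≤ T →
      |a φ n ⌊s / τ n⌋₊| ≤ A B T := fun hφ n s T hs hsT =>
    ha hφ n T _ ((hfl n ⟨s, hs⟩).trans hsT)
  obtain ⟨θ, hθ, f, hf, hFf⟩ := FiniteMeasure.exists_subseq_tendsto F
    (fun t => by
      obtain ⟨A, hA, h⟩ := S.exists_isCompact_of_moment (S.momentBound f₀ t)
      exact ⟨A, hA, fun n => h _ (hFW n t).1 (hFW n t).2⟩) (by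
    intro φ L hL t δ hδ
    have hadm := P.isAdm_of_lipschitz hL (fun x => φ.norm_coe_le_norm x) (norm_nonneg φ)
    set Q := |A (‖φ‖ + L) (t + 1)| with hQ
    refine ⟨min 1 (δ / (2 * (Q + 1))), by positivity, fun s hs => ?_⟩
    have hs1 : |(s : ℝ) - t| < 1 := by
      have := hs.trans_le (min_le_left _ _)
      rwa [NNReal.dist_eq] at this
    have hs2 : |(s : ℝ) - t| < δ / (2 * (Q + 1)) := by
      have := hs.trans_le (min_le_right _ _)
      rwa [NNReal.dist_eq] at this
    have hsT : (s : ℝ) ≤ t + 1 := by linarith [(abs_lt.1 hs1).2]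
    have hτQ : Tendsto (fun n => 2 * (Q * τ n)) atTop (𝓝 0) := by
      simpa using (hτ0.const_mul Q).const_mul 2
    filter_upwards [hτQ.eventually (ge_mem_nhds (show 0 < δ / 2 by positivity))] with n hn
    have h1 := hsum hadm n s (t + 1) hsT
    have h2 := hsum hadm n t (t + 1) (by linarith)
    have h3 : |(∫ r in (0 : ℝ)..s, a φ n ⌊r / τ n⌋₊) - ∫ r in (0 : ℝ)..t, a φ n ⌊r / τ n⌋₊| ≤
        Q * |(s : ℝ) - t| := by
      rw [intervalIntegral.integral_interval_sub_left (intervalIntegrable_comp_floor _ (hτ n) _ _)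
        (intervalIntegrable_comp_floor _ (hτ n) _ _)]
      rw [← Real.norm_eq_abs]
      refine intervalIntegral.norm_integral_le_of_norm_le_const fun r hr => ?_
      refine (hafl hadm n r (t + 1) ?_ ?_).trans (le_abs_self _)
      · exact (le_min t.coe_nonneg s.coe_nonneg).trans hr.1.le
      · exact hr.2.trans (max_le (by linarith) hsT)
    have h4 : Q * |(s : ℝ) - t| ≤ δ / 2 := by
      have hQ0 : 0 ≤ Q := abs_nonneg _
      calc Q * |(s : ℝ) - t| ≤ Q * (δ / (2 * (Q + 1))) := by gcongr
        _ = Q / (Q + 1) * (δ / 2) := by field_simp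
        _ ≤ 1 * (δ / 2) := by
          refine mul_le_mul_of_nonneg_right ?_ (by positivity)
          rw [div_le_one (by positivity)]; linarith
        _ = δ / 2 := one_mul _
    have h5 : A (‖φ‖ + L) (t + 1) * τ n ≤ Q * τ n :=
      mul_le_mul_of_nonneg_right (le_abs_self _) (hτ n).le
    rw [abs_le] at *
    constructor <;> linarith)
  have hfW : ∀ t, Integrable S.W (f t : Measure X) ∧
      ∫ x, S.W x ∂(f t : Measure X) ≤ S.momentBound f₀ t := fun t =>
    integral_weight_le_of_tendsto (hFf t) S.continuous_W S.W_nonneg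
      (Eventually.of_forall fun n => hFW (θ n) t)
  refine ⟨f, hf, hfW, fun φ g B hφ hg t => ?_⟩
  have h1 := tendsto_integral_of_isSubweight (hFf t) S.continuous_W S.W_nonneg
    (Eventually.of_forall fun n => hFW (θ n) t) hφ.continuous (S.isSubweight_of_le_U hφ.abs_le)
  have h2 : Tendsto (fun n => ∫ s in (0 : ℝ)..t, a φ (θ n) ⌊s / τ (θ n)⌋₊) atTop
      (𝓝 (∫ s in (0 : ℝ)..t, S.weakOp φ g (f s.toNNReal : Measure X))) := by
    refine intervalIntegral.tendsto_integral_filter_of_dominated_convergence (fun _ => A B t)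
      (Eventually.of_forall fun n =>
        (intervalIntegrable_iff.1
          (intervalIntegrable_comp_floor _ (hτ (θ n)) _ _)).aestronglyMeasurable)
      (Eventually.of_forall fun n => ae_of_all _ fun s hs => ?_) intervalIntegrable_const
      (ae_of_all _ fun s hs => ?_)
    · rw [uIoc_of_le t.coe_nonneg] at hs
      exact hafl hφ (θ n) s t hs.1.le hs.2
    · rw [uIoc_of_le t.coe_nonneg] at hs
      have h3 := P.tendsto_discGen hM (fun n => hτ (θ n)) (hτ0.comp hθ.tendsto_atTop)
        (hFf s.toNNReal) (fun n => hFm (θ n) _) (fun n => hFW (θ n) s.toNNReal) hφ hg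
      refine h3.congr fun n => ?_
      simp only [a, F, Real.coe_toNNReal _ hs.1.le, FiniteMeasure.toMeasure_mk]
  have h3 : Tendsto (fun n => ∫ x, φ x ∂(F (θ n) t : Measure X) - ∫ x, φ x ∂f₀ -
      ∫ s in (0 : ℝ)..t, a φ (θ n) ⌊s / τ (θ n)⌋₊) atTop (𝓝 0) := by
    refine squeeze_zero_norm (fun n => hsum hφ (θ n) t t le_rfl) ?_
    simpa using (hτ0.comp hθ.tendsto_atTop).const_mul (A B t)
  have h4 := tendsto_nhds_unique h3 ((h1.sub_const _).sub h2)
  linarith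

end Existence

section PowerInequalities

/-- The increment of a power function at a sum, relative to the larger summand. -/
theorem rpow_add_le_of_le (e : ℝ) {v w : ℝ} (hw : 0 < w) (hwv : w ≤ v) :
    (v + w) ^ e ≤ v ^ e + w ^ e + |e| * 2 ^ (e - 1) * (v ^ (e - 1) * w) := by
  have hv : 0 < v := hw.trans_le hwv
  have hrest : 0 ≤ |e| * 2 ^ (e - 1) * (v ^ (e - 1) * w) := by positivity
  rcases le_total e 0 with he | he
  · have h1 : (v + w) ^ e ≤ v ^ e := Real.rpow_le_rpow_of_nonpos hv (by linarith) he
    have h2 : 0 < w ^ e := by positivity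
    linarith
  rcases le_total e 1 with he1 | he1
  · have := Real.rpow_add_le_add_rpow hv.le hw.le he he1
    linarith
  have hvw : 0 < v + w := by positivity
  have h1 := one_add_mul_self_le_rpow_one_add (s := -(w / (v + w)))
    (by rw [neg_le_neg_iff, div_le_one hvw]; linarith) he1
  have h2 : 1 + -(w / (v + w)) = v / (v + w) := by field_simp; ring
  rw [h2, Real.div_rpow hv.le hvw.le, le_div_iff₀ (by positivity)] at h1
  have h3 : (v + w) ^ e = (v + w) ^ (e - 1) * (v + w) := by
    rw [← Real.rpow_add_one hvw.ne']; ring_nf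
  have h4 : (1 + e * -(w / (v + w))) * (v + w) ^ e = (v + w) ^ e - e * ((v + w) ^ (e - 1) * w) := by
    rw [h3]; field_simp; ring
  have h5 : (v + w) ^ (e - 1) ≤ 2 ^ (e - 1) * v ^ (e - 1) := by
    rw [← Real.mul_rpow (by norm_num) hv.le]
    exact Real.rpow_le_rpow hvw.le (by linarith) (by linarith)
  have h6 : e * ((v + w) ^ (e - 1) * w) ≤ |e| * 2 ^ (e - 1) * (v ^ (e - 1) * w) := by
    rw [abs_of_nonneg he]
    calc _ ≤ e * ((2 ^ (e - 1) * v ^ (e - 1)) * w) := by gcongr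
      _ = _ := by ring
  have h7 : 0 < w ^ e := by positivity
  linarith

theorem rpow_add_le_two_rpow_mul (e : ℝ) {v w : ℝ} (hv : 0 < v) (hw : 0 < w) :
    (v + w) ^ e ≤ 2 ^ |e| * (v ^ e + w ^ e) := by
  have hv' : 0 < v ^ e := by positivity
  have hw' : 0 < w ^ e := by positivity
  rcases le_total e 0 with he | he
  · have h1 : (v + w) ^ e ≤ v ^ e := Real.rpow_le_rpow_of_nonpos hv (by linarith) he
    have h2 : (1 : ℝ) ≤ 2 ^ |e| := Real.one_le_rpow (by norm_num) (abs_nonneg e)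
    nlinarith
  · rw [abs_of_nonneg he]
    have h0 : (0 : ℝ) < 2 ^ e := by positivity
    rcases le_total v w with h | h
    · have := Real.rpow_le_rpow (by positivity) (show v + w ≤ 2 * w by linarith) he
      rw [Real.mul_rpow (by norm_num) hw.le] at this
      nlinarith
    · have := Real.rpow_le_rpow (by positivity) (show v + w ≤ 2 * v by linarith) he
      rw [Real.mul_rpow (by norm_num) hv.le] at this
      nlinarith

theorem rpow_le_rpow_add_rpow_neg {v s p : ℝ} (hv : 0 < v) (hs : |s| ≤ p) :
    v ^ s ≤ v ^ p + v ^ (-p) := by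
  have h1 : 0 < v ^ p := by positivity
  have h2 : 0 < v ^ (-p) := by positivity
  rw [abs_le] at hs
  rcases le_total 1 v with h | h
  · linarith [Real.rpow_le_rpow_of_exponent_le h hs.2]
  · linarith [Real.rpow_le_rpow_of_exponent_ge hv h hs.1]

theorem rpow_le_one_add_rpow {v s e : ℝ} (hv : 0 < v) (hs : 0 ≤ s) (hse : s ≤ e) :
    v ^ s ≤ 1 + v ^ e := by
  have h1 : 0 < v ^ e := by positivity
  rcases le_total 1 v with h | h
  · linarith [Real.rpow_le_rpow_of_exponent_le h hse]
  · linarith [Real.rpow_le_one hv.le h hs]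

theorem rpow_sub_one_mul_le {X Y p : ℝ} (hX : 0 < X) (hY : 0 < Y) (hp : 1 ≤ p) :
    X ^ (p - 1) * Y ≤ X ^ p + Y ^ p := by
  have hX' : X ^ p = X ^ (p - 1) * X := by rw [← Real.rpow_add_one hX.ne']; ring_nf
  have hY' : Y ^ p = Y ^ (p - 1) * Y := by rw [← Real.rpow_add_one hY.ne']; ring_nf
  have h1 : 0 < X ^ p := by positivity
  have h2 : 0 < Y ^ p := by positivity
  rcases le_total X Y with h | h
  · have := mul_le_mul_of_nonneg_right
      (Real.rpow_le_rpow hX.le h (show 0 ≤ p - 1 by linarith)) hY.le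
    linarith
  · have := mul_le_mul_of_nonneg_left h (show 0 ≤ X ^ (p - 1) by positivity)
    linarith

theorem rpow_sub_one_mul_mul_le {a b m n p : ℝ} (ha : 0 < a) (hb : 0 < b) (hm : 0 < m)
    (hn : 0 < n) (hp : 1 < p) :
    a ^ (p - 1) * b * (m * n) ≤ a ^ p * n ^ (p / (p - 1)) + b ^ p * m ^ p := by
  have h := rpow_sub_one_mul_le (X := a * n ^ (1 / (p - 1))) (Y := b * m) (by positivity)
    (by positivity) hp.le
  rw [Real.mul_rpow ha.le (by positivity), Real.mul_rpow ha.le (by positivity),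
    Real.mul_rpow hb.le hm.le, ← Real.rpow_mul hn.le, ← Real.rpow_mul hn.le,
    one_div_mul_cancel (by linarith), Real.rpow_one, one_div_mul_eq_div] at h
  linarith

/-- The model coagulation kernel in the volume variables. -/
noncomputable def powKernel (al be v w : ℝ) : ℝ := v ^ (-al) * w ^ be + w ^ (-al) * v ^ be

variable {al be : ℝ}

theorem powKernel_comm (v w : ℝ) : powKernel al be v w = powKernel al be w v := add_comm _ _

theorem powKernel_nonneg {v w : ℝ} (hv : 0 < v) (hw : 0 < w) : 0 ≤ powKernel al be v w := by
  unfold powKernel; positivity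

theorem powKernel_mul_volume_le (hal : 0 < al) (hal1 : al < 1) (hbe : 0 < be) (hbe1 : be < 1)
    (e : ℝ) {v w : ℝ} (hv : 0 < v) (hw : 0 < w) :
    powKernel al be v w * ((v + w) ^ e - v ^ e - w ^ e) ≤
      2 * (|e| * 2 ^ (e - 1)) * ((1 + v ^ e) * (1 + w) + (1 + v) * (1 + w ^ e)) := by
  wlog hwv : w ≤ v generalizing v w
  · have := this hw hv (le_of_not_ge hwv)
    rw [powKernel_comm, add_comm v w]
    linarith
  set c := |e| * 2 ^ (e - 1) with hc
  have hc0 : 0 ≤ c := by positivity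
  have hk := powKernel_nonneg (al := al) (be := be) hv hw
  have hR : 0 ≤ 2 * c * ((1 + v ^ e) * (1 + w) + (1 + v) * (1 + w ^ e)) := by positivity
  rcases lt_or_ge e 1 with he | he
  · refine (mul_nonpos_of_nonneg_of_nonpos hk ?_).trans hR
    rcases le_total e 0 with he0 | he0
    · have h1 : (v + w) ^ e ≤ v ^ e := Real.rpow_le_rpow_of_nonpos hv (by linarith) he0
      have h2 : 0 < w ^ e := by positivity
      linarith
    · have := Real.rpow_add_le_add_rpow hv.le hw.le he0 he.le
      linarith
  have h1 : powKernel al be v w ≤ 2 * (w ^ (-al) * v ^ be) := by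
    have h2 : v ^ (-al) ≤ w ^ (-al) := Real.rpow_le_rpow_of_nonpos hw hwv (by linarith)
    have h3 : w ^ be ≤ v ^ be := Real.rpow_le_rpow hw.le hwv hbe.le
    have h4 : v ^ (-al) * w ^ be ≤ w ^ (-al) * v ^ be := by gcongr
    unfold powKernel
    linarith
  have h2 := rpow_add_le_of_le e hw hwv
  have h3 : v ^ (e - 1) * v ^ be ≤ 1 + v ^ e := by
    rw [← Real.rpow_add hv]
    exact rpow_le_one_add_rpow hv (by linarith) (by linarith)
  have h4 : w ^ (-al) * w ≤ 1 + w := by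
    rw [← Real.rpow_add_one hw.ne']
    simpa using rpow_le_one_add_rpow (e := 1) hw (show 0 ≤ -al + 1 by linarith) (by linarith)
  calc _ ≤ powKernel al be v w * (c * (v ^ (e - 1) * w)) := by gcongr; linarith
    _ ≤ 2 * (w ^ (-al) * v ^ be) * (c * (v ^ (e - 1) * w)) := by gcongr
    _ = 2 * c * ((v ^ (e - 1) * v ^ be) * (w ^ (-al) * w)) := by ring
    _ ≤ 2 * c * ((1 + v ^ e) * (1 + w)) := by gcongr
    _ ≤ _ := by
      have : 0 ≤ (1 + v) * (1 + w ^ e) := by positivity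
      gcongr
      linarith

theorem powKernel_mul_area_le (hal : 0 < al) (hal1 : al < 1) (hbe : 0 < be) (hbe1 : be < 1)
    {p : ℝ} (hp : 2 ≤ p) {a b v w : ℝ} (ha : 0 < a) (hb : 0 < b) (hv : 0 < v) (hw : 0 < w) :
    powKernel al be v w * ((a + b) ^ p - a ^ p - b ^ p) ≤
      2 * (|p| * 2 ^ (p - 1)) * (a ^ p * (w ^ p + w ^ (-p)) + (v ^ p + v ^ (-p)) * b ^ p) := by
  wlog hba : b ≤ a generalizing a b v w
  · have := this hb ha hw hv (le_of_not_ge hba)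
    rw [powKernel_comm, add_comm a b]
    linarith
  set c := |p| * 2 ^ (p - 1) with hc
  have hc0 : 0 ≤ c := by positivity
  have hk := powKernel_nonneg (al := al) (be := be) hv hw
  have hpp : p / (p - 1) ≤ p := by
    rw [div_le_iff₀ (by linarith)]; nlinarith
  have hpp0 : 0 < p / (p - 1) := div_pos (by linarith) (by linarith)
  have key : ∀ s t : ℝ, |s| ≤ 1 → |t| ≤ 1 → a ^ (p - 1) * b * (v ^ s * w ^ t) ≤
      a ^ p * (w ^ p + w ^ (-p)) + (v ^ p + v ^ (-p)) * b ^ p := by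
    intro s t hs ht
    have h1 := rpow_sub_one_mul_mul_le ha hb (show 0 < v ^ s by positivity)
      (show 0 < w ^ t by positivity) (show 1 < p by linarith)
    rw [← Real.rpow_mul hv.le, ← Real.rpow_mul hw.le] at h1
    have h2 : w ^ (t * (p / (p - 1))) ≤ w ^ p + w ^ (-p) := by
      refine rpow_le_rpow_add_rpow_neg hw ?_
      rw [abs_mul, abs_of_pos hpp0]
      nlinarith [abs_nonneg t]
    have h3 : v ^ (s * p) ≤ v ^ p + v ^ (-p) := by
      refine rpow_le_rpow_add_rpow_neg hv ?_
      rw [abs_mul, abs_of_pos (show 0 < p by linarith)]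
      nlinarith [abs_nonneg s]
    calc _ ≤ _ := h1
      _ ≤ a ^ p * (w ^ p + w ^ (-p)) + b ^ p * (v ^ p + v ^ (-p)) := by gcongr
      _ = _ := by ring
  have habs : |(-al)| ≤ 1 := by rw [abs_neg, abs_of_pos hal]; exact hal1.le
  have hbbs : |be| ≤ 1 := by rw [abs_of_pos hbe]; exact hbe1.le
  have k1 := key (-al) be habs hbbs
  have k2 := key be (-al) hbbs habs
  have h2 := rpow_add_le_of_le p hb hba
  calc _ ≤ powKernel al be v w * (c * (a ^ (p - 1) * b)) := by gcongr; linarith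
    _ = c * (a ^ (p - 1) * b * (v ^ (-al) * w ^ be) + a ^ (p - 1) * b * (v ^ be * w ^ (-al))) := by
      unfold powKernel; ring
    _ ≤ c * (2 * (a ^ p * (w ^ p + w ^ (-p)) + (v ^ p + v ^ (-p)) * b ^ p)) := by
      gcongr; linarith
    _ = _ := by ring

end PowerInequalities

section IsoSpace

theorem c0_pos : 0 < c0 := by unfold c0; positivity

theorem isoRegion_subset_quad : IsoRegion ⊆ Quad := fun _ hx =>
  ⟨lt_of_lt_of_le (mul_pos c0_pos (Real.rpow_pos_of_pos hx.1 _)) hx.2, hx.1⟩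

theorem add_mem_isoRegion {x y : ℝ × ℝ} (hx : x ∈ IsoRegion) (hy : y ∈ IsoRegion) :
    x + y ∈ IsoRegion := by
  refine ⟨add_pos hx.1 hy.1, ?_⟩
  have h := Real.rpow_add_le_add_rpow hx.1.le hy.1.le (show (0 : ℝ) ≤ 2 / 3 by norm_num)
    (by norm_num)
  calc c0 * (x.2 + y.2) ^ ((2 : ℝ) / 3)
      ≤ c0 * (x.2 ^ ((2 : ℝ) / 3) + y.2 ^ ((2 : ℝ) / 3)) := by gcongr; exact c0_pos.le
    _ ≤ x.1 + y.1 := by rw [mul_add]; exact add_le_add hx.2 hy.2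

/-- The isoperimetric region as a type. -/
abbrev IsoPair : Type := IsoRegion

instance : Add IsoPair := ⟨fun x y => ⟨x.1 + y.1, add_mem_isoRegion x.2 y.2⟩⟩

@[simp] theorem IsoPair.coe_add (x y : IsoPair) : ((x + y : IsoPair) : ℝ × ℝ) = x + y := rfl

instance : ContinuousAdd IsoPair :=
  ⟨Continuous.subtype_mk ((continuous_subtype_val.comp continuous_fst).add
    (continuous_subtype_val.comp continuous_snd)) _⟩

theorem IsoPair.one_one_mem : ((c0, 1) : ℝ × ℝ) ∈ IsoRegion := ⟨one_pos, by simp⟩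

instance : Nonempty IsoPair := ⟨⟨(c0, 1), IsoPair.one_one_mem⟩⟩

namespace IsoPair

variable (x y : IsoPair)

theorem volume_pos : 0 < x.1.2 := x.2.1

theorem area_pos : 0 < x.1.1 := (isoRegion_subset_quad x.2).1

theorem continuous_area : Continuous fun x : IsoPair => x.1.1 :=
  continuous_fst.comp continuous_subtype_val

theorem continuous_volume : Continuous fun x : IsoPair => x.1.2 :=
  continuous_snd.comp continuous_subtype_val

theorem continuous_volume_rpow (s : ℝ) : Continuous fun x : IsoPair => x.1.2 ^ s :=
  continuous_volume.rpow_const fun x => Or.inl x.volume_pos.ne'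

theorem continuous_area_rpow (s : ℝ) : Continuous fun x : IsoPair => x.1.1 ^ s :=
  continuous_area.rpow_const fun x => Or.inl x.area_pos.ne'

/-- The weight whose moment decreases under coagulation. -/
noncomputable def zWeight (p : ℝ) : ℝ := 1 + x.1.2 + x.1.2 ^ (-p)

/-- The weight in the volume variable. -/
noncomputable def yWeight (p q : ℝ) : ℝ := x.zWeight p + x.1.2 ^ p + x.1.2 ^ q

/-- The weight in both variables. -/
noncomputable def wWeight (p q : ℝ) : ℝ := x.yWeight p q + x.1.1 ^ p

/-- The `p`-th root of `wWeight`. -/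
noncomputable def uWeight (p q : ℝ) : ℝ := x.wWeight p q ^ (1 / p)

variable {p q : ℝ}

theorem volume_rpow_pos (s : ℝ) : 0 < x.1.2 ^ s := Real.rpow_pos_of_pos x.volume_pos s

theorem area_rpow_pos (s : ℝ) : 0 < x.1.1 ^ s := Real.rpow_pos_of_pos x.area_pos s

theorem one_le_zWeight : 1 ≤ x.zWeight p := by
  have := x.volume_pos
  have := x.volume_rpow_pos (-p)
  unfold zWeight; linarith

theorem zWeight_le_yWeight : x.zWeight p ≤ x.yWeight p q := by
  have := x.volume_rpow_pos p
  have := x.volume_rpow_pos q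
  unfold yWeight; linarith

theorem yWeight_le_wWeight : x.yWeight p q ≤ x.wWeight p q := by
  have := x.area_rpow_pos p
  unfold wWeight; linarith

theorem one_le_wWeight : 1 ≤ x.wWeight p q :=
  x.one_le_zWeight.trans (x.zWeight_le_yWeight.trans x.yWeight_le_wWeight)

theorem continuous_zWeight : Continuous fun x : IsoPair => x.zWeight p :=
  (continuous_const.add continuous_volume).add (continuous_volume_rpow _)

theorem continuous_yWeight : Continuous fun x : IsoPair => x.yWeight p q :=
  (continuous_zWeight.add (continuous_volume_rpow _)).add (continuous_volume_rpow _)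

theorem continuous_wWeight : Continuous fun x : IsoPair => x.wWeight p q :=
  continuous_yWeight.add (continuous_area_rpow _)

theorem continuous_uWeight : Continuous fun x : IsoPair => x.uWeight p q :=
  continuous_wWeight.rpow_const fun x => Or.inl (by linarith [x.one_le_wWeight (p := p) (q := q)])

theorem volume_rpow_le_wWeight {s : ℝ} (hs : |s| ≤ p) : x.1.2 ^ s ≤ x.wWeight p q := by
  have h1 := rpow_le_rpow_add_rpow_neg x.volume_pos hs
  have := x.volume_pos
  have := x.volume_rpow_pos q
  have := x.area_rpow_pos p
  unfold wWeight yWeight zWeight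
  linarith

theorem volume_rpow_mul_le_wWeight : x.1.2 ^ q ≤ x.wWeight p q := by
  have := x.volume_pos
  have := x.volume_rpow_pos p
  have := x.volume_rpow_pos (-p)
  have := x.area_rpow_pos p
  unfold wWeight yWeight zWeight
  linarith

theorem area_rpow_le_wWeight : x.1.1 ^ p ≤ x.wWeight p q := by
  have := x.one_le_zWeight (p := p)
  have := x.zWeight_le_yWeight (p := p) (q := q)
  unfold wWeight
  linarith

theorem wWeight_pos : 0 < x.wWeight p q := zero_lt_one.trans_le x.one_le_wWeight

theorem uWeight_rpow (hp : 0 < p) : x.uWeight p q ^ p = x.wWeight p q := by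
  rw [uWeight, ← Real.rpow_mul x.wWeight_pos.le, one_div_mul_cancel hp.ne', Real.rpow_one]

theorem one_le_uWeight (hp : 0 < p) : 1 ≤ x.uWeight p q :=
  Real.one_le_rpow x.one_le_wWeight (by positivity)

theorem le_uWeight (hp : 0 < p) {X : ℝ} (hX : 0 ≤ X) (h : X ^ p ≤ x.wWeight p q) :
    X ≤ x.uWeight p q := by
  have := Real.rpow_le_rpow (by positivity) h (show 0 ≤ 1 / p by positivity)
  rwa [← Real.rpow_mul hX, mul_one_div_cancel hp.ne', Real.rpow_one] at this

theorem area_le_uWeight (hp : 0 < p) : x.1.1 ≤ x.uWeight p q :=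
  x.le_uWeight hp x.area_pos.le x.area_rpow_le_wWeight

theorem volume_rpow_le_uWeight (hp : 0 < p) {s : ℝ} (hs : |s| ≤ 1) : x.1.2 ^ s ≤ x.uWeight p q := by
  refine x.le_uWeight hp (x.volume_rpow_pos s).le ?_
  rw [← Real.rpow_mul x.volume_pos.le]
  refine x.volume_rpow_le_wWeight ?_
  rw [abs_mul, abs_of_pos hp]
  nlinarith [abs_nonneg s]

theorem volume_rpow_le_uWeight_of_mul (hp : 0 < p) {s : ℝ} (hs : s * p = q) :
    x.1.2 ^ s ≤ x.uWeight p q := by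
  refine x.le_uWeight hp (x.volume_rpow_pos s).le ?_
  rw [← Real.rpow_mul x.volume_pos.le, hs]
  exact x.volume_rpow_mul_le_wWeight

theorem zWeight_add_le (hp : 0 ≤ p) : (x + y).zWeight p ≤ x.zWeight p + y.zWeight p := by
  have h1 : (x.1.2 + y.1.2) ^ (-p) ≤ x.1.2 ^ (-p) :=
    Real.rpow_le_rpow_of_nonpos x.volume_pos (by linarith [y.volume_pos]) (by linarith)
  have h2 := y.volume_rpow_pos (-p)
  simp only [zWeight, coe_add, Prod.snd_add]
  linarith

theorem wWeight_add_le (hp : 0 ≤ p) :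
    (x + y).wWeight p q ≤ (1 + 2 ^ |p| + 2 ^ |q|) * (x.wWeight p q + y.wWeight p q) := by
  have h1 := zWeight_add_le x y hp
  have h2 := rpow_add_le_two_rpow_mul p x.volume_pos y.volume_pos
  have h3 := rpow_add_le_two_rpow_mul q x.volume_pos y.volume_pos
  have h4 := rpow_add_le_two_rpow_mul p x.area_pos y.area_pos
  have hx := x.one_le_zWeight (p := p)
  have hy := y.one_le_zWeight (p := p)
  have hxp := x.volume_rpow_pos p
  have hyp := y.volume_rpow_pos p
  have hxq := x.volume_rpow_pos q
  have hyq := y.volume_rpow_pos q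
  have hxa := x.area_rpow_pos p
  have hya := y.area_rpow_pos p
  have hP : (0 : ℝ) < 2 ^ |p| := by positivity
  have hQ : (0 : ℝ) < 2 ^ |q| := by positivity
  simp only [wWeight, yWeight, coe_add, Prod.snd_add, Prod.fst_add]
  generalize (2 : ℝ) ^ |p| = P at *
  generalize (2 : ℝ) ^ |q| = Q at *
  generalize x.zWeight p = zx at *
  generalize y.zWeight p = zy at *
  have e1 : 0 ≤ (P + Q) * (zx + zy) := by positivity
  have e2 : 0 ≤ (1 + Q) * (x.1.2 ^ p + y.1.2 ^ p) := by positivity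
  have e3 : 0 ≤ (1 + P) * (x.1.2 ^ q + y.1.2 ^ q) := by positivity
  have e4 : 0 ≤ (1 + Q) * (x.1.1 ^ p + y.1.1 ^ p) := by positivity
  linarith

/-- The constant in the increment estimate for the power `e`. -/
noncomputable def incrConst (e : ℝ) : ℝ := 2 * (|e| * 2 ^ (e - 1))

theorem incrConst_nonneg (e : ℝ) : 0 ≤ incrConst e := by unfold incrConst; positivity

section Kernel

variable {al be K₀ κ : ℝ}

theorem mul_le_of_le_const_mul {k d R : ℝ} (hK₀ : 0 ≤ K₀) (hκ : 0 ≤ κ) (hκK : κ ≤ K₀ * k)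
    (h : k * d ≤ R) (hR : 0 ≤ R) : κ * d ≤ K₀ * R := by
  rcases le_total 0 d with hd | hd
  · calc κ * d ≤ K₀ * k * d := mul_le_mul_of_nonneg_right hκK hd
      _ = K₀ * (k * d) := mul_assoc _ _ _
      _ ≤ K₀ * R := mul_le_mul_of_nonneg_left h hK₀
  · exact (mul_nonpos_of_nonneg_of_nonpos hκ hd).trans (mul_nonneg hK₀ hR)

variable (hal : 0 < al) (hal1 : al < 1) (hbe : 0 < be) (hbe1 : be < 1) (hK₀ : 0 ≤ K₀)
  (hκ : 0 ≤ κ) (hκK : κ ≤ K₀ * powKernel al be x.1.2 y.1.2)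

include hal hal1 hbe hbe1 hK₀ hκ hκK

theorem kernel_mul_volume_le {e : ℝ} (hx : x.1.2 ^ e ≤ x.yWeight p q - x.zWeight p)
    (hy : y.1.2 ^ e ≤ y.yWeight p q - y.zWeight p) :
    κ * ((x.1.2 + y.1.2) ^ e - x.1.2 ^ e - y.1.2 ^ e) ≤
      K₀ * incrConst e * (x.yWeight p q * y.zWeight p + x.zWeight p * y.yWeight p q) := by
  have hvx := x.volume_pos
  have hvy := y.volume_pos
  have hxe := x.volume_rpow_pos e
  have hye := y.volume_rpow_pos e
  have h := mul_le_of_le_const_mul hK₀ hκ hκK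
    (powKernel_mul_volume_le hal hal1 hbe hbe1 e hvx hvy)
    (by positivity)
  refine h.trans ?_
  rw [← incrConst, ← mul_assoc]
  have h0 := incrConst_nonneg e
  have hx1 : 1 + x.1.2 ^ e ≤ x.yWeight p q := by linarith [x.one_le_zWeight (p := p)]
  have hy1 : 1 + y.1.2 ^ e ≤ y.yWeight p q := by linarith [y.one_le_zWeight (p := p)]
  have hx2 : 1 + x.1.2 ≤ x.zWeight p := by
    have := x.volume_rpow_pos (-p)
    unfold zWeight; linarith
  have hy2 : 1 + y.1.2 ≤ y.zWeight p := by
    have := y.volume_rpow_pos (-p)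
    unfold zWeight; linarith
  have hx3 : 0 ≤ x.yWeight p q := le_trans (by positivity) hx1
  have hx4 : 0 ≤ x.zWeight p := le_trans (by positivity) hx2
  gcongr

theorem kernel_mul_yWeight_le (hp : 0 ≤ p) :
    κ * ((x + y).yWeight p q - x.yWeight p q - y.yWeight p q) ≤
      K₀ * (incrConst p + incrConst q) *
        (x.yWeight p q * y.zWeight p + x.zWeight p * y.yWeight p q) := by
  have h1 := kernel_mul_volume_le x y (p := p) (q := q) hal hal1 hbe hbe1 hK₀ hκ hκK (e := p)
    (by have := x.volume_rpow_pos q; unfold yWeight; linarith)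
    (by have := y.volume_rpow_pos q; unfold yWeight; linarith)
  have h2 := kernel_mul_volume_le x y (p := p) (q := q) hal hal1 hbe hbe1 hK₀ hκ hκK (e := q)
    (by have := x.volume_rpow_pos p; unfold yWeight; linarith)
    (by have := y.volume_rpow_pos p; unfold yWeight; linarith)
  have h3 := mul_nonneg hκ (sub_nonneg.2 (x.zWeight_add_le y hp))
  have e1 : (x + y).yWeight p q - x.yWeight p q - y.yWeight p q =
      ((x.1.2 + y.1.2) ^ p - x.1.2 ^ p - y.1.2 ^ p) +
      ((x.1.2 + y.1.2) ^ q - x.1.2 ^ q - y.1.2 ^ q) -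
      (x.zWeight p + y.zWeight p - (x + y).zWeight p) := by
    simp only [yWeight, coe_add, Prod.snd_add]
    ring
  rw [e1]
  linarith

theorem kernel_mul_wWeight_le (hp : 2 ≤ p) :
    κ * ((x + y).wWeight p q - x.wWeight p q - y.wWeight p q) ≤
      K₀ * (2 * incrConst p + incrConst q) *
        (x.wWeight p q * y.yWeight p q + x.yWeight p q * y.wWeight p q) := by
  have h1 := kernel_mul_yWeight_le x y (p := p) (q := q) hal hal1 hbe hbe1 hK₀ hκ hκK
    (by linarith)
  have hxa := x.area_rpow_pos p
  have hya := y.area_rpow_pos p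
  have hxp := x.volume_rpow_pos p
  have hyp := y.volume_rpow_pos p
  have hxn := x.volume_rpow_pos (-p)
  have hyn := y.volume_rpow_pos (-p)
  have hxq := x.volume_rpow_pos q
  have hyq := y.volume_rpow_pos q
  have h2 := mul_le_of_le_const_mul hK₀ hκ hκK
    (powKernel_mul_area_le hal hal1 hbe hbe1 hp x.area_pos y.area_pos x.volume_pos y.volume_pos)
    (by positivity)
  rw [← incrConst] at h2
  have hx1 : x.1.2 ^ p + x.1.2 ^ (-p) ≤ x.yWeight p q := by
    have := x.volume_pos
    unfold yWeight zWeight; linarith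
  have hy1 : y.1.2 ^ p + y.1.2 ^ (-p) ≤ y.yWeight p q := by
    have := y.volume_pos
    unfold yWeight zWeight; linarith
  have hx2 : x.1.1 ^ p ≤ x.wWeight p q := x.area_rpow_le_wWeight
  have hy2 : y.1.1 ^ p ≤ y.wWeight p q := y.area_rpow_le_wWeight
  have hx3 := x.zWeight_le_yWeight (p := p) (q := q)
  have hy3 := y.zWeight_le_yWeight (p := p) (q := q)
  have hx4 := x.yWeight_le_wWeight (p := p) (q := q)
  have hy4 := y.yWeight_le_wWeight (p := p) (q := q)
  have hx5 := x.one_le_zWeight (p := p)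
  have hy5 := y.one_le_zWeight (p := p)
  have hip := incrConst_nonneg p
  have hiq := incrConst_nonneg q
  have e1 : (x + y).wWeight p q - x.wWeight p q - y.wWeight p q =
      ((x + y).yWeight p q - x.yWeight p q - y.yWeight p q) +
      ((x.1.1 + y.1.1) ^ p - x.1.1 ^ p - y.1.1 ^ p) := by
    simp only [wWeight, coe_add, Prod.fst_add]
    ring
  rw [e1, mul_add]
  calc _ ≤ K₀ * (incrConst p + incrConst q) *
        (x.yWeight p q * y.zWeight p + x.zWeight p * y.yWeight p q) +
        K₀ * (incrConst p * (x.1.1 ^ p * (y.1.2 ^ p + y.1.2 ^ (-p)) +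
          (x.1.2 ^ p + x.1.2 ^ (-p)) * y.1.1 ^ p)) := add_le_add h1 h2
    _ ≤ K₀ * (incrConst p + incrConst q) *
        (x.wWeight p q * y.yWeight p q + x.yWeight p q * y.wWeight p q) +
        K₀ * (incrConst p * (x.wWeight p q * y.yWeight p q + x.yWeight p q * y.wWeight p q)) := by
      have hx6 : 0 ≤ x.wWeight p q := x.wWeight_pos.le
      have hx7 : 0 ≤ x.yWeight p q := by linarith
      gcongr
      linarith
    _ = _ := by ring

end Kernel

theorem kernelConst_nonneg {K₀ : ℝ} (hK₀ : 0 ≤ K₀) (p q : ℝ) :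
    0 ≤ K₀ * (2 * incrConst p + incrConst q) :=
  mul_nonneg hK₀ (add_nonneg (mul_nonneg zero_le_two (incrConst_nonneg p)) (incrConst_nonneg q))

theorem isCompact_wWeight_le (hp : 0 < p) (R : ℝ) :
    IsCompact {x : IsoPair | x.wWeight p q ≤ R} := by
  rw [Subtype.isCompact_iff]
  set r := max 1 R ^ (1 / p) with hr
  have hr0 : 0 < r := by positivity
  have hc : IsClosed {x : ℝ × ℝ | c0 * x.2 ^ ((2 : ℝ) / 3) ≤ x.1} :=
    isClosed_le (continuous_const.mul (continuous_snd.rpow_const fun _ => Or.inr (by norm_num)))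
      continuous_fst
  have hA : IsCompact ((Icc 0 r ×ˢ Icc r⁻¹ r) ∩ {x : ℝ × ℝ | c0 * x.2 ^ ((2 : ℝ) / 3) ≤ x.1}) :=
    (isCompact_Icc.prod isCompact_Icc).inter_right hc
  have hsub : ∀ x ∈ (Icc 0 r ×ˢ Icc r⁻¹ r) ∩ {x : ℝ × ℝ | c0 * x.2 ^ ((2 : ℝ) / 3) ≤ x.1},
      x ∈ IsoRegion := fun x hx => ⟨(inv_pos.2 hr0).trans_le hx.1.2.1, hx.2⟩
  have hA' : IsCompact (Subtype.val ⁻¹' ((Icc 0 r ×ˢ Icc r⁻¹ r) ∩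
      {x : ℝ × ℝ | c0 * x.2 ^ ((2 : ℝ) / 3) ≤ x.1}) : Set IsoPair) := by
    rw [Subtype.isCompact_iff, Subtype.image_preimage_coe, inter_eq_right.2 hsub]
    exact hA
  rw [← Subtype.isCompact_iff]
  refine hA'.of_isClosed_subset (isClosed_le continuous_wWeight continuous_const) fun x hx => ?_
  have hu : x.uWeight p q ≤ r :=
    Real.rpow_le_rpow x.wWeight_pos.le (le_max_of_le_right hx) (by positivity)
  have hv := x.volume_rpow_le_uWeight (q := q) hp (s := 1) (by simp)
  have hv' := x.volume_rpow_le_uWeight (q := q) hp (s := -1) (by simp)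
  rw [Real.rpow_one] at hv
  rw [Real.rpow_neg_one] at hv'
  refine ⟨⟨⟨x.area_pos.le, (x.area_le_uWeight hp).trans hu⟩, ?_, hv.trans hu⟩, x.2.2⟩
  rw [inv_le_comm₀ hr0 x.volume_pos]
  exact hv'.trans hu

/-- The coagulation system on the isoperimetric region given by a kernel with power bounds. -/
noncomputable def coagSystem {al be K₀ : ℝ} (hal : 0 < al) (hal1 : al < 1) (hbe : 0 < be)
    (hbe1 : be < 1) (hK₀ : 0 ≤ K₀) (hp : 3 ≤ p) (q : ℝ) (k : IsoPair × IsoRegion → ℝ)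
    (hk : Continuous k) (hk0 : ∀ z, 0 ≤ k z) (hks : ∀ x y, k (x, y) = k (y, x))
    (hkK : ∀ x y : IsoPair, k (x, y) ≤ K₀ * powKernel al be x.1.2 y.1.2) :
    CoagSystem IsoPair where
  K := k
  Z₀ x := x.zWeight p
  Z₁ x := x.yWeight p q
  W x := x.wWeight p q
  U x := x.uWeight p q
  C := 2 * K₀ + (1 + 2 ^ |p| + 2 ^ |q|) +
    K₀ * (2 * (incrConst p) + incrConst q)
  continuous_K := hk
  continuous_Z₀ := continuous_zWeight
  continuous_Z₁ := continuous_yWeight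
  continuous_W := continuous_wWeight
  continuous_U := continuous_uWeight
  K_nonneg := hk0
  K_symm := hks
  C_nonneg := add_nonneg (by positivity) (kernelConst_nonneg hK₀ p q)
  one_le_U x := x.one_le_uWeight (by linarith)
  U_pow_le x := by
    rw [← x.uWeight_rpow (p := p) (q := q) (by linarith), ← Real.rpow_natCast]
    exact Real.rpow_le_rpow_of_exponent_le (x.one_le_uWeight (by linarith)) (by simpa using hp)
  Z₀_nonneg x := zero_le_one.trans x.one_le_zWeight
  Z₀_le x := x.zWeight_le_yWeight
  Z₁_le x := x.yWeight_le_wWeight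
  K_le x y := by
    have hp0 : 0 < p := by linarith
    have ux := x.one_le_uWeight (q := q) hp0
    have uy := y.one_le_uWeight (q := q) hp0
    have hal' : |(-al)| ≤ 1 := by rw [abs_neg, abs_of_pos hal]; exact hal1.le
    have hbe' : |be| ≤ 1 := by rw [abs_of_pos hbe]; exact hbe1.le
    have h1 : powKernel al be x.1.2 y.1.2 ≤ 2 * (x.uWeight p q * y.uWeight p q) := by
      have h2 := mul_le_mul (x.volume_rpow_le_uWeight (q := q) hp0 hal')
        (y.volume_rpow_le_uWeight (q := q) hp0 hbe') (y.volume_rpow_pos _).le (by linarith)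
      have h3 := mul_le_mul (x.volume_rpow_le_uWeight (q := q) hp0 hbe')
        (y.volume_rpow_le_uWeight (q := q) hp0 hal') (y.volume_rpow_pos _).le (by linarith)
      unfold powKernel
      linarith
    calc k (x, y) ≤ K₀ * (2 * (x.uWeight p q * y.uWeight p q)) :=
          (hkK x y).trans (mul_le_mul_of_nonneg_left h1 hK₀)
      _ = (2 * K₀) * (x.uWeight p q * y.uWeight p q) := by ring
      _ ≤ _ := by
        refine mul_le_mul_of_nonneg_right ?_ (by positivity)
        rw [add_assoc]
        exact le_add_of_nonneg_right (add_nonneg (by positivity) (kernelConst_nonneg hK₀ p q))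
  U_add x y := by
    have hp0 : 0 < p := by linarith
    have h1 := x.wWeight_add_le y (q := q) hp0.le
    have hx := x.wWeight_pos (p := p) (q := q)
    have hy := y.wWeight_pos (p := p) (q := q)
    have h2 := Real.rpow_le_rpow (x + y).wWeight_pos.le h1 (show 0 ≤ 1 / p by positivity)
    rw [Real.mul_rpow (by positivity) (by positivity)] at h2
    have hp1 : 1 / p ≤ 1 := by rw [div_le_one hp0]; linarith
    have h3 := Real.rpow_add_le_add_rpow hx.le hy.le (show 0 ≤ 1 / p by positivity) hp1
    have h4 : (1 + 2 ^ |p| + 2 ^ |q| : ℝ) ^ (1 / p) ≤ 1 + 2 ^ |p| + 2 ^ |q| :=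
      Real.rpow_le_self_of_one_le (by
        have : (0 : ℝ) < 2 ^ |p| := by positivity
        have : (0 : ℝ) < 2 ^ |q| := by positivity
        linarith) hp1
    have h5 : 0 ≤ K₀ * (2 * (incrConst p) + incrConst q) := kernelConst_nonneg hK₀ p q
    have hux : 0 < x.uWeight p q := zero_lt_one.trans_le (x.one_le_uWeight hp0)
    have huy : 0 < y.uWeight p q := zero_lt_one.trans_le (y.one_le_uWeight hp0)
    calc _ ≤ _ := h2
      _ ≤ _ := by
        refine mul_le_mul (h4.trans (by linarith)) h3 (by positivity)
          (add_nonneg (by positivity) h5)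
  W_add x y := by
    refine (x.wWeight_add_le y (by linarith)).trans (mul_le_mul_of_nonneg_right ?_ ?_)
    · have h5 : 0 ≤ K₀ * (2 * (incrConst p) + incrConst q) := kernelConst_nonneg hK₀ p q
      linarith
    · exact add_nonneg x.wWeight_pos.le y.wWeight_pos.le
  K_Z₀ x y := x.zWeight_add_le y (by linarith)
  K_Z₁ x y := by
    refine (kernel_mul_yWeight_le x y hal hal1 hbe hbe1 hK₀ (hk0 _) (hkK x y)
      (by linarith)).trans (mul_le_mul_of_nonneg_right ?_ ?_)
    · have hip := incrConst_nonneg p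
      have : 0 ≤ K₀ * incrConst p := by positivity
      have : (0 : ℝ) < 2 ^ |p| := by positivity
      have : (0 : ℝ) < 2 ^ |q| := by positivity
      linarith
    · have hx := x.one_le_zWeight (p := p)
      have hy := y.one_le_zWeight (p := p)
      have hx' := x.zWeight_le_yWeight (p := p) (q := q)
      have hy' := y.zWeight_le_yWeight (p := p) (q := q)
      have : 0 ≤ x.zWeight p := by linarith
      have : 0 ≤ y.zWeight p := by linarith
      have : 0 ≤ x.yWeight p q := by linarith
      have : 0 ≤ y.yWeight p q := by linarith
      positivity
  K_W x y := by
    refine (kernel_mul_wWeight_le x y hal hal1 hbe hbe1 hK₀ (hk0 _) (hkK x y)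
      (by linarith)).trans (mul_le_mul_of_nonneg_right ?_ ?_)
    · have : (0 : ℝ) < 2 ^ |p| := by positivity
      have : (0 : ℝ) < 2 ^ |q| := by positivity
      linarith
    · have hx := x.one_le_zWeight (p := p)
      have hy := y.one_le_zWeight (p := p)
      have hx' := x.zWeight_le_yWeight (p := p) (q := q)
      have hy' := y.zWeight_le_yWeight (p := p) (q := q)
      have := x.wWeight_pos (p := p) (q := q)
      have := y.wWeight_pos (p := p) (q := q)
      have : 0 ≤ x.yWeight p q := by linarith
      have : 0 ≤ y.yWeight p q := by linarith
      positivity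
  isCompact_W_le := isCompact_wWeight_le (by linarith)

end IsoPair

end IsoSpace

section IsoFlow

namespace IsoPair

variable (x : IsoPair)

/-- The minimal area of a particle with the volume of `x`. -/
noncomputable def sphereArea : ℝ := c0 * x.1.2 ^ ((2 : ℝ) / 3)

/-- The excess of the area over the area of a sphere of the same volume. -/
noncomputable def excess : ℝ := x.1.1 - x.sphereArea

theorem sphereArea_pos : 0 < x.sphereArea := mul_pos c0_pos (x.volume_rpow_pos _)

theorem excess_nonneg : 0 ≤ x.excess := sub_nonneg.2 x.2.2

theorem excess_le_area : x.excess ≤ x.1.1 := sub_le_self _ x.sphereArea_pos.le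

theorem continuous_sphereArea : Continuous fun x : IsoPair => x.sphereArea :=
  continuous_const.mul (continuous_volume_rpow _)

theorem continuous_excess : Continuous fun x : IsoPair => x.excess :=
  continuous_area.sub continuous_sphereArea

/-- Shrinking the excess area by the factor `(1 + d)⁻¹`. -/
noncomputable def shrink (d : ℝ) : IsoPair :=
  ⟨(x.sphereArea + x.excess / (1 + |d|), x.1.2), x.volume_pos,
    le_add_of_nonneg_right (div_nonneg x.excess_nonneg (by positivity))⟩

@[simp] theorem shrink_volume (d : ℝ) : (x.shrink d).1.2 = x.1.2 := rfl

theorem shrink_excess (d : ℝ) : (x.shrink d).excess = x.excess / (1 + |d|) := by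
  simp [excess, shrink, sphereArea]

theorem area_sub_shrink_area (d : ℝ) :
    x.1.1 - (x.shrink d).1.1 = x.excess - x.excess / (1 + |d|) := by
  simp only [shrink, excess]; ring

theorem excess_sub_div {d : ℝ} (hd : 0 ≤ d) :
    x.excess - x.excess / (1 + |d|) = d * x.excess / (1 + d) := by
  rw [abs_of_nonneg hd]
  field_simp
  ring

theorem area_sub_shrink_area_nonneg {d : ℝ} (hd : 0 ≤ d) : 0 ≤ x.1.1 - (x.shrink d).1.1 := by
  rw [area_sub_shrink_area, excess_sub_div x hd]
  have := x.excess_nonneg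
  positivity

theorem area_sub_shrink_area_le {d : ℝ} (hd : 0 ≤ d) :
    x.1.1 - (x.shrink d).1.1 ≤ d * x.excess := by
  rw [area_sub_shrink_area, excess_sub_div x hd]
  exact div_le_self (mul_nonneg hd x.excess_nonneg) (by linarith)

theorem mul_excess_sub_area_sub_shrink_area_le {d : ℝ} (hd : 0 ≤ d) :
    d * x.excess - (x.1.1 - (x.shrink d).1.1) ≤ d ^ 2 * x.excess := by
  rw [area_sub_shrink_area, excess_sub_div x hd]
  have h := x.excess_nonneg
  rw [sub_le_iff_le_add, ← sub_le_iff_le_add', le_div_iff₀ (by positivity)]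
  nlinarith [mul_nonneg (pow_nonneg hd 3) h]

theorem dist_shrink {d : ℝ} (hd : 0 ≤ d) : dist (x.shrink d) x = x.1.1 - (x.shrink d).1.1 := by
  rw [Subtype.dist_eq, Prod.dist_eq, shrink_volume, dist_self, Real.dist_eq, abs_sub_comm,
    abs_of_nonneg (x.area_sub_shrink_area_nonneg hd),
    max_eq_left (x.area_sub_shrink_area_nonneg hd)]

end IsoPair

/-- A coagulation system on the isoperimetric region with the power weights. -/
structure IsPowerSystem (S : CoagSystem IsoPair) (p q : ℝ) : Prop where
  three_le : 3 ≤ p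
  Z₀_eq : ∀ x, S.Z₀ x = x.zWeight p
  Z₁_eq : ∀ x, S.Z₁ x = x.yWeight p q
  W_eq : ∀ x, S.W x = x.wWeight p q
  U_eq : ∀ x, S.U x = x.uWeight p q

/-- A continuous relaxation rate dominated by the power `a ^ (p - 3) * v ^ s`. -/
structure IsRelaxRate (ρ : IsoPair → ℝ) (D p s : ℝ) : Prop where
  continuous : Continuous ρ
  nonneg : ∀ x, 0 ≤ ρ x
  D_nonneg : 0 ≤ D
  le : ∀ x, ρ x ≤ D * (x.1.1 ^ (p - 3) * x.1.2 ^ s)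

namespace IsPowerSystem

variable {S : CoagSystem IsoPair} {p q : ℝ} (hS : IsPowerSystem S p q)

include hS

theorem p_pos : 0 < p := by linarith [hS.three_le]

theorem area_le (x : IsoPair) : x.1.1 ≤ S.U x := by
  rw [hS.U_eq]; exact x.area_le_uWeight hS.p_pos

theorem excess_le (x : IsoPair) : x.excess ≤ S.U x := x.excess_le_area.trans (hS.area_le x)

theorem U_rpow (x : IsoPair) : S.U x ^ p = S.W x := by
  rw [hS.U_eq, hS.W_eq]; exact x.uWeight_rpow hS.p_pos

theorem U_rpow_le_W (x : IsoPair) {s : ℝ} (hs : s ≤ p) : S.U x ^ s ≤ S.W x := by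
  rw [← hS.U_rpow]
  exact Real.rpow_le_rpow_of_exponent_le (S.one_le_U x) hs

theorem W_shrink_le (x : IsoPair) {d : ℝ} (hd : 0 ≤ d) : S.W (x.shrink d) ≤ S.W x := by
  rw [hS.W_eq, hS.W_eq]
  have := Real.rpow_le_rpow (x.shrink d).area_pos.le
    (sub_nonneg.1 (x.area_sub_shrink_area_nonneg hd)) hS.p_pos.le
  simp only [IsoPair.wWeight, IsoPair.yWeight, IsoPair.zWeight, IsoPair.shrink_volume]
  linarith

variable {ρ : IsoPair → ℝ} {D s : ℝ} (hρ : IsRelaxRate ρ D p s) (hs : s * p = q)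

include hρ hs

theorem rate_le (x : IsoPair) : ρ x ≤ D * S.U x ^ (p - 2) := by
  have hU := S.one_le_U x
  have h1 : x.1.1 ^ (p - 3) ≤ S.U x ^ (p - 3) :=
    Real.rpow_le_rpow x.area_pos.le (hS.area_le x) (by linarith [hS.three_le])
  have h2 : x.1.2 ^ s ≤ S.U x := by
    rw [hS.U_eq]; exact x.volume_rpow_le_uWeight_of_mul hS.p_pos hs
  have h3 : S.U x ^ (p - 2) = S.U x ^ (p - 3) * S.U x := by
    rw [← Real.rpow_add_one (by linarith)]; ring_nf
  refine (hρ.le x).trans (mul_le_mul_of_nonneg_left ?_ hρ.D_nonneg)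
  rw [h3]
  exact mul_le_mul h1 h2 (x.volume_rpow_pos s).le (by positivity)

theorem rate_mul_excess_le (x : IsoPair) : ρ x * x.excess ≤ D * S.U x ^ (p - 1) := by
  have hU := S.one_le_U x
  have h3 : S.U x ^ (p - 1) = S.U x ^ (p - 2) * S.U x := by
    rw [← Real.rpow_add_one (by linarith)]; ring_nf
  calc ρ x * x.excess ≤ D * S.U x ^ (p - 2) * S.U x :=
        mul_le_mul (hS.rate_le hρ hs x) (hS.excess_le x) x.excess_nonneg
          (mul_nonneg hρ.D_nonneg (by positivity))
    _ = _ := by rw [h3]; ring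

theorem rate_mul_excess_le_W (x : IsoPair) : ρ x * x.excess ≤ D * S.W x :=
  (hS.rate_mul_excess_le hρ hs x).trans
    (mul_le_mul_of_nonneg_left (hS.U_rpow_le_W x (by linarith)) hρ.D_nonneg)

theorem rate_le_W (x : IsoPair) : ρ x ≤ D * S.W x :=
  (hS.rate_le hρ hs x).trans
    (mul_le_mul_of_nonneg_left (hS.U_rpow_le_W x (by linarith)) hρ.D_nonneg)

/-- The relaxation of the area to the area of a sphere with rate `ρ`. -/
noncomputable def flow : FusionFlow S where
  Φ τ x := x.shrink (τ * ρ x)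
  G x := ρ x * x.excess
  D := D
  continuous_Φ τ hτ := by
    refine Continuous.subtype_mk (Continuous.prodMk ?_ IsoPair.continuous_volume) _
    exact IsoPair.continuous_sphereArea.add (IsoPair.continuous_excess.div
      (continuous_const.add (continuous_const.mul hρ.continuous).abs) fun x => by positivity)
  D_nonneg := hρ.D_nonneg
  G_le := hS.rate_mul_excess_le_W hρ hs
  isSubweight_G := by
    have hp := hS.three_le
    have h := (IsSubweight.rpow S.one_le_W (s := (p - 1) / p)
      (div_nonneg (by linarith) (by linarith))
      (by rw [div_lt_one (by linarith)]; linarith)).const_mul S.W_nonneg D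
    refine h.mono fun x => ?_
    rw [abs_of_nonneg (mul_nonneg (hρ.nonneg x) x.excess_nonneg)]
    refine (hS.rate_mul_excess_le hρ hs x).trans_eq ?_
    rw [← hS.U_rpow, ← Real.rpow_mul (S.U_nonneg x), mul_div_cancel₀ _ (by linarith)]
  dist_le τ hτ x := by
    have hd := mul_nonneg hτ.le (hρ.nonneg x)
    rw [x.dist_shrink hd, ← mul_assoc]
    exact x.area_sub_shrink_area_le hd
  Z₀_Φ τ hτ x := by simp [hS.Z₀_eq, IsoPair.zWeight]
  Z₁_Φ τ hτ x := by simp [hS.Z₁_eq, IsoPair.zWeight, IsoPair.yWeight]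
  W_Φ τ hτ x := hS.W_shrink_le x (mul_nonneg hτ.le (hρ.nonneg x))

variable {φ γ : IsoPair → ℝ} {b : ℝ}

theorem isAdm_flow (hb0 : 0 ≤ b) (hφ : Continuous φ) (hφU : ∀ x, |φ x| ≤ b * S.U x)
    (hL : ∀ x d, 0 ≤ d → |φ (x.shrink d) - φ x| ≤ b * (x.1.1 - (x.shrink d).1.1)) :
    (hS.flow hρ hs).IsAdm φ b where
  nonneg := hb0
  continuous := hφ
  abs_le := hφU
  abs_sub_le τ hτ x := by
    have hd := mul_nonneg hτ.le (hρ.nonneg x)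
    refine (hL x _ hd).trans (mul_le_mul_of_nonneg_left ?_ hb0)
    simpa only [flow, mul_assoc] using x.area_sub_shrink_area_le hd

/-- If `γ` is the slope of `φ` in the area variable, uniformly, then `-ρ * excess * γ` is the
generator of the relaxation flow applied to `φ`. -/
theorem isGen_flow (hγ : Continuous γ) (hb0 : 0 ≤ b) (hγb : ∀ x, |γ x| ≤ b)
    (hsl : ∀ δ > 0, ∃ ω > 0, ∀ x d, 0 ≤ d → x.1.1 - (x.shrink d).1.1 ≤ ω →
      |φ (x.shrink d) - φ x + (x.1.1 - (x.shrink d).1.1) * γ x| ≤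
        δ * (x.1.1 - (x.shrink d).1.1)) :
    (hS.flow hρ hs).IsGen φ fun x => -(ρ x * x.excess) * γ x := by
  refine ⟨(hρ.continuous.mul IsoPair.continuous_excess).neg.mul hγ, fun R δ hδ => ?_⟩
  set Q := D * |R| with hQ
  have hD := hρ.D_nonneg
  have hQ0 : 0 ≤ Q := by positivity
  obtain ⟨ω, hω, hφ⟩ := hsl (δ / (2 * (Q + 1))) (by positivity)
  have hpos : 0 < min (ω / (Q + 1)) (δ / (2 * (b * Q ^ 2 + 1))) := by positivity
  filter_upwards [Ioc_mem_nhdsGT hpos] with τ hτ x hx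
  have hτ0 : 0 < τ := hτ.1
  have hτ1 : τ * (Q + 1) ≤ ω := (le_div_iff₀ (by positivity)).1 (hτ.2.trans (min_le_left _ _))
  have hτ2 : τ * (2 * (b * Q ^ 2 + 1)) ≤ δ :=
    (le_div_iff₀ (by positivity)).1 (hτ.2.trans (min_le_right _ _))
  have hxR : D * S.W x ≤ Q := mul_le_mul_of_nonneg_left (hx.trans (le_abs_self R)) hD
  have hG := (hS.rate_mul_excess_le_W hρ hs x).trans hxR
  have hρQ := (hS.rate_le_W hρ hs x).trans hxR
  have hρ0 := hρ.nonneg x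
  have he0 := x.excess_nonneg
  have hd := mul_nonneg hτ0.le hρ0
  set y := x.shrink (τ * ρ x) with hy
  have h0 := x.area_sub_shrink_area_nonneg hd
  have h1 := x.area_sub_shrink_area_le hd
  have h2 := x.mul_excess_sub_area_sub_shrink_area_le hd
  rw [← hy] at h0 h1 h2
  have h3 : x.1.1 - y.1.1 ≤ τ * Q := by
    calc _ ≤ τ * (ρ x * x.excess) := by rw [← mul_assoc]; exact h1
      _ ≤ τ * Q := by gcongr
  have h4 := hφ x _ hd (by rw [← hy]; linarith)
  rw [← hy] at h4
  have e : τ⁻¹ * (φ y - φ x) - -(ρ x * x.excess) * γ x =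
      τ⁻¹ * ((φ y - φ x + (x.1.1 - y.1.1) * γ x) +
        (τ * ρ x * x.excess - (x.1.1 - y.1.1)) * γ x) := by
    field_simp
    ring
  have h5 : |τ⁻¹ * ((φ y - φ x + (x.1.1 - y.1.1) * γ x) +
        (τ * ρ x * x.excess - (x.1.1 - y.1.1)) * γ x)| ≤
      τ⁻¹ * (δ / (2 * (Q + 1)) * (τ * Q) + (τ ^ 2 * Q ^ 2) * b) := by
    rw [abs_mul, abs_of_pos (inv_pos.2 hτ0)]
    refine mul_le_mul_of_nonneg_left ((abs_add_le _ _).trans (add_le_add (h4.trans ?_) ?_))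
      (inv_pos.2 hτ0).le
    · gcongr
    · rw [abs_mul]
      refine mul_le_mul ?_ (hγb x) (abs_nonneg _) (by positivity)
      rw [abs_of_nonneg (by linarith)]
      calc _ ≤ _ := h2
        _ = τ ^ 2 * (ρ x * (ρ x * x.excess)) := by ring
        _ ≤ τ ^ 2 * (Q * Q) := by
          have := mul_nonneg hρ0 he0
          gcongr
        _ = _ := by ring
  have h6 : τ⁻¹ * (δ / (2 * (Q + 1)) * (τ * Q) + (τ ^ 2 * Q ^ 2) * b) =
      δ / 2 * (Q / (Q + 1)) + τ * (b * Q ^ 2) := by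
    field_simp
  have h7 : Q / (Q + 1) ≤ 1 := by rw [div_le_one (by positivity)]; linarith
  have h8 : δ / 2 * (Q / (Q + 1)) ≤ δ / 2 * 1 := by gcongr
  change |τ⁻¹ * (φ y - φ x) - -(ρ x * x.excess) * γ x| ≤ δ
  rw [e]
  linarith

/-- The excess area decays at rate `ρ`. -/
theorem isAdm_excess : (hS.flow hρ hs).IsAdm (fun x => x.excess) 1 :=
  hS.isAdm_flow hρ hs zero_le_one IsoPair.continuous_excess
    (fun x => by rw [abs_of_nonneg x.excess_nonneg, one_mul]; exact hS.excess_le x)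
    fun x d hd => by
      have h := x.area_sub_shrink_area_nonneg hd
      rw [abs_sub_comm, one_mul, x.shrink_excess, ← x.area_sub_shrink_area, abs_of_nonneg h]

theorem isGen_excess :
    (hS.flow hρ hs).IsGen (fun x => x.excess) fun x => -(ρ x * x.excess) * 1 :=
  hS.isGen_flow hρ hs continuous_const zero_le_one (fun _ => by simp) fun δ hδ =>
    ⟨1, one_pos, fun x d hd _ => by
      have h := mul_nonneg hδ.le (x.area_sub_shrink_area_nonneg hd)
      refine le_trans (le_of_eq ?_) h
      rw [x.shrink_excess, x.area_sub_shrink_area, abs_eq_zero]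
      ring⟩

theorem isAdm_of_shrink_eq (hb0 : 0 ≤ b) (hφ : Continuous φ) (hφb : ∀ x, |φ x| ≤ b)
    (h : ∀ x d, φ (x.shrink d) = φ x) : (hS.flow hρ hs).IsAdm φ b :=
  hS.isAdm_flow hρ hs hb0 hφ
    (fun x => (hφb x).trans (le_mul_of_one_le_right hb0 (S.one_le_U x)))
    fun x d hd => by
      rw [h, sub_self, abs_zero]
      exact mul_nonneg hb0 (x.area_sub_shrink_area_nonneg hd)

theorem isGen_of_shrink_eq (h : ∀ x d, φ (x.shrink d) = φ x) :
    (hS.flow hρ hs).IsGen φ fun x => -(ρ x * x.excess) * 0 :=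
  hS.isGen_flow hρ hs continuous_const le_rfl (fun _ => by simp) fun δ hδ =>
    ⟨1, one_pos, fun x d hd _ => by
      have h' := mul_nonneg hδ.le (x.area_sub_shrink_area_nonneg hd)
      rw [h]
      simpa using h'⟩

end IsPowerSystem

end IsoFlow

section TimeDependent

open scoped NNReal

variable {X : Type*} [PseudoMetricSpace X] [Add X] {S : CoagSystem X} [MeasurableSpace X]

/-- A measure-valued solution of the coagulation equation with transport along `P`, tested
against functions which do not depend on time. -/
structure FusionFlow.IsSolution [OpensMeasurableSpace X] (P : FusionFlow S) (f₀ : Measure X)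
    (f : ℝ≥0 → FiniteMeasure X) : Prop where
  continuous : Continuous f
  moment : ∀ t, Integrable S.W (f t : Measure X) ∧
    ∫ x, S.W x ∂(f t : Measure X) ≤ S.momentBound f₀ t
  identity : ∀ φ g B, P.IsAdm φ B → P.IsGen φ g → ∀ t : ℝ≥0,
    ∫ x, φ x ∂(f t : Measure X) = ∫ x, φ x ∂f₀ +
      ∫ s in (0 : ℝ)..t, S.weakOp φ g (f s.toNNReal : Measure X)

/-- A family of test functions depending on time in a continuously differentiable way, with time
derivative `ψ'` and generator `γ`. -/
structure FusionFlow.IsTimeTest (P : FusionFlow S) (ψ ψ' γ : ℝ → X → ℝ) (B : ℝ) : Prop where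
  adm : ∀ s, P.IsAdm (ψ s) B
  gen : ∀ s, P.IsGen (ψ s) (γ s)
  abs_le : ∀ s x, |ψ s x| ≤ B
  continuous_deriv : ∀ s, Continuous (ψ' s)
  abs_deriv_le : ∀ s x, |ψ' s x| ≤ B
  slope : ∀ δ > 0, ∃ ω > 0, ∀ s h x, |h| ≤ ω → |ψ (s + h) x - ψ s x - h * ψ' s x| ≤ δ * |h|
  deriv_unif : ∀ δ > 0, ∃ ω > 0, ∀ s s' x, |s' - s| ≤ ω → |ψ' s' x - ψ' s x| ≤ δ
  gen_unif : ∀ R, ∀ δ > 0, ∃ ω > 0, ∀ s s' x, |s' - s| ≤ ω → S.W x ≤ R → |γ s' x - γ s x| ≤ δ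

theorem eventually_abs_sub_le_nhds (s : ℝ) {ω : ℝ} (hω : 0 < ω) : ∀ᶠ u in 𝓝 s, |u - s| ≤ ω := by
  filter_upwards [Metric.closedBall_mem_nhds s hω] with u hu
  rwa [Metric.mem_closedBall, Real.dist_eq] at hu

theorem IsSubweight.of_const {Y : Type*} {W : Y → ℝ} (hW : ∀ x, 0 ≤ W x) (c : ℝ) :
    IsSubweight W fun _ => c := fun δ hδ =>
  ⟨|c|, fun x => by have := mul_nonneg hδ.le (hW x); linarith⟩

namespace FusionFlow

variable [BorelSpace X] {P : FusionFlow S} {f₀ : Measure X} {f : ℝ≥0 → FiniteMeasure X}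

theorem IsSolution.continuous_toNNReal (hf : P.IsSolution f₀ f) :
    Continuous fun s : ℝ => f s.toNNReal := hf.continuous.comp continuous_real_toNNReal

theorem IsSolution.moment_eventually (hf : P.IsSolution f₀ f) (s : ℝ) :
    ∀ᶠ u in 𝓝 s, Integrable S.W (f (Real.toNNReal u) : Measure X) ∧
      ∫ x, S.W x ∂(f (Real.toNNReal u) : Measure X) ≤ S.momentBound f₀ (|s| + 1) := by
  filter_upwards [eventually_abs_sub_le_nhds s one_pos] with u hu
  obtain ⟨h1, h2⟩ := hf.moment u.toNNReal
  refine ⟨h1, h2.trans (S.momentBound_mono f₀ (NNReal.coe_nonneg _) ?_)⟩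
  rw [Real.coe_toNNReal']
  exact max_le (by linarith [le_abs_self (u - s), le_abs_self s]) (by positivity)

section

variable {ψ ψ' γ : ℝ → X → ℝ} {B : ℝ}

omit [MeasurableSpace X] [BorelSpace X] in
theorem IsTimeTest.nonneg (h : P.IsTimeTest ψ ψ' γ B) : 0 ≤ B := (h.adm 0).nonneg

omit [MeasurableSpace X] [BorelSpace X] in
theorem IsTimeTest.abs_gen_le (h : P.IsTimeTest ψ ψ' γ B) (s : ℝ) (x : X) :
    |γ s x| ≤ B * P.G x := (h.gen s).abs_le (h.adm s) x

omit [MeasurableSpace X] [BorelSpace X] in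
theorem IsTimeTest.unif (h : P.IsTimeTest ψ ψ' γ B) {δ : ℝ} (hδ : 0 < δ) :
    ∃ ω > 0, ∀ s s' x, |s' - s| ≤ ω → |ψ s' x - ψ s x| ≤ δ := by
  obtain ⟨ω, hω, hs⟩ := h.slope 1 one_pos
  have hB := h.nonneg
  refine ⟨min ω (δ / (1 + B)), by positivity, fun s s' x hss => ?_⟩
  have h1 := hs s (s' - s) x (hss.trans (min_le_left _ _))
  have h2 := (le_div_iff₀ (by positivity)).1 (hss.trans (min_le_right _ _))
  rw [add_sub_cancel] at h1
  have h3 : |(s' - s) * ψ' s x| ≤ |s' - s| * B := by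
    rw [abs_mul]; gcongr; exact h.abs_deriv_le s x
  have e : ψ s' x - ψ s x = (ψ s' x - ψ s x - (s' - s) * ψ' s x) + (s' - s) * ψ' s x := by ring
  rw [e]
  refine (abs_add_le _ _).trans ?_
  linarith

theorem IsSolution.continuous_integral_deriv [Nonempty X] (hf : P.IsSolution f₀ f)
    (h : P.IsTimeTest ψ ψ' γ B) :
    Continuous fun s : ℝ => ∫ x, ψ' s x ∂(f s.toNNReal : Measure X) :=
  continuous_iff_continuousAt.2 fun s =>
    tendsto_integral_of_isSubweight_of_uniform (hf.continuous_toNNReal.tendsto s) S.continuous_W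
      S.one_le_W (hf.moment_eventually s) (fun u => (h.continuous_deriv u).measurable)
      (h.continuous_deriv s) (IsSubweight.of_const S.W_nonneg B)
      (Eventually.of_forall fun u => h.abs_deriv_le u) (h.abs_deriv_le s) fun R δ hδ => by
        obtain ⟨ω, hω, hu⟩ := h.deriv_unif δ hδ
        filter_upwards [eventually_abs_sub_le_nhds s hω] with u hus x _ using hu s u x hus

theorem IsSolution.continuous_integral [Nonempty X] (hf : P.IsSolution f₀ f)
    (h : P.IsTimeTest ψ ψ' γ B) :
    Continuous fun s : ℝ => ∫ x, ψ s x ∂(f s.toNNReal : Measure X) :=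
  continuous_iff_continuousAt.2 fun s =>
    tendsto_integral_of_isSubweight_of_uniform (hf.continuous_toNNReal.tendsto s) S.continuous_W
      S.one_le_W (hf.moment_eventually s) (fun u => (h.adm u).continuous.measurable)
      (h.adm s).continuous (IsSubweight.of_const S.W_nonneg B)
      (Eventually.of_forall fun u => h.abs_le u) (h.abs_le s) fun R δ hδ => by
        obtain ⟨ω, hω, hu⟩ := h.unif hδ
        filter_upwards [eventually_abs_sub_le_nhds s hω] with u hus x _ using hu s u x hus

theorem IsSolution.continuous_integral_gen [Nonempty X] (hf : P.IsSolution f₀ f)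
    (h : P.IsTimeTest ψ ψ' γ B) :
    Continuous fun s : ℝ => ∫ x, γ s x ∂(f s.toNNReal : Measure X) :=
  continuous_iff_continuousAt.2 fun s =>
    tendsto_integral_of_isSubweight_of_uniform (hf.continuous_toNNReal.tendsto s) S.continuous_W
      S.one_le_W (hf.moment_eventually s) (fun u => (h.gen u).1.measurable)
      (h.gen s).1 (P.isSubweight_G.const_mul S.W_nonneg B)
      (Eventually.of_forall fun u => h.abs_gen_le u) (h.abs_gen_le s) fun R δ hδ => by
        obtain ⟨ω, hω, hu⟩ := h.gen_unif R δ hδ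
        filter_upwards [eventually_abs_sub_le_nhds s hω] with u hus x hx using hu s u x hus hx

variable [SecondCountableTopology X] [ContinuousAdd X] [Nonempty X]

theorem IsSolution.continuous_weakOp (hf : P.IsSolution f₀ f) (h : P.IsTimeTest ψ ψ' γ B) :
    Continuous fun s : ℝ => S.weakOp (ψ s) (γ s) (f s.toNNReal : Measure X) :=
  continuous_iff_continuousAt.2 fun s =>
    S.tendsto_weakOp (hf.continuous_toNNReal.tendsto s) (hf.moment_eventually s)
      (ks := fun _ => S.K) (fun _ => S.continuous_K.measurable)
      (Eventually.of_forall fun _ => S.K_nonneg) (Eventually.of_forall fun _ _ => le_rfl)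
      (fun _ => Eventually.of_forall fun _ _ _ => rfl) h.nonneg
      (fun u => (h.adm u).continuous.measurable) (h.adm s).continuous
      (Eventually.of_forall fun u => (h.adm u).abs_le) (h.adm s).abs_le
      (fun R δ hδ => by
        obtain ⟨ω, hω, hu⟩ := h.unif hδ
        filter_upwards [eventually_abs_sub_le_nhds s hω] with u hus x _ using hu s u x hus)
      (fun u => (h.gen u).1.measurable) (h.gen s).1 (P.isSubweight_G.const_mul S.W_nonneg B)
      (Eventually.of_forall fun u => h.abs_gen_le u) (h.abs_gen_le s) fun R δ hδ => by
        obtain ⟨ω, hω, hu⟩ := h.gen_unif R δ hδ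
        filter_upwards [eventually_abs_sub_le_nhds s hω] with u hus x hx using hu s u x hus hx

theorem IsSolution.continuous_weakOp_const (hf : P.IsSolution f₀ f) {φ g : X → ℝ}
    (hφ : P.IsAdm φ B) (hg : P.IsGen φ g) :
    Continuous fun s : ℝ => S.weakOp φ g (f s.toNNReal : Measure X) :=
  continuous_iff_continuousAt.2 fun s =>
    S.tendsto_weakOp (hf.continuous_toNNReal.tendsto s) (hf.moment_eventually s)
      (ks := fun _ => S.K) (fun _ => S.continuous_K.measurable)
      (Eventually.of_forall fun _ => S.K_nonneg) (Eventually.of_forall fun _ _ => le_rfl)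
      (fun _ => Eventually.of_forall fun _ _ _ => rfl) hφ.nonneg
      (φs := fun _ => φ) (γs := fun _ => g)
      (fun u => hφ.continuous.measurable) hφ.continuous
      (Eventually.of_forall fun u => hφ.abs_le) hφ.abs_le
      (fun R δ hδ => Eventually.of_forall fun _ x _ => by simpa using hδ.le)
      (fun u => hg.1.measurable) hg.1 (P.isSubweight_G.const_mul S.W_nonneg B)
      (Eventually.of_forall fun u => hg.abs_le hφ) (hg.abs_le hφ) fun R δ hδ =>
        Eventually.of_forall fun _ x _ => by simpa using hδ.le

theorem IsSolution.hasDerivAt_integral (hf : P.IsSolution f₀ f) {φ g : X → ℝ}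
    (hφ : P.IsAdm φ B) (hg : P.IsGen φ g) {s : ℝ} (hs : 0 < s) :
    HasDerivAt (fun u : ℝ => ∫ x, φ x ∂(f u.toNNReal : Measure X))
      (S.weakOp φ g (f s.toNNReal : Measure X)) s := by
  have hc := hf.continuous_weakOp_const hφ hg
  have h1 := (hc.integral_hasStrictDerivAt 0 s).hasDerivAt.const_add (∫ x, φ x ∂f₀)
  refine h1.congr_of_eventuallyEq ?_
  filter_upwards [lt_mem_nhds hs] with u hu
  have := hf.identity φ g B hφ hg u.toNNReal
  rw [Real.coe_toNNReal _ hu.le] at this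
  exact this

theorem IsSolution.hasDerivAt_integral_timeTest (hf : P.IsSolution f₀ f)
    (h : P.IsTimeTest ψ ψ' γ B) {s : ℝ} (hs : 0 < s) :
    HasDerivAt (fun u : ℝ => ∫ x, ψ u x ∂(f u.toNNReal : Measure X))
      ((∫ x, ψ' s x ∂(f s.toNNReal : Measure X)) +
        S.weakOp (ψ s) (γ s) (f s.toNNReal : Measure X)) s := by
  have h2 := hasDerivAt_iff_tendsto_slope_zero.1 (hf.hasDerivAt_integral (h.adm s) (h.gen s) hs)
  have hadd : Tendsto (fun u : ℝ => s + u) (𝓝[≠] 0) (𝓝 s) := by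
    have : Tendsto (fun u : ℝ => s + u) (𝓝 0) (𝓝 (s + 0)) := tendsto_const_nhds.add tendsto_id
    rw [add_zero] at this
    exact this.mono_left nhdsWithin_le_nhds
  have hsm : ∀ ω > 0, ∀ᶠ u in 𝓝[≠] (0 : ℝ), |u| ≤ ω ∧ u ≠ 0 := fun ω hω => by
    have h3 := (eventually_abs_sub_le_nhds 0 hω).filter_mono (nhdsWithin_le_nhds (s := {0}ᶜ))
    filter_upwards [h3, self_mem_nhdsWithin] with u hu hu0
    exact ⟨by simpa using hu, hu0⟩
  have hquot : ∀ δ > 0, ∀ᶠ u in 𝓝[≠] (0 : ℝ), ∀ x,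
      |u⁻¹ * (ψ (s + u) x - ψ s x) - ψ' s x| ≤ δ := fun δ hδ => by
    obtain ⟨ω, hω, hsl⟩ := h.slope δ hδ
    filter_upwards [hsm ω hω] with u hu x
    have h4 := hsl s u x hu.1
    have e : u⁻¹ * (ψ (s + u) x - ψ s x) - ψ' s x =
        u⁻¹ * (ψ (s + u) x - ψ s x - u * ψ' s x) := by field_simp [hu.2]
    have hu' : 0 < |u| := abs_pos.2 hu.2
    rw [e, abs_mul, abs_inv, inv_mul_le_iff₀ hu']
    linarith
  have h3 : Tendsto (fun u => ∫ x, u⁻¹ * (ψ (s + u) x - ψ s x) ∂(f (s + u).toNNReal : Measure X))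
      (𝓝[≠] 0) (𝓝 (∫ x, ψ' s x ∂(f s.toNNReal : Measure X))) := by
    refine tendsto_integral_of_isSubweight_of_uniform
      ((hf.continuous_toNNReal.tendsto s).comp hadd) S.continuous_W
      S.one_le_W (hadd.eventually (hf.moment_eventually s)) (fun u => ?_)
      (h.continuous_deriv s) (IsSubweight.of_const S.W_nonneg (B + 1)) ?_
      (fun x => (h.abs_deriv_le s x).trans (by linarith)) ?_
    · exact (((h.adm _).continuous.sub (h.adm s).continuous).measurable).const_mul _
    · filter_upwards [hquot 1 one_pos] with u hu x
      have e : u⁻¹ * (ψ (s + u) x - ψ s x) =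
        (u⁻¹ * (ψ (s + u) x - ψ s x) - ψ' s x) + ψ' s x := by ring
      rw [e]
      refine (abs_add_le _ _).trans ?_
      linarith [hu x, h.abs_deriv_le s x]
    · intro R δ hδ
      filter_upwards [hquot δ hδ] with u hu x _ using hu x
  refine hasDerivAt_iff_tendsto_slope_zero.2 ((h3.add h2).congr fun u => ?_)
  have hi : ∀ v w, Integrable (ψ v) (f w : Measure X) := fun v w =>
    (IsSubweight.mono (IsSubweight.of_const S.W_nonneg B) (h.abs_le v)).integrable
      (h.adm v).continuous.measurable (hf.moment w).1
  rw [integral_const_mul, integral_sub (hi _ _) (hi _ _)]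
  simp only [smul_eq_mul]
  ring

/-- The weak formulation against test functions depending on time. -/
theorem IsSolution.identity_timeTest (hf : P.IsSolution f₀ f) (h : P.IsTimeTest ψ ψ' γ B) {t : ℝ}
    (ht : 0 ≤ t) :
    (∫ x, ψ t x ∂(f t.toNNReal : Measure X)) - (∫ x, ψ 0 x ∂f₀) -
        ∫ s in (0 : ℝ)..t, ∫ x, ψ' s x ∂(f s.toNNReal : Measure X) =
      (∫ s in (0 : ℝ)..t, (1 / 2) * ∫ z : X × X, S.K z *
        (ψ s (z.1 + z.2) - ψ s z.1 - ψ s z.2)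
          ∂((f s.toNNReal : Measure X).prod (f s.toNNReal : Measure X))) +
      ∫ s in (0 : ℝ)..t, ∫ x, γ s x ∂(f s.toNNReal : Measure X) := by
  have c1 := hf.continuous_integral_deriv h
  have c2 := hf.continuous_weakOp h
  have c3 := hf.continuous_integral_gen h
  have h1 := intervalIntegral.integral_eq_sub_of_hasDerivAt_of_le ht
    (hf.continuous_integral h).continuousOn
    (fun s hs => hf.hasDerivAt_integral_timeTest h hs.1)
    ((c1.add c2).intervalIntegrable 0 t)
  have h0 := hf.identity _ _ _ (h.adm 0) (h.gen 0) 0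
  simp only [NNReal.coe_zero, intervalIntegral.integral_same, add_zero] at h0
  rw [intervalIntegral.integral_add (c1.intervalIntegrable 0 t) (c2.intervalIntegrable 0 t),
    Real.toNNReal_zero, h0] at h1
  have h5 : ∫ s in (0 : ℝ)..t, S.weakOp (ψ s) (γ s) (f s.toNNReal : Measure X) =
      (∫ s in (0 : ℝ)..t, (S.weakOp (ψ s) (γ s) (f s.toNNReal : Measure X) -
        ∫ x, γ s x ∂(f s.toNNReal : Measure X))) +
      ∫ s in (0 : ℝ)..t, ∫ x, γ s x ∂(f s.toNNReal : Measure X) := by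
    rw [intervalIntegral.integral_sub (c2.intervalIntegrable 0 t) (c3.intervalIntegrable 0 t)]
    ring
  have h6 : ∀ s, S.weakOp (ψ s) (γ s) (f (Real.toNNReal s) : Measure X) -
      ∫ x, γ s x ∂(f s.toNNReal : Measure X) = (1 / 2) * ∫ z : X × X, S.K z *
        (ψ s (z.1 + z.2) - ψ s z.1 - ψ s z.2)
          ∂((f s.toNNReal : Measure X).prod (f s.toNNReal : Measure X)) := fun s => by
    unfold CoagSystem.weakOp; ring
  simp only [h6] at h5
  linarith

end

end FusionFlow

end TimeDependent

section SmoothTests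

open scoped NNReal

theorem ContDiff.exists_uniform_slope {E : Type*} [NormedAddCommGroup E] [NormedSpace ℝ E]
    {Ψ : E → ℝ} (hΨ : ContDiff ℝ 1 Ψ) (hc : HasCompactSupport Ψ) {δ : ℝ} (hδ : 0 < δ) :
    ∃ ω > 0, ∀ x y, ‖y - x‖ ≤ ω → ‖fderiv ℝ Ψ y - fderiv ℝ Ψ x‖ ≤ δ ∧
      ‖Ψ y - Ψ x - fderiv ℝ Ψ x (y - x)‖ ≤ δ * ‖y - x‖ := by
  have hu : UniformContinuous (fderiv ℝ Ψ) :=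
    (hΨ.continuous_fderiv one_ne_zero).uniformContinuous_of_tendsto_cocompact
      (hc.fderiv ℝ).is_zero_at_infty
  obtain ⟨ω, hω, h⟩ := Metric.uniformContinuous_iff.1 hu δ hδ
  have key : ∀ x y, ‖y - x‖ ≤ ω / 2 → ‖fderiv ℝ Ψ y - fderiv ℝ Ψ x‖ ≤ δ := fun x y hxy => by
    rw [← dist_eq_norm]
    exact (h (by rw [dist_eq_norm]; linarith)).le
  refine ⟨ω / 2, by positivity, fun x y hxy => ⟨key x y hxy, ?_⟩⟩
  refine (convex_closedBall x (ω / 2)).norm_image_sub_le_of_norm_fderiv_le' (𝕜 := ℝ)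
    (fun z _ => hΨ.differentiable one_ne_zero z) (fun z hz => key x z ?_)
    (Metric.mem_closedBall_self (by positivity)) ?_
  · rwa [← dist_eq_norm]
  · rwa [Metric.mem_closedBall, dist_eq_norm]

theorem deriv_fst_eq_fderiv {Ψ : ℝ × (ℝ × ℝ) → ℝ} (hΨ : ContDiff ℝ 1 Ψ) (s : ℝ) (η : ℝ × ℝ) :
    deriv (fun u => Ψ (u, η)) s = fderiv ℝ Ψ (s, η) (1, 0) :=
  ((hΨ.differentiable one_ne_zero (s, η)).hasFDerivAt.comp_hasDerivAt s
    ((hasDerivAt_id s).prodMk (hasDerivAt_const s η))).deriv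

theorem da_eq_fderiv {Ψ : ℝ × (ℝ × ℝ) → ℝ} (hΨ : ContDiff ℝ 1 Ψ) (s : ℝ) (η : ℝ × ℝ) :
    da (fun p => Ψ (s, p)) η = fderiv ℝ Ψ (s, η) (0, (1, 0)) :=
  HasDerivAt.deriv (f := fun a => Ψ (s, (a, η.2)))
    ((hΨ.differentiable one_ne_zero (s, η)).hasFDerivAt.comp_hasDerivAt η.1
      ((hasDerivAt_const η.1 s).prodMk ((hasDerivAt_id η.1).prodMk (hasDerivAt_const η.1 η.2))))

theorem IsPowerSystem.exists_isTimeTest {S : CoagSystem IsoPair} {p q : ℝ}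
    (hS : IsPowerSystem S p q) {ρ : IsoPair → ℝ} {D s : ℝ} (hρ : IsRelaxRate ρ D p s)
    (hs : s * p = q) {Ψ : ℝ × (ℝ × ℝ) → ℝ} (hΨ : ContDiff ℝ 1 Ψ) (hc : HasCompactSupport Ψ) :
    ∃ B, (hS.flow hρ hs).IsTimeTest (fun t x => Ψ (t, x.1))
      (fun t x => fderiv ℝ Ψ (t, x.1) (1, 0))
      (fun t x => -(ρ x * x.excess) * fderiv ℝ Ψ (t, x.1) (0, (1, 0))) B := by
  have hcf := hΨ.continuous_fderiv one_ne_zero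
  obtain ⟨b₁, hb₁⟩ := hΨ.continuous.bounded_above_of_compact_support hc
  obtain ⟨b₂, hb₂⟩ := hcf.bounded_above_of_compact_support (hc.fderiv ℝ)
  obtain ⟨L, hL⟩ := hΨ.lipschitzWith_of_hasCompactSupport hc one_ne_zero
  have hb₁0 : 0 ≤ b₁ := (norm_nonneg _).trans (hb₁ 0)
  have hb₂0 : 0 ≤ b₂ := (norm_nonneg _).trans (hb₂ 0)
  have n1 : ‖((1 : ℝ), (0 : ℝ × ℝ))‖ = 1 := by simp [Prod.norm_def]
  have n2 : ‖((0 : ℝ), ((1 : ℝ), (0 : ℝ)))‖ = 1 := by simp [Prod.norm_def]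
  have hap : ∀ (A : ℝ × (ℝ × ℝ) →L[ℝ] ℝ) (e : ℝ × (ℝ × ℝ)), ‖e‖ = 1 → |A e| ≤ ‖A‖ :=
    fun A e he => by simpa [he] using A.le_opNorm e
  have hcoe : ∀ t : ℝ, Continuous fun x : IsoPair => (t, x.1) := fun t =>
    continuous_const.prodMk continuous_subtype_val
  have hcd : ∀ t e, Continuous fun x : IsoPair => fderiv ℝ Ψ (t, x.1) e := fun t e =>
    (hcf.comp (hcoe t)).clm_apply continuous_const
  have hlip : ∀ t : ℝ, LipschitzWith L fun x : IsoPair => Ψ (t, x.1) := fun t =>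
    LipschitzWith.of_dist_le_mul fun x y => by
      refine (hL.dist_le_mul _ _).trans_eq ?_
      rw [Prod.dist_eq, dist_self, max_eq_right dist_nonneg, Subtype.dist_eq]
  have hadm := fun t => (hS.flow hρ hs).isAdm_of_lipschitz (hlip t) (b := b₁ + b₂)
    (fun x => by have := hb₁ (t, x.1); rw [Real.norm_eq_abs] at this; linarith) (by positivity)
  refine ⟨b₁ + b₂ + L, hadm, fun t => ?_, fun t x => ?_, fun t => hcd t _, fun t x => ?_,
    fun δ hδ => ?_, fun δ hδ => ?_, fun R δ hδ => ?_⟩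
  · refine hS.isGen_flow hρ hs (hcd t _) hb₂0 (fun x => (hap _ _ n2).trans (hb₂ _)) fun δ hδ => ?_
    obtain ⟨ω, hω, h⟩ := hΨ.exists_uniform_slope hc hδ
    refine ⟨ω, hω, fun x d hd hx => ?_⟩
    have h0 := x.area_sub_shrink_area_nonneg hd
    have e : (t, (x.shrink d).1) - (t, x.1) =
        (-(x.1.1 - (x.shrink d).1.1)) • ((0 : ℝ), ((1 : ℝ), (0 : ℝ))) := by
      ext <;> simp
    have hn : ‖(t, (x.shrink d).1) - (t, x.1)‖ = x.1.1 - (x.shrink d).1.1 := by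
      rw [e, norm_smul, n2, mul_one, norm_neg, Real.norm_of_nonneg h0]
    have h1 := (h (t, x.1) (t, (x.shrink d).1) (by rw [hn]; exact hx)).2
    rw [hn, e, map_smul, smul_eq_mul, Real.norm_eq_abs] at h1
    convert h1 using 2
    ring
  · have := hb₁ (t, x.1)
    rw [Real.norm_eq_abs] at this
    linarith [L.coe_nonneg]
  · linarith [(hap _ _ n1).trans (hb₂ (t, x.1)), L.coe_nonneg]
  · obtain ⟨ω, hω, h⟩ := hΨ.exists_uniform_slope hc hδ
    refine ⟨ω, hω, fun t u x hu => ?_⟩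
    have e : (t + u, x.1) - (t, x.1) = u • ((1 : ℝ), (0 : ℝ × ℝ)) := by
      ext <;> simp
    have hn : ‖(t + u, x.1) - (t, x.1)‖ = |u| := by
      rw [e, norm_smul, n1, mul_one, Real.norm_eq_abs]
    have h1 := (h (t, x.1) (t + u, x.1) (by rw [hn]; exact hu)).2
    rwa [hn, e, map_smul, smul_eq_mul, Real.norm_eq_abs] at h1
  · obtain ⟨ω, hω, h⟩ := hΨ.exists_uniform_slope hc hδ
    refine ⟨ω, hω, fun t t' x ht => ?_⟩
    rw [← sub_apply]
    refine (hap _ _ n1).trans (h _ _ ?_).1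
    simpa [Prod.norm_def] using ht
  · obtain ⟨ω, hω, h⟩ := hΨ.exists_uniform_slope hc
      (show 0 < δ / (D * |R| + 1) by have := hρ.D_nonneg; positivity)
    refine ⟨ω, hω, fun t t' x ht hx => ?_⟩
    have hD := hρ.D_nonneg
    have h1 : ρ x * x.excess ≤ D * |R| := (hS.rate_mul_excess_le_W hρ hs x).trans
      (mul_le_mul_of_nonneg_left (hx.trans (le_abs_self R)) hD)
    have h2 : |fderiv ℝ Ψ (t', x.1) (0, (1, 0)) - fderiv ℝ Ψ (t, x.1) (0, (1, 0))| ≤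
        δ / (D * |R| + 1) := by
      rw [← sub_apply]
      refine (hap _ _ n2).trans (h _ _ ?_).1
      simpa [Prod.norm_def] using ht
    have h3 := mul_nonneg (hρ.nonneg x) x.excess_nonneg
    rw [← mul_sub, abs_mul, abs_neg, abs_of_nonneg h3]
    calc _ ≤ (D * |R| + 1) * (δ / (D * |R| + 1)) :=
          mul_le_mul (by linarith) h2 (abs_nonneg _) (by positivity)
      _ = δ := by field_simp

end SmoothTests

section WeakSolutions

open scoped NNReal BoundedContinuousFunction

theorem measurableSet_isoRegion : MeasurableSet IsoRegion :=
  (measurableSet_lt measurable_const measurable_snd).inter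
    (measurableSet_le ((measurable_snd.pow_const _).const_mul _) measurable_fst)

theorem measurableEmbedding_isoPair : MeasurableEmbedding (Subtype.val : IsoPair → ℝ × ℝ) :=
  MeasurableEmbedding.subtype_coe measurableSet_isoRegion

theorem isIsoMeasure_map (m : Measure IsoPair) : IsIsoMeasure (m.map Subtype.val) := by
  rw [IsIsoMeasure, Measure.map_apply measurableEmbedding_isoPair.measurable
    measurableSet_isoRegion.compl]
  have : (Subtype.val : IsoPair → ℝ × ℝ) ⁻¹' IsoRegionᶜ = ∅ := by
    ext x; simp
  rw [this, measure_empty]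

theorem IsIsoMeasure.map_comap {m : Measure (ℝ × ℝ)} (h : IsIsoMeasure m) :
    (m.comap (Subtype.val : IsoPair → ℝ × ℝ)).map Subtype.val = m := by
  rw [map_comap_subtype_coe measurableSet_isoRegion]
  exact Measure.restrict_eq_self_of_ae_mem (mem_ae_iff.2 h)

theorem IsC0Quad.exists_bound {φ : ℝ × ℝ → ℝ} (hφ : IsC0Quad φ) : ∃ C, ∀ p, |φ p| ≤ C := by
  obtain ⟨A, hA, -, hAφ⟩ := hφ.2.2 1 one_pos
  obtain ⟨C, hC⟩ := hA.exists_bound_of_continuousOn hφ.1.continuousOn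
  refine ⟨max C 1, fun p => ?_⟩
  by_cases hp : p ∈ A
  · exact (hC p hp).trans (le_max_left _ _)
  · exact (hAφ p hp).trans (le_max_right _ _)

theorem IsC0Quad.tendsto_integral_map {φ : ℝ × ℝ → ℝ} (hφ : IsC0Quad φ) {ι : Type*} {l : Filter ι}
    {μs : ι → FiniteMeasure IsoPair} {μ : FiniteMeasure IsoPair} (h : Tendsto μs l (𝓝 μ)) :
    Tendsto (fun i => ∫ η, φ η ∂((μs i : Measure IsoPair).map Subtype.val)) l
      (𝓝 (∫ η, φ η ∂((μ : Measure IsoPair).map Subtype.val))) := by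
  obtain ⟨C, hC⟩ := hφ.exists_bound
  simp only [measurableEmbedding_isoPair.integral_map]
  exact FiniteMeasure.tendsto_iff_forall_integral_tendsto.1 h
    (BoundedContinuousFunction.ofNormedAddCommGroup (fun x : IsoPair => φ x.1)
      (hφ.1.comp continuous_subtype_val) C fun x => hC _)

theorem CoagSystem.integrable_K_mul {X : Type*} [PseudoMetricSpace X] [Add X] [ContinuousAdd X]
    [MeasurableSpace X] [BorelSpace X] [SecondCountableTopology X] (S : CoagSystem X) {φ : X → ℝ}
    {B : ℝ} (hB : 0 ≤ B) (hφc : Continuous φ) (hφ : ∀ x, |φ x| ≤ B * S.U x) {μ : Measure X}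
    [IsFiniteMeasure μ] (hμ : Integrable S.W μ) :
    Integrable (fun z : X × X => S.K z * (φ (z.1 + z.2) - φ z.1 - φ z.2)) (μ.prod μ) := by
  refine ((S.isSubweight_prod (2 * B * S.C * (S.C + 1))).mono fun z => ?_).integrable ?_
    (hμ.mul_prod hμ)
  · rw [abs_mul, abs_of_nonneg (S.K_nonneg z)]
    exact S.abs_K_mul_le hB hφ z.1 z.2
  · exact (S.continuous_K.mul ((hφc.comp continuous_add).sub (hφc.comp continuous_fst)
      |>.sub (hφc.comp continuous_snd))).measurable

/-- The weight appearing in the moment bounds. -/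
noncomputable def momentWeight (p q : ℝ) (η : ℝ × ℝ) : ℝ :=
  η.2 ^ (-p) + η.2 ^ p + η.2 ^ q + η.1 ^ p

theorem IsoPair.momentWeight_le (x : IsoPair) (p q : ℝ) : momentWeight p q x.1 ≤ x.wWeight p q := by
  have := x.volume_pos
  simp only [momentWeight, IsoPair.wWeight, IsoPair.yWeight, IsoPair.zWeight]
  linarith

theorem IsoPair.wWeight_le_momentWeight (x : IsoPair) {p : ℝ} (hp : 1 ≤ p) (q : ℝ) :
    x.wWeight p q ≤ 3 * momentWeight p q x.1 := by
  have hv := x.volume_pos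
  have ha := x.area_pos
  have h1 := rpow_le_rpow_add_rpow_neg hv (show |(0 : ℝ)| ≤ p by simpa using by linarith)
  have h2 := rpow_le_rpow_add_rpow_neg hv (show |(1 : ℝ)| ≤ p by simpa using hp)
  rw [Real.rpow_zero] at h1
  rw [Real.rpow_one] at h2
  have h3 : 0 ≤ x.1.2 ^ q := by positivity
  have h4 : 0 ≤ x.1.1 ^ p := by positivity
  simp only [momentWeight, IsoPair.wWeight, IsoPair.yWeight, IsoPair.zWeight]
  linarith

theorem CoagSystem.integrable_W_of_lintegral_momentWeight {S : CoagSystem IsoPair} {p q : ℝ}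
    (hS : IsPowerSystem S p q) {m : Measure IsoPair}
    (h : ∫⁻ x : IsoPair, ENNReal.ofReal (momentWeight p q x.1) ∂m ≠ ⊤) : Integrable S.W m := by
  refine ⟨S.continuous_W.measurable.aestronglyMeasurable, ?_⟩
  rw [hasFiniteIntegral_iff_ofReal (ae_of_all _ S.W_nonneg)]
  calc ∫⁻ x, ENNReal.ofReal (S.W x) ∂m
      ≤ ∫⁻ x, ENNReal.ofReal 3 * ENNReal.ofReal (momentWeight p q x.1) ∂m := by
        refine lintegral_mono fun x => ?_
        rw [← ENNReal.ofReal_mul (by norm_num), hS.W_eq]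
        exact ENNReal.ofReal_le_ofReal
          (x.wWeight_le_momentWeight (by linarith [hS.three_le]) q)
    _ = ENNReal.ofReal 3 * ∫⁻ x, ENNReal.ofReal (momentWeight p q x.1) ∂m :=
        lintegral_const_mul' _ _ ENNReal.ofReal_ne_top
    _ < ⊤ := ENNReal.mul_lt_top ENNReal.ofReal_lt_top h.lt_top

theorem CoagSystem.isFiniteMeasure_of_integrable_W {X : Type*} [TopologicalSpace X] [Add X]
    [MeasurableSpace X] (S : CoagSystem X) {m : Measure X} (h : Integrable S.W m) :
    IsFiniteMeasure m := by
  refine ⟨?_⟩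
  rw [← lintegral_one]
  refine (lintegral_mono fun x => ?_).trans_lt
    ((hasFiniteIntegral_iff_ofReal (ae_of_all _ S.W_nonneg)).1 h.2)
  rw [← ENNReal.ofReal_one]
  exact ENNReal.ofReal_le_ofReal (S.one_le_W x)

theorem CoagSystem.lintegral_map_le {S : CoagSystem IsoPair} {m : Measure IsoPair}
    (hm : Integrable S.W m) {I : ℝ} (hI : ∫ x, S.W x ∂m ≤ I) {w : ℝ × ℝ → ℝ}
    (hw : ∀ x : IsoPair, w x.1 ≤ S.W x) :
    ∫⁻ η, ENNReal.ofReal (w η) ∂(m.map Subtype.val) ≤ ENNReal.ofReal I := by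
  rw [measurableEmbedding_isoPair.lintegral_map]
  refine (lintegral_mono fun x => ENNReal.ofReal_le_ofReal (hw x)).trans ?_
  rw [← ofReal_integral_eq_lintegral_ofReal hm (ae_of_all _ S.W_nonneg)]
  exact ENNReal.ofReal_le_ofReal hI

theorem IsCoagKernel.exists_coagSystem {K : ℝ × ℝ → ℝ × ℝ → ℝ} {K₀ K₁ al be : ℝ}
    (hK : IsCoagKernel K K₀ K₁ al be) {p : ℝ} (hp : 3 ≤ p) (q : ℝ) :
    ∃ S : CoagSystem IsoPair, IsPowerSystem S p q ∧ ∀ z, S.K z = K z.1.1 z.2.1 := by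
  have hq : ∀ x : IsoPair, x.1 ∈ Quad := fun x => isoRegion_subset_quad x.2
  refine ⟨IsoPair.coagSystem hK.al_pos (by linarith [hK.be_sub_al_mem.1, hK.be_mem.2])
    hK.be_mem.1 hK.be_mem.2 (hK.K1_pos.le.trans hK.K1_le_K0) hp q
    (fun z => K z.1.1 z.2.1) ?_ (fun z => ?_) (fun x y => hK.symm _ _)
    (fun x y => hK.upper _ (hq x) _ (hq y)), ⟨hp, ?_, ?_, ?_, ?_⟩, fun z => rfl⟩
  · exact hK.cont.comp_continuous
      ((continuous_subtype_val.comp continuous_fst).prodMk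
        (continuous_subtype_val.comp continuous_snd)) fun z => ⟨hq z.1, hq z.2⟩
  · refine le_trans ?_ (hK.lower _ (hq z.1) _ (hq z.2))
    have := hK.K1_pos
    have h1 := z.1.2.1
    have h2 := z.2.2.1
    positivity
  all_goals exact fun x => rfl

theorem IsFusionKernel.isRelaxRate {r : ℝ × ℝ → ℝ} {R₀ R₁ mu sg B : ℝ}
    (hr : IsFusionKernel r R₀ R₁ mu sg B) {c : ℝ} (hc : 0 ≤ c) :
    IsRelaxRate (fun x => c * r x.1) (c * R₁) (mu + 3) sg where
  continuous := continuous_const.mul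
    (hr.smooth.continuousOn.comp_continuous continuous_subtype_val
      fun x => isoRegion_subset_quad x.2)
  nonneg x := mul_nonneg hc (hr.pos _ (isoRegion_subset_quad x.2)).le
  D_nonneg := mul_nonneg hc hr.R1_pos.le
  le x := by
    have h := hr.upper _ (isoRegion_subset_quad x.2)
    rw [show mu + 3 - 3 = mu by ring, mul_assoc, ← mul_assoc R₁]
    exact mul_le_mul_of_nonneg_left h hc

section

variable {S : CoagSystem IsoPair} {p q : ℝ} (hS : IsPowerSystem S p q)
  {r : ℝ × ℝ → ℝ} {c D s : ℝ} (hρ : IsRelaxRate (fun x => c * r x.1) D p s) (hs : s * p = q)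
  {K : ℝ × ℝ → ℝ × ℝ → ℝ} {fin : Measure (ℝ × ℝ)} {F : ℝ≥0 → FiniteMeasure IsoPair}

theorem IsPowerSystem.weakIdentity (hSK : ∀ z, S.K z = K z.1.1 z.2.1) (hfin : IsIsoMeasure fin)
    (hF : (hS.flow hρ hs).IsSolution (fin.comap Subtype.val) F) {ψ : ℝ × (ℝ × ℝ) → ℝ}
    (hψ : IsTestFun ψ) {t : ℝ} (ht : 0 ≤ t) :
    WeakIdentity K r c fin (fun t => (F t.toNNReal : Measure IsoPair).map Subtype.val) ψ t := by
  obtain ⟨B, hB⟩ := hS.exists_isTimeTest hρ hs hψ.1 hψ.2.1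
  have key := hF.identity_timeTest hB ht
  have h0 : ∫ η, ψ (0, η) ∂fin = ∫ x : IsoPair, ψ (0, x.1) ∂(fin.comap Subtype.val) := by
    conv_lhs => rw [← hfin.map_comap]
    rw [measurableEmbedding_isoPair.integral_map]
  have hK : ∀ u : ℝ, ∫ z : IsoPair × IsoPair, S.K z *
        (ψ (u, (z.1 + z.2 : IsoPair).1) - ψ (u, z.1.1) - ψ (u, z.2.1))
          ∂((F u.toNNReal : Measure IsoPair).prod (F u.toNNReal : Measure IsoPair)) =
      ∫ x : IsoPair, ∫ y : IsoPair, K x.1 y.1 *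
        (ψ (u, x.1 + y.1) - ψ (u, x.1) - ψ (u, y.1)) ∂(F u.toNNReal : Measure IsoPair)
          ∂(F u.toNNReal : Measure IsoPair) := fun u => by
    rw [integral_prod _ (S.integrable_K_mul (φ := fun x => ψ (u, x.1)) hB.nonneg
      (hB.adm u).continuous (hB.adm u).abs_le (hF.moment _).1)]
    simp only [hSK, IsoPair.coe_add]
  have hg : ∀ u : ℝ, ∫ x : IsoPair, -(c * r x.1 * x.excess) * fderiv ℝ ψ (u, x.1) (0, (1, 0))
        ∂(F u.toNNReal : Measure IsoPair) =
      c * ∫ x : IsoPair, r x.1 * (c0 * x.1.2 ^ ((2 : ℝ) / 3) - x.1.1) *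
        da (fun p => ψ (u, p)) x.1 ∂(F u.toNNReal : Measure IsoPair) := fun u => by
    rw [← integral_const_mul]
    congr 1 with x
    rw [da_eq_fderiv hψ.1, IsoPair.excess, IsoPair.sphereArea]
    ring
  simp only [hK, hg, intervalIntegral.integral_const_mul] at key
  simp only [WeakIdentity, measurableEmbedding_isoPair.integral_map, h0,
    deriv_fst_eq_fderiv hψ.1, intervalIntegral.integral_const_mul]
  exact key

theorem IsPowerSystem.isWeakSolution {al be : ℝ} (hal : |al| ≤ 1) (hbe : 0 ≤ be) (hbe1 : be ≤ 1)
    (hSK : ∀ z, S.K z = K z.1.1 z.2.1) (hfin : IsIsoMeasure fin)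
    (hF : (hS.flow hρ hs).IsSolution (fin.comap Subtype.val) F) :
    IsWeakSolution K r c al be fin
      fun t => (F t.toNNReal : Measure IsoPair).map Subtype.val := by
  refine ⟨fun t _ => isIsoMeasure_map _, fun φ hφ => ?_, fun T hT => ?_, fun ψ hψ t ht =>
    hS.weakIdentity hρ hs hSK hfin hF hψ ht⟩
  · exact (continuous_iff_continuousAt.2 fun t =>
      hφ.tendsto_integral_map (hF.continuous_toNNReal.tendsto t)).continuousOn
  · refine ⟨ENNReal.ofReal (S.momentBound (fin.comap Subtype.val) T), ENNReal.ofReal_ne_top,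
      fun t ht => CoagSystem.lintegral_map_le (hF.moment _).1
        ((hF.moment _).2.trans (S.momentBound_mono _ (NNReal.coe_nonneg _) ?_)) fun x => ?_⟩
    · rw [Real.coe_toNNReal _ ht.1]; exact ht.2
    · have hp := hS.three_le
      have hv := x.volume_pos
      have ha := x.area_pos
      have h1 := rpow_le_rpow_add_rpow_neg hv
        (show |(-al)| ≤ p by rw [abs_neg]; linarith)
      have h2 := rpow_le_one_add_rpow hv hbe hbe1
      have h3 : 0 ≤ x.1.2 ^ q := by positivity
      have h4 : 0 ≤ x.1.1 ^ p := by positivity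
      rw [Real.rpow_one] at h2
      simp only [hS.W_eq, IsoPair.wWeight, IsoPair.yWeight, IsoPair.zWeight]
      linarith

end

end WeakSolutions

section FastFusion

open scoped NNReal BoundedContinuousFunction

theorem CoagSystem.abs_weakOp_sub_le {X : Type*} [PseudoMetricSpace X] [Add X] [ContinuousAdd X]
    [MeasurableSpace X] [BorelSpace X] [SecondCountableTopology X] (S : CoagSystem X) {φ : X → ℝ}
    {B : ℝ} (hB : 0 ≤ B) (hφ : ∀ x, |φ x| ≤ B * S.U x) {μ : Measure X}
    [IsFiniteMeasure μ] (hμ : Integrable S.W μ) {M : ℝ} (hM : ∫ x, S.W x ∂μ ≤ M) (g : X → ℝ) :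
    |S.weakOp φ g μ - ∫ x, g x ∂μ| ≤ B * S.C * (S.C + 1) * M ^ 2 := by
  have hC := S.C_nonneg
  have h0 : 0 ≤ ∫ x, S.W x ∂μ := integral_nonneg S.W_nonneg
  have h1 : ‖∫ z : X × X, S.K z * (φ (z.1 + z.2) - φ z.1 - φ z.2) ∂(μ.prod μ)‖ ≤
      ∫ z : X × X, 2 * B * S.C * (S.C + 1) * (S.W z.1 * S.W z.2) ∂(μ.prod μ) := by
    refine norm_integral_le_of_norm_le ((hμ.mul_prod hμ).const_mul _) (ae_of_all _ fun z => ?_)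
    rw [Real.norm_eq_abs, abs_mul, abs_of_nonneg (S.K_nonneg z)]
    refine (S.abs_K_mul_le hB hφ z.1 z.2).trans ?_
    have h2 := S.U_sq_le_W z.1
    have h3 := S.U_sq_le_W z.2
    have h4 := S.W_nonneg z.1
    gcongr
  rw [integral_const_mul, integral_prod_mul, Real.norm_eq_abs] at h1
  rw [CoagSystem.weakOp, add_sub_cancel_right, abs_mul, abs_of_pos (by norm_num : (0 : ℝ) < 1 / 2)]
  have h5 : (∫ x, S.W x ∂μ) * (∫ x, S.W x ∂μ) ≤ M ^ 2 := by
    rw [pow_two]; exact mul_le_mul hM hM h0 (h0.trans hM)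
  have h6 : 0 ≤ 2 * B * S.C * (S.C + 1) := by positivity
  linarith [mul_le_mul_of_nonneg_left h5 h6]

theorem le_add_exp_of_hasDerivAt_le {H H' : ℝ → ℝ} {lam b t : ℝ} (ht : 0 ≤ t)
    (hc : ContinuousOn H (Icc 0 t)) (hH : ∀ u ∈ Ioo 0 t, HasDerivAt H (H' u) u)
    (hle : ∀ u ∈ Ioo 0 t, H' u ≤ -lam * (H u - b)) :
    H t ≤ b + exp (-(lam * t)) * (H 0 - b) := by
  have hd : ∀ u ∈ Ioo 0 t, HasDerivAt (fun u => exp (lam * u) * (H u - b))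
      (exp (lam * u) * lam * (H u - b) + exp (lam * u) * H' u) u := fun u hu => by
    have h1 : HasDerivAt (fun u => exp (lam * u)) (exp (lam * u) * lam) u := by
      simpa using ((hasDerivAt_id u).const_mul lam).exp
    exact h1.mul ((hH u hu).sub_const b)
  have hanti : AntitoneOn (fun u => exp (lam * u) * (H u - b)) (Icc 0 t) := by
    refine antitoneOn_of_deriv_nonpos (convex_Icc 0 t) ?_ ?_ ?_
    · exact ContinuousOn.mul (by fun_prop) (hc.sub continuousOn_const)
    · rw [interior_Icc]
      exact fun u hu => (hd u hu).differentiableAt.differentiableWithinAt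
    · rw [interior_Icc]
      intro u hu
      rw [(hd u hu).deriv]
      have := mul_le_mul_of_nonneg_left (hle u hu) (exp_pos (lam * u)).le
      linarith
  have h := hanti (left_mem_Icc.2 ht) (right_mem_Icc.2 ht) ht
  simp only [mul_zero, exp_zero, one_mul] at h
  have h2 : exp (-(lam * t)) * (exp (lam * t) * (H t - b)) = H t - b := by
    rw [← mul_assoc, ← exp_add]; simp
  have h3 := mul_le_mul_of_nonneg_left h (exp_pos (-(lam * t))).le
  linarith

namespace IsPowerSystem

variable {S : CoagSystem IsoPair} {p q s : ℝ} (hS : IsPowerSystem S p q) (hs : s * p = q)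
  {r : IsoPair → ℝ} {f₀ : Measure IsoPair}

include hS

theorem integrable_excess {m : Measure IsoPair} [IsFiniteMeasure m] (hm : Integrable S.W m) :
    Integrable (fun x : IsoPair => x.excess) m :=
  (S.isSubweight_of_le_U (B := 1) fun x => by
    rw [abs_of_nonneg x.excess_nonneg, one_mul]
    exact hS.excess_le x).integrable IsoPair.continuous_excess.measurable hm

theorem integral_excess_le {m : Measure IsoPair} [IsFiniteMeasure m] (hm : Integrable S.W m) :
    ∫ x : IsoPair, x.excess ∂m ≤ ∫ x, S.W x ∂m :=
  integral_mono (hS.integrable_excess hm) hm fun x => (hS.excess_le x).trans (S.U_le_W x)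

/-- The dissipation rate of the excess area controls the excess area, up to a small error. -/
theorem exists_mul_excess_le (hr : Continuous r) (hr0 : ∀ x, 0 < r x) {δ : ℝ} (hδ : 0 < δ) :
    ∃ κ > 0, ∀ x : IsoPair, κ * (x.excess - δ * S.W x) ≤ r x * x.excess := by
  obtain ⟨κ, hκ, h⟩ := (S.isCompact_W_le (1 / δ ^ 2)).exists_forall_le' hr.continuousOn
    (fun x _ => hr0 x)
  refine ⟨κ, hκ, fun x => ?_⟩
  have he := x.excess_nonneg
  have hW := S.W_nonneg x
  by_cases hx : S.W x ≤ 1 / δ ^ 2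
  · have h1 := mul_le_mul_of_nonneg_right (h x hx) he
    have h2 : 0 ≤ κ * (δ * S.W x) := by positivity
    linarith
  · have hx' : 1 / δ ^ 2 ≤ S.W x := (not_le.1 hx).le
    have h1 : x.excess ≤ δ * S.W x := by
      refine (hS.excess_le x).trans ?_
      rcases le_total (1 / δ) (S.U x) with hU | hU
      · have h2 := S.U_sq_le_W x
        have h3 : 1 ≤ δ * S.U x := by rwa [div_le_iff₀' hδ] at hU
        nlinarith [S.U_nonneg x]
      · refine hU.trans ?_
        have h2 := mul_le_mul_of_nonneg_left hx' hδ.le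
        have h3 : δ * (1 / δ ^ 2) = 1 / δ := by field_simp
        linarith
    have h2 : κ * (x.excess - δ * S.W x) ≤ 0 := mul_nonpos_of_nonneg_of_nonpos hκ.le (by linarith)
    exact h2.trans (mul_nonneg (hr0 x).le he)

/-- Under fast fusion the excess area becomes small after an arbitrarily short time. -/
theorem exists_forall_integral_excess_le (hr : Continuous r) (hr0 : ∀ x, 0 < r x)
    (f₀ : Measure IsoPair) {t₀ T δ : ℝ} (ht₀ : 0 < t₀) (hδ : 0 < δ) :
    ∃ Λ, ∀ c, Λ ≤ c → ∀ (D : ℝ) (hρ : IsRelaxRate (fun x => c * r x) D p s)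
      (F : ℝ≥0 → FiniteMeasure IsoPair), (hS.flow hρ hs).IsSolution f₀ F → ∀ t, t₀ ≤ t → t ≤ T →
      ∫ x : IsoPair, x.excess ∂(F t.toNNReal : Measure IsoPair) ≤ δ := by
  set M := |S.momentBound f₀ T| with hM
  have hM0 : 0 ≤ M := abs_nonneg _
  have hC := S.C_nonneg
  set A := 1 * S.C * (S.C + 1) * M ^ 2 with hA
  have hA0 : 0 ≤ A := by positivity
  obtain ⟨κ, hκ, hκr⟩ := hS.exists_mul_excess_le hr hr0
    (show 0 < δ / (2 * (M + 1)) by positivity)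
  refine ⟨(2 * (A + M / t₀) / δ + 1) / κ, fun c hc D hρ F hF t ht₀t htT => ?_⟩
  rw [div_le_iff₀ hκ] at hc
  set lam := c * κ with hlam
  have hlam0 : 0 < lam := lt_of_lt_of_le (by positivity) hc
  have hc0 : 0 < c := pos_of_mul_pos_left hlam0 hκ.le
  have ht : 0 < t := ht₀.trans_le ht₀t
  have hbd : ∀ u : ℝ, 0 ≤ u → u ≤ t → ∫ x, S.W x ∂(F u.toNNReal : Measure IsoPair) ≤ M :=
    fun u hu0 hu => (hF.moment _).2.trans ((S.momentBound_mono f₀ (NNReal.coe_nonneg _)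
      (by rw [Real.coe_toNNReal _ hu0]; linarith)).trans (le_abs_self _))
  have hadm := hS.isAdm_excess hρ hs
  have hgen := hS.isGen_excess hρ hs
  have hcont : Continuous fun u : ℝ => ∫ x : IsoPair, x.excess ∂(F u.toNNReal : Measure IsoPair) :=
    continuous_iff_continuousAt.2 fun u =>
      tendsto_integral_of_isSubweight_of_uniform (hF.continuous_toNNReal.tendsto u) S.continuous_W
        S.one_le_W (hF.moment_eventually u) (Gs := fun _ x => x.excess)
        (fun _ => IsoPair.continuous_excess.measurable)
        IsoPair.continuous_excess (S.isSubweight_of_le_U (φ := S.U) (B := 1)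
          fun x => by rw [abs_of_nonneg (S.U_nonneg x), one_mul])
        (Eventually.of_forall fun _ x => by
          rw [abs_of_nonneg x.excess_nonneg]; exact hS.excess_le x)
        (fun x => by rw [abs_of_nonneg x.excess_nonneg]; exact hS.excess_le x)
        fun R δ hδ => Eventually.of_forall fun _ x _ => by simpa using hδ.le
  have hgr := le_add_exp_of_hasDerivAt_le (lam := lam) (b := A / lam + δ / (2 * (M + 1)) * M) ht.le
    hcont.continuousOn (fun u hu => hF.hasDerivAt_integral hadm hgen hu.1) fun u hu => by
      have hmom := (hF.moment u.toNNReal).1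
      have hb := hbd u hu.1.le hu.2.le
      have h1 := (abs_le.1 (S.abs_weakOp_sub_le zero_le_one hadm.abs_le hmom hb
        (fun x => -(c * r x * x.excess) * 1))).2
      have hgi : Integrable (fun x : IsoPair => -(c * r x * x.excess) * 1)
          (F u.toNNReal : Measure IsoPair) :=
        (((hS.flow hρ hs).isSubweight_G.const_mul S.W_nonneg 1).mono
          (hgen.abs_le hadm)).integrable hgen.1.measurable hmom
      have h2 : ∫ x : IsoPair, -(c * r x * x.excess) * 1 ∂(F u.toNNReal : Measure IsoPair) ≤
          ∫ x : IsoPair, -lam * (x.excess - δ / (2 * (M + 1)) * S.W x)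
            ∂(F u.toNNReal : Measure IsoPair) := by
        refine integral_mono hgi
          (((hS.integrable_excess hmom).sub (hmom.const_mul _)).const_mul _) fun x => ?_
        have := mul_le_mul_of_nonneg_left (hκr x) hc0.le
        simp only [hlam]
        linarith
      rw [integral_const_mul, integral_sub (hS.integrable_excess hmom) (hmom.const_mul _),
        integral_const_mul] at h2
      have h3 : lam * (δ / (2 * (M + 1)) * ∫ x, S.W x ∂(F u.toNNReal : Measure IsoPair)) ≤
          lam * (δ / (2 * (M + 1)) * M) := by gcongr
      have h4 : lam * (A / lam) = A := by field_simp
      linarith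
  have h0 : ∫ x : IsoPair, x.excess ∂(F (Real.toNNReal 0) : Measure IsoPair) ≤ M :=
    (hS.integral_excess_le (hF.moment _).1).trans (hbd 0 le_rfl ht.le)
  have h1 : exp (-(lam * t)) ≤ 1 / (lam * t₀) := by
    rw [exp_neg, ← one_div]
    refine one_div_le_one_div_of_le (by positivity) ?_
    have := add_one_le_exp (lam * t)
    nlinarith
  have h2 : exp (-(lam * t)) * ((∫ x : IsoPair, x.excess ∂(F (Real.toNNReal 0) : Measure IsoPair)) -
      (A / lam + δ / (2 * (M + 1)) * M)) ≤ 1 / (lam * t₀) * M := by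
    have h3 : 0 ≤ A / lam + δ / (2 * (M + 1)) * M := by positivity
    calc _ ≤ exp (-(lam * t)) * M := mul_le_mul_of_nonneg_left (by linarith) (exp_pos _).le
      _ ≤ _ := mul_le_mul_of_nonneg_right h1 hM0
  have h3 : A / lam + 1 / (lam * t₀) * M = (A + M / t₀) / lam := by field_simp
  have h4 : (A + M / t₀) / lam ≤ δ / 2 := by
    rw [div_le_iff₀ hlam0]
    have h5 : 2 * (A + M / t₀) / δ ≤ lam := by linarith
    rw [div_le_iff₀ hδ] at h5
    linarith
  have h5 : δ / (2 * (M + 1)) * M ≤ δ / 2 := by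
    rw [div_mul_eq_mul_div, div_le_iff₀ (by positivity)]
    nlinarith
  linarith

end IsPowerSystem

end FastFusion

section FastFusionLimit

open scoped NNReal BoundedContinuousFunction

namespace IsoPair

/-- The sphere with the same volume. -/
noncomputable def toSphere (x : IsoPair) : IsoPair := ⟨(x.sphereArea, x.1.2), x.volume_pos, le_rfl⟩

theorem continuous_toSphere : Continuous toSphere :=
  Continuous.subtype_mk (continuous_sphereArea.prodMk continuous_volume) _

theorem dist_toSphere (x : IsoPair) : dist x x.toSphere = x.excess := by
  change dist x.1 x.toSphere.1 = x.excess
  rw [Prod.dist_eq]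
  change max (dist x.1.1 x.sphereArea) (dist x.1.2 x.1.2) = x.excess
  rw [dist_self, Real.dist_eq, ← excess, abs_of_nonneg x.excess_nonneg,
    max_eq_left x.excess_nonneg]

end IsoPair

namespace IsPowerSystem

variable {S : CoagSystem IsoPair} {p q s D : ℝ} (hS : IsPowerSystem S p q) (hs : s * p = q)
  {ρ : IsoPair → ℝ} (hρ : IsRelaxRate ρ D p s) {f₀ : Measure IsoPair}
  {F : ℝ≥0 → FiniteMeasure IsoPair}

theorem abs_integral_toSphere_sub_le (hF : (hS.flow hρ hs).IsSolution f₀ F) {φ : IsoPair → ℝ}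
    (hφ : Continuous φ) {b : ℝ} (hb0 : 0 ≤ b) (hb : ∀ x, |φ x| ≤ b) {T t u : ℝ} (ht : 0 ≤ t)
    (hu : 0 ≤ u) (htT : t ≤ T) (huT : u ≤ T) :
    |∫ x : IsoPair, φ x.toSphere ∂(F u.toNNReal : Measure IsoPair) -
      ∫ x : IsoPair, φ x.toSphere ∂(F t.toNNReal : Measure IsoPair)| ≤
      b * S.C * (S.C + 1) * |S.momentBound f₀ T| ^ 2 * |u - t| := by
  have hc := hφ.comp IsoPair.continuous_toSphere
  have hsh : ∀ (x : IsoPair) (d : ℝ), (φ ∘ IsoPair.toSphere) (x.shrink d) =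
    (φ ∘ IsoPair.toSphere) x := fun x d => rfl
  have hadm := hS.isAdm_of_shrink_eq hρ hs hb0 hc (fun x => hb _) hsh
  have hgen := hS.isGen_of_shrink_eq hρ hs hsh
  have hw := hF.continuous_weakOp_const hadm hgen
  have h1 := hF.identity _ _ _ hadm hgen u.toNNReal
  have h2 := hF.identity _ _ _ hadm hgen t.toNNReal
  rw [Real.coe_toNNReal _ hu] at h1
  rw [Real.coe_toNNReal _ ht] at h2
  have h3 := intervalIntegral.integral_interval_sub_left (μ := volume)
    (hw.intervalIntegrable 0 u) (hw.intervalIntegrable 0 t)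
  simp only [Function.comp_apply] at h1 h2
  rw [h1, h2, add_sub_add_left_eq_sub]
  change |(∫ v in (0 : ℝ)..u, S.weakOp (φ ∘ IsoPair.toSphere) _ _) -
    ∫ v in (0 : ℝ)..t, S.weakOp (φ ∘ IsoPair.toSphere) _ _| ≤ _
  rw [h3, ← Real.norm_eq_abs]
  refine intervalIntegral.norm_integral_le_of_norm_le_const fun v hv => ?_
  have hv' := uIoc_subset_uIcc hv
  have hv0 : 0 ≤ v := (le_min ht hu).trans hv'.1
  have hvT : v ≤ T := hv'.2.trans (max_le htT huT)
  have h4 := S.abs_weakOp_sub_le hb0 hadm.abs_le (hF.moment v.toNNReal).1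
    (M := |S.momentBound f₀ T|) ((hF.moment _).2.trans ((S.momentBound_mono f₀ (NNReal.coe_nonneg _)
      (by rw [Real.coe_toNNReal _ hv0]; exact hvT)).trans (le_abs_self _)))
    fun x => -(ρ x * x.excess) * 0
  simpa using h4

include hS in
theorem abs_integral_sub_toSphere_le {m : Measure IsoPair} [IsFiniteMeasure m]
    (hm : Integrable S.W m) (φ : IsoPair →ᵇ ℝ) {L : ℝ≥0} (hL : LipschitzWith L φ) :
    |∫ x, φ x ∂m - ∫ x : IsoPair, φ x.toSphere ∂m| ≤ L * ∫ x : IsoPair, x.excess ∂m := by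
  have hi : Integrable (fun x : IsoPair => φ x.toSphere) m :=
    (φ.compContinuous ⟨IsoPair.toSphere, IsoPair.continuous_toSphere⟩).integrable m
  rw [← integral_sub (φ.integrable m) hi, ← integral_const_mul, ← Real.norm_eq_abs]
  refine norm_integral_le_of_norm_le ((hS.integrable_excess hm).const_mul _)
    (ae_of_all _ fun x => ?_)
  rw [← dist_eq_norm, ← x.dist_toSphere]
  exact hL.dist_le_mul _ _

/-- Compactness of solutions in the limit of fast fusion. -/
theorem exists_fastFusion_limit {r : IsoPair → ℝ} (hr : Continuous r) (hr0 : ∀ x, 0 < r x)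
    {cs : ℕ → ℝ} (hcs : Tendsto cs atTop atTop) {Ds : ℕ → ℝ}
    (hρ : ∀ n, IsRelaxRate (fun x => cs n * r x) (Ds n) p s)
    {Fs : ℕ → ℝ≥0 → FiniteMeasure IsoPair}
    (hFs : ∀ n, (hS.flow (hρ n) hs).IsSolution f₀ (Fs n)) :
    ∃ θ : ℕ → ℕ, StrictMono θ ∧ ∃ g : Ioi (0 : ℝ) → FiniteMeasure IsoPair, Continuous g ∧
      ∀ t : Ioi (0 : ℝ), Tendsto (fun n => Fs (θ n) t.1.toNNReal) atTop (𝓝 (g t)) := by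
  have hC := S.C_nonneg
  have : Nonempty (Ioi (0 : ℝ)) := ⟨⟨1, mem_Ioi.2 one_pos⟩⟩
  refine FiniteMeasure.exists_subseq_tendsto (fun n (t : Ioi (0 : ℝ)) => Fs n t.1.toNNReal)
    (fun t => ?_) fun φ L hL t δ hδ => ?_
  · obtain ⟨A, hA, h⟩ := S.exists_isCompact_of_moment (S.momentBound f₀ (t.1.toNNReal : ℝ))
    exact ⟨A, hA, fun n => h _ ((hFs n).moment _).1 ((hFs n).moment _).2⟩
  · have ht : 0 < t.1 := t.2
    set A := ‖φ‖ * S.C * (S.C + 1) * |S.momentBound f₀ (t.1 + 1)| ^ 2 with hA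
    have hA0 : 0 ≤ A := by positivity
    obtain ⟨Λ, hΛ⟩ := hS.exists_forall_integral_excess_le hs hr hr0 f₀ (t₀ := t.1 / 2)
      (T := t.1 + 1) (half_pos ht) (show 0 < δ / (3 * (L + 1)) by positivity)
    refine ⟨min (min (t.1 / 2) 1) (δ / (3 * (A + 1))), by positivity, fun u hu => ?_⟩
    rw [Subtype.dist_eq, Real.dist_eq] at hu
    have hu1 := hu.le.trans (min_le_right _ _)
    have hu2 := abs_le.1 (hu.le.trans ((min_le_left _ _).trans (min_le_left _ _)))
    have hu3 := abs_le.1 (hu.le.trans ((min_le_left _ _).trans (min_le_right _ _)))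
    filter_upwards [hcs.eventually_ge_atTop Λ] with n hn
    have hF := hFs n
    have e1 := hΛ _ hn _ (hρ n) _ hF t.1 (by linarith) (by linarith)
    have e2 := hΛ _ hn _ (hρ n) _ hF u.1 (by linarith) (by linarith)
    have d1 := hS.abs_integral_sub_toSphere_le (hF.moment t.1.toNNReal).1 φ hL
    have d2 := hS.abs_integral_sub_toSphere_le (hF.moment u.1.toNNReal).1 φ hL
    have d3 := hS.abs_integral_toSphere_sub_le hs (hρ n) hF φ.continuous (norm_nonneg φ)
      φ.norm_coe_le_norm (T := t.1 + 1) ht.le u.2.le (by linarith) (by linarith)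
    have hL0 : ∀ e, e ≤ δ / (3 * (L + 1)) → L * e ≤ δ / 3 := fun e he => by
      have : (0 : ℝ) ≤ L := L.coe_nonneg
      calc L * e ≤ L * (δ / (3 * (L + 1))) := by gcongr
        _ ≤ (L + 1) * (δ / (3 * (L + 1))) := by gcongr; linarith
        _ = δ / 3 := by field_simp
    have hAu : A * |u.1 - t.1| ≤ δ / 3 := by
      calc _ ≤ (A + 1) * (δ / (3 * (A + 1))) := by gcongr; linarith
        _ = δ / 3 := by field_simp
    have d1' := abs_le.1 (d1.trans (hL0 _ e1))
    have d2' := abs_le.1 (d2.trans (hL0 _ e2))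
    have d3' := abs_le.1 (d3.trans hAu)
    rw [abs_le]
    constructor <;> linarith

end IsPowerSystem

end FastFusionLimit

/-- existence of weak solutions of the ε-fusion problem with uniform moment
bounds, and weak-* compactness of the family as ε → 0 (fast fusion). -/
theorem fast_fusion_compactness
    (K : ℝ × ℝ → ℝ × ℝ → ℝ) (K₀ K₁ al be : ℝ) (hK : IsCoagKernel K K₀ K₁ al be)
    (r : ℝ × ℝ → ℝ) (R₀ R₁ mu sg B : ℝ) (hr : IsFusionKernel r R₀ R₁ mu sg B)
    (hmu : 0 < mu)
    (fin : Measure (ℝ × ℝ)) (hfin_iso : IsIsoMeasure fin)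
    (hfin_mom : (∫⁻ η : ℝ × ℝ, ENNReal.ofReal
        (η.2 ^ (-(mu + 3)) + η.2 ^ (mu + 3) + η.2 ^ (sg * (mu + 3)) + η.1 ^ (mu + 3))
        ∂fin) ≠ ⊤)
    (T : ℝ) (hT : 0 < T) :
    ∃ f : ℝ → ℝ → Measure (ℝ × ℝ),
      (∀ ε ∈ Ioo (0 : ℝ) 1, IsWeakSolution K r ε⁻¹ al be fin (f ε)) ∧
      (∃ C : ℝ≥0∞, C ≠ ⊤ ∧ ∀ ε ∈ Ioo (0 : ℝ) 1, ∀ t ∈ Icc (0 : ℝ) T,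
          (∫⁻ η : ℝ × ℝ, ENNReal.ofReal
            (η.2 ^ (-(mu + 3)) + η.2 ^ (mu + 3) + η.2 ^ (sg * (mu + 3)) + η.1 ^ (mu + 3))
            ∂(f ε t)) ≤ C) ∧
      (∃ es : ℕ → ℝ, (∀ n, es n ∈ Ioo (0 : ℝ) 1) ∧ Tendsto es atTop (𝓝 0) ∧
        ∃ fbar : ℝ → Measure (ℝ × ℝ),
          (∀ t ∈ Ioc (0 : ℝ) T, IsIsoMeasure (fbar t)) ∧
          (∀ φ, IsC0Quad φ →
            ContinuousOn (fun t => ∫ η, φ η ∂(fbar t)) (Ioc (0 : ℝ) T)) ∧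
          (∀ sb > (0 : ℝ), ∀ t ∈ Icc sb T, ∀ φ, IsC0Quad φ →
            Tendsto (fun n => ∫ η, φ η ∂(f (es n) t)) atTop
              (𝓝 (∫ η, φ η ∂(fbar t))))) := by
  obtain ⟨S, hS, hSK⟩ := hK.exists_coagSystem (show 3 ≤ mu + 3 by linarith) (sg * (mu + 3))
  have hal := hK.al_pos
  have hal1 : al < 1 := by linarith [hK.be_sub_al_mem.1, hK.be_mem.2]
  set f₀ : Measure IsoPair := fin.comap Subtype.val with hf₀
  have hf₀W : Integrable S.W f₀ := by
    refine S.integrable_W_of_lintegral_momentWeight hS ?_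
    rw [← measurableEmbedding_isoPair.lintegral_map
      fun η => ENNReal.ofReal (momentWeight (mu + 3) (sg * (mu + 3)) η), hfin_iso.map_comap]
    exact hfin_mom
  have := S.isFiniteMeasure_of_integrable_W hf₀W
  have hr_cont : Continuous fun x : IsoPair => r x.1 :=
    hr.smooth.continuousOn.comp_continuous continuous_subtype_val
      fun x => isoRegion_subset_quad x.2
  have hr_pos : ∀ x : IsoPair, 0 < r x.1 := fun x => hr.pos _ (isoRegion_subset_quad x.2)
  have hρ : ∀ ε : ℝ, IsRelaxRate (fun x => |ε⁻¹| * r x.1) (|ε⁻¹| * R₁) (mu + 3) sg :=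
    fun ε => hr.isRelaxRate (abs_nonneg _)
  have hex : ∀ ε : ℝ, ∃ F, (hS.flow (hρ ε) rfl).IsSolution f₀ F := fun ε => by
    obtain ⟨F, h1, h2, h3⟩ := (hS.flow (hρ ε) rfl).exists_solution f₀ hf₀W
    exact ⟨F, h1, h2, h3⟩
  choose F hF using hex
  have hes : Tendsto (fun n : ℕ => ((n : ℝ) + 2)⁻¹) atTop (𝓝 0) :=
    tendsto_inv_atTop_zero.comp (tendsto_atTop_add_const_right _ 2 tendsto_natCast_atTop_atTop)
  have hcs : Tendsto (fun n : ℕ => |(((n : ℝ) + 2)⁻¹)⁻¹|) atTop atTop := by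
    simp only [inv_inv]
    exact tendsto_abs_atTop_atTop.comp
      (tendsto_atTop_add_const_right _ 2 tendsto_natCast_atTop_atTop)
  obtain ⟨θ, hθ, g, hg, hlim⟩ := hS.exists_fastFusion_limit rfl hr_cont hr_pos hcs
    (fun n => hρ _) fun n => hF _
  refine ⟨fun ε t => (F ε t.toNNReal : Measure IsoPair).map Subtype.val, fun ε hε => ?_,
    ⟨ENNReal.ofReal (S.momentBound f₀ T), ENNReal.ofReal_ne_top, fun ε hε t ht => ?_⟩,
    fun n => ((θ n : ℝ) + 2)⁻¹, fun n => ⟨by positivity, ?_⟩, hes.comp hθ.tendsto_atTop,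
    fun t => if ht : 0 < t then (g ⟨t, mem_Ioi.2 ht⟩ : Measure IsoPair).map Subtype.val else 0,
    fun t ht => ?_, fun φ hφ => ?_, fun sb hsb t ht φ hφ => ?_⟩
  · have h := hS.isWeakSolution (hρ ε) rfl (abs_le.2 ⟨by linarith, hal1.le⟩) hK.be_mem.1.le
      hK.be_mem.2.le hSK hfin_iso (hF ε)
    rwa [abs_of_pos (inv_pos.2 hε.1)] at h
  · refine CoagSystem.lintegral_map_le ((hF ε).moment _).1 (((hF ε).moment _).2.trans
      (S.momentBound_mono f₀ (NNReal.coe_nonneg _) ?_)) fun x => ?_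
    · rw [Real.coe_toNNReal _ ht.1]; exact ht.2
    · rw [hS.W_eq]; exact x.momentWeight_le _ _
  · exact inv_lt_one_of_one_lt₀ (by have : (0 : ℝ) ≤ θ n := Nat.cast_nonneg _; linarith)
  · simp only [dif_pos ht.1]
    exact isIsoMeasure_map _
  · rw [continuousOn_iff_continuous_domRestrict]
    have hι : Continuous fun t : Ioc (0 : ℝ) T => (⟨t.1, t.2.1⟩ : Ioi (0 : ℝ)) :=
      continuous_subtype_val.subtype_mk _
    have hc : Continuous fun t : Ioc (0 : ℝ) T =>
        ∫ η, φ η ∂((g ⟨t.1, t.2.1⟩ : Measure IsoPair).map Subtype.val) :=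
      continuous_iff_continuousAt.2 fun t => hφ.tendsto_integral_map ((hg.comp hι).tendsto t)
    refine hc.congr fun t => ?_
    simp only [Set.domRestrict_apply, dif_pos t.2.1]
  · have ht0 : 0 < t := lt_of_lt_of_le hsb ht.1
    simp only [dif_pos ht0]
    exact hφ.tendsto_integral_map (hlim ⟨t, ht0⟩)
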